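/- Let N ≥ 3 be an integer, let a, b > −2, and let p ≥ q > 0 with pq > 1. Assume that (N+a)/(p+1) + (N+b)/(q+1) > N−2. If N ≥ 4, assume in addition that 0 ≤ a−b ≤ (N−2)(p−q) and that 2(p+1)/(pq−1) > N−3. Then there exists no positive solution (u, v) of the Hardy–Hénon system on ℝ^N with both u and v bounded on ℝ^N. -/

import Mathlib

open MeasureTheory Metric Set Filter

/-- The Euclidean Laplacian of `u : ℝ^N → ℝ`, as the sum of the second derivatives
along the standard coordinate directions. -/
noncomputable def lap {N : ℕ} (u : EuclideanSpace ℝ (Fin N) → ℝ)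
    (x : EuclideanSpace ℝ (Fin N)) : ℝ :=
  ∑ i : Fin N, iteratedFDeriv ℝ 2 u x ![EuclideanSpace.single i 1, EuclideanSpace.single i 1]

/-- `(u, v)` is a positive solution of the Hardy–Hénon system
`-Δu = |x|^a v^p`, `-Δv = |x|^b u^q` on the set `Ω`:
`u, v` are continuous on `Ω`, `C²` on `Ω \ {0}`, positive on `Ω`, and
the equations hold on `Ω \ {0}`. -/
def IsHHSol {N : ℕ} (a b p q : ℝ) (Ω : Set (EuclideanSpace ℝ (Fin N)))
    (u v : EuclideanSpace ℝ (Fin N) → ℝ) : Prop :=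
  ContinuousOn u Ω ∧ ContinuousOn v Ω ∧
  ContDiffOn ℝ 2 u (Ω \ {0}) ∧ ContDiffOn ℝ 2 v (Ω \ {0}) ∧
  (∀ x ∈ Ω, 0 < u x) ∧ (∀ x ∈ Ω, 0 < v x) ∧
  (∀ x ∈ Ω \ {0}, -lap u x = ‖x‖ ^ a * v x ^ p) ∧
  (∀ x ∈ Ω \ {0}, -lap v x = ‖x‖ ^ b * u x ^ q)

/-- The partial derivative in the `i`-th coordinate direction. -/
noncomputable def pd {N : ℕ} (i : Fin N) (u : EuclideanSpace ℝ (Fin N) → ℝ)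
    (x : EuclideanSpace ℝ (Fin N)) : ℝ :=
  fderiv ℝ u x (EuclideanSpace.single i 1)

section Calculus

variable {N : ℕ} {u v : EuclideanSpace ℝ (Fin N) → ℝ} {x : EuclideanSpace ℝ (Fin N)}

lemma pd_congr {i : Fin N} (h : u =ᶠ[nhds x] v) : pd i u x = pd i v x := by
  simp only [pd, h.fderiv_eq]

lemma ContDiffAt.pd {n m : WithTop ℕ∞} {i : Fin N} (h : ContDiffAt ℝ n u x) (hm : m + 1 ≤ n) :
    ContDiffAt ℝ m (_root_.pd i u) x :=
  (h.fderiv_right hm).clm_apply contDiffAt_const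

lemma pd_add {i : Fin N} (hu : DifferentiableAt ℝ u x) (hv : DifferentiableAt ℝ v x) :
    pd i (fun y => u y + v y) x = pd i u x + pd i v x := by
  simp [pd, fderiv_fun_add hu hv]

lemma pd_sub {i : Fin N} (hu : DifferentiableAt ℝ u x) (hv : DifferentiableAt ℝ v x) :
    pd i (fun y => u y - v y) x = pd i u x - pd i v x := by
  simp [pd, fderiv_fun_sub hu hv]

lemma pd_mul {i : Fin N} (hu : DifferentiableAt ℝ u x) (hv : DifferentiableAt ℝ v x) :
    pd i (fun y => u y * v y) x = pd i u x * v x + u x * pd i v x := by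
  simp [pd, fderiv_fun_mul hu hv]; ring

lemma pd_const_mul {i : Fin N} (c : ℝ) (hu : DifferentiableAt ℝ u x) :
    pd i (fun y => c * u y) x = c * pd i u x := by
  simp [pd, fderiv_const_mul hu]

lemma pd_const {i : Fin N} (c : ℝ) : pd i (fun _ => c) x = 0 := by
  simp [pd]

lemma pd_sum {i : Fin N} {ι : Type*} (s : Finset ι) {w : ι → EuclideanSpace ℝ (Fin N) → ℝ}
    (h : ∀ j ∈ s, DifferentiableAt ℝ (w j) x) :
    pd i (fun y => ∑ j ∈ s, w j y) x = ∑ j ∈ s, pd i (w j) x := by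
  simp [pd, fderiv_fun_sum h]

lemma pd_comp {i : Fin N} {g : ℝ → ℝ} {g' : ℝ} (hg : HasDerivAt g g' (u x))
    (hu : DifferentiableAt ℝ u x) : pd i (fun y => g (u y)) x = g' * pd i u x := by
  have := (hg.comp_hasFDerivAt x hu.hasFDerivAt).fderiv
  simp only [Function.comp_def] at this
  simp [pd, this]

lemma pd_coord (i j : Fin N) : pd i (fun y : EuclideanSpace ℝ (Fin N) => y j) x =
    if i = j then 1 else 0 := by
  have : (fun y : EuclideanSpace ℝ (Fin N) => y j) = EuclideanSpace.proj (𝕜 := ℝ) j := rfl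
  rw [pd, this, ContinuousLinearMap.fderiv]
  simp [eq_comm]

lemma differentiableAt_coord (j : Fin N) :
    DifferentiableAt ℝ (fun y : EuclideanSpace ℝ (Fin N) => y j) x :=
  (EuclideanSpace.proj (𝕜 := ℝ) j).differentiableAt

lemma pd_normSq (i : Fin N) :
    pd i (fun y : EuclideanSpace ℝ (Fin N) => ‖y‖ ^ 2) x = 2 * x i := by
  have := (hasStrictFDerivAt_norm_sq x).hasFDerivAt.fderiv
  simp [pd, this, EuclideanSpace.inner_single_right]

lemma differentiableAt_normSq :
    DifferentiableAt ℝ (fun y : EuclideanSpace ℝ (Fin N) => ‖y‖ ^ 2) x :=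
  (hasStrictFDerivAt_norm_sq x).hasFDerivAt.differentiableAt

lemma pd_comm {i j : Fin N} (h : ContDiffAt ℝ 2 u x) : pd i (pd j u) x = pd j (pd i u) x := by
  have hd : DifferentiableAt ℝ (fderiv ℝ u) x :=
    (h.fderiv_right (m := 1) (by norm_num)).differentiableAt one_ne_zero
  have hs := (h.isSymmSndFDerivAt (by simp)) (EuclideanSpace.single i 1) (EuclideanSpace.single j 1)
  have key : ∀ k l : Fin N, pd k (pd l u) x
      = fderiv ℝ (fderiv ℝ u) x (EuclideanSpace.single k 1) (EuclideanSpace.single l 1) := by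
    intro k l
    have : pd l u = fun y => fderiv ℝ u y (EuclideanSpace.single l 1) := rfl
    rw [this, pd, fderiv_clm_apply hd (by fun_prop)]
    simp
  rw [key, key, hs]

lemma lap_eq (h : ContDiffAt ℝ 2 u x) : lap u x = ∑ i, pd i (pd i u) x := by
  have hd : DifferentiableAt ℝ (fderiv ℝ u) x :=
    (h.fderiv_right (m := 1) (by norm_num)).differentiableAt one_ne_zero
  refine Finset.sum_congr rfl fun i _ => ?_
  have : pd i u = fun y => fderiv ℝ u y (EuclideanSpace.single i 1) := rfl
  rw [iteratedFDeriv_two_apply, this, pd, fderiv_clm_apply hd (by fun_prop)]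
  simp

lemma lap_congr (h : u =ᶠ[nhds x] v) : lap u x = lap v x := by
  simp only [lap, (h.iteratedFDeriv ℝ 2).eq_of_nhds]

lemma differentiableAt_of_c2 (h : ContDiffAt ℝ 2 u x) : DifferentiableAt ℝ u x :=
  h.differentiableAt two_ne_zero

lemma eventually_c2 (h : ContDiffAt ℝ 2 u x) : ∀ᶠ y in nhds x, ContDiffAt ℝ 2 u y :=
  h.eventually (by simp)

lemma differentiableAt_pd {i : Fin N} (h : ContDiffAt ℝ 2 u x) : DifferentiableAt ℝ (pd i u) x :=
  (h.pd (m := 1) (by norm_num)).differentiableAt one_ne_zero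

lemma lap_mul (hu : ContDiffAt ℝ 2 u x) (hv : ContDiffAt ℝ 2 v x) :
    lap (fun y => u y * v y) x
      = u x * lap v x + 2 * (∑ i, pd i u x * pd i v x) + v x * lap u x := by
  rw [lap_eq (hu.mul hv), lap_eq hu, lap_eq hv, Finset.mul_sum, Finset.mul_sum, Finset.mul_sum,
    ← Finset.sum_add_distrib, ← Finset.sum_add_distrib]
  refine Finset.sum_congr rfl fun i _ => ?_
  have h1 : pd i (fun y => u y * v y) =ᶠ[nhds x] fun y => pd i u y * v y + u y * pd i v y := by
    filter_upwards [eventually_c2 hu, eventually_c2 hv] with y hy hy'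
    exact pd_mul (differentiableAt_of_c2 hy) (differentiableAt_of_c2 hy')
  have hu' := differentiableAt_of_c2 hu
  have hv' := differentiableAt_of_c2 hv
  have hu2 := differentiableAt_pd (i := i) hu
  have hv2 := differentiableAt_pd (i := i) hv
  rw [pd_congr h1, pd_add (hu2.fun_mul hv') (hu'.fun_mul hv2), pd_mul hu2 hv', pd_mul hu' hv2]
  ring

lemma lap_comp {g g' : ℝ → ℝ} {g'' : ℝ} (hu : ContDiffAt ℝ 2 u x) (hc : ContDiffAt ℝ 2 g (u x))
    (hg : ∀ᶠ t in nhds (u x), HasDerivAt g (g' t) t) (hg' : HasDerivAt g' g'' (u x)) :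
    lap (fun y => g (u y)) x = g'' * (∑ i, pd i u x ^ 2) + g' (u x) * lap u x := by
  rw [lap_eq (u := fun y => g (u y)) (hc.comp x hu), lap_eq hu, Finset.mul_sum, Finset.mul_sum,
    ← Finset.sum_add_distrib]
  refine Finset.sum_congr rfl fun i _ => ?_
  have h1 : pd i (fun y => g (u y)) =ᶠ[nhds x] fun y => g' (u y) * pd i u y := by
    filter_upwards [eventually_c2 hu, hu.continuousAt.eventually hg] with y hy hy'
    exact pd_comp hy' (differentiableAt_of_c2 hy)
  have hu' := differentiableAt_of_c2 hu
  have hu2 := differentiableAt_pd (i := i) hu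
  have hd : DifferentiableAt ℝ (fun y => g' (u y)) x := by
    have := (hg'.comp_hasFDerivAt x hu'.hasFDerivAt)
    simp only [Function.comp_def] at this
    exact this.differentiableAt
  rw [pd_congr h1, pd_mul hd hu2, pd_comp hg' hu']
  ring

lemma lap_add (hu : ContDiffAt ℝ 2 u x) (hv : ContDiffAt ℝ 2 v x) :
    lap (fun y => u y + v y) x = lap u x + lap v x := by
  rw [lap_eq (hu.add hv), lap_eq hu, lap_eq hv, ← Finset.sum_add_distrib]
  refine Finset.sum_congr rfl fun i _ => ?_
  have h1 : pd i (fun y => u y + v y) =ᶠ[nhds x] fun y => pd i u y + pd i v y := by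
    filter_upwards [eventually_c2 hu, eventually_c2 hv] with y hy hy'
    exact pd_add (differentiableAt_of_c2 hy) (differentiableAt_of_c2 hy')
  rw [pd_congr h1, pd_add (differentiableAt_pd hu) (differentiableAt_pd hv)]

lemma lap_const_mul (c : ℝ) (hu : ContDiffAt ℝ 2 u x) :
    lap (fun y => c * u y) x = c * lap u x := by
  rw [lap_eq (contDiffAt_const.mul hu), lap_eq hu, Finset.mul_sum]
  refine Finset.sum_congr rfl fun i _ => ?_
  have h1 : pd i (fun y => c * u y) =ᶠ[nhds x] fun y => c * pd i u y := by
    filter_upwards [eventually_c2 hu] with y hy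
    exact pd_const_mul c (differentiableAt_of_c2 hy)
  rw [pd_congr h1, pd_const_mul c (differentiableAt_pd hu)]

lemma pd_translate (i : Fin N) (a : EuclideanSpace ℝ (Fin N)) :
    pd i (fun y => u (y - a)) x = pd i u (x - a) := by
  simp [pd, fderiv_comp_sub]

lemma lap_translate (a : EuclideanSpace ℝ (Fin N)) (hu : ContDiffAt ℝ 2 u (x - a)) :
    lap (fun y => u (y - a)) x = lap u (x - a) := by
  rw [lap_eq (u := fun y => u (y - a)) (hu.comp (f := fun y => y - a) x (by fun_prop)), lap_eq hu]
  refine Finset.sum_congr rfl fun i _ => ?_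
  have : pd i (fun y => u (y - a)) = fun y => pd i u (y - a) := funext fun y => pd_translate i a
  rw [this, pd_translate (u := pd i u)]

lemma pd_smul_arg (i : Fin N) (R : ℝ) :
    pd i (fun y => u (R • y)) x = R * pd i u (R • x) := by
  simp [pd, fderiv_comp_smul]

lemma lap_smul_arg (R : ℝ) (hu : ContDiffAt ℝ 2 u (R • x)) :
    lap (fun y => u (R • y)) x = R ^ 2 * lap u (R • x) := by
  rw [lap_eq (u := fun y => u (R • y)) (hu.comp (f := fun y => R • y) x (by fun_prop)),
    lap_eq hu, Finset.mul_sum]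
  refine Finset.sum_congr rfl fun i _ => ?_
  have : pd i (fun y => u (R • y)) = fun y => R * pd i u (R • y) :=
    funext fun y => pd_smul_arg i R
  have hd : DifferentiableAt ℝ (fun y => pd i u (R • y)) x :=
    DifferentiableAt.comp (g := pd i u) (f := fun y => R • y) x
      (differentiableAt_pd hu) (by fun_prop)
  rw [this, pd_const_mul _ hd, pd_smul_arg (u := pd i u)]
  ring

lemma lap_pd {i : Fin N} (h : ContDiffAt ℝ 3 u x) : lap (pd i u) x = pd i (lap u) x := by
  have h2 : ContDiffAt ℝ 2 u x := h.of_le (by norm_num)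
  have hev : ∀ᶠ y in nhds x, ContDiffAt ℝ 3 u y := h.eventually (by simp)
  have e1 : lap u =ᶠ[nhds x] fun y => ∑ j, pd j (pd j u) y := by
    filter_upwards [eventually_c2 h2] with y hy using lap_eq hy
  have hp : ∀ j, ContDiffAt ℝ 2 (pd j u) x := fun j => h.pd (by norm_num)
  rw [pd_congr e1, pd_sum _ fun j _ => differentiableAt_pd (hp j), lap_eq (hp i)]
  refine Finset.sum_congr rfl fun j _ => ?_
  have e2 : pd j (pd i u) =ᶠ[nhds x] pd i (pd j u) := by
    filter_upwards [eventually_c2 h2] with y hy using pd_comm hy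
  rw [pd_congr e2, pd_comm (hp j)]

lemma pd_eq_zero_of_notMem_tsupport {i : Fin N} (h : x ∉ tsupport u) : pd i u x = 0 := by
  simp [pd, image_eq_zero_of_notMem_tsupport (fun hx => h (tsupport_fderiv_subset ℝ hx))]

lemma tsupport_pd_subset {i : Fin N} : tsupport (pd i u) ⊆ tsupport u :=
  closure_minimal (fun y hy => by
    by_contra h; exact hy (pd_eq_zero_of_notMem_tsupport h)) (isClosed_tsupport u)

lemma lap_eq_zero_of_notMem_tsupport (h : x ∉ tsupport u) : lap u x = 0 := by
  have : u =ᶠ[nhds x] fun _ => 0 := by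
    filter_upwards [(isClosed_tsupport u).isOpen_compl.mem_nhds h] with y hy
    exact image_eq_zero_of_notMem_tsupport hy
  rw [lap_congr this, lap_eq contDiffAt_const]
  have h0 : ∀ i : Fin N, pd i (fun _ : EuclideanSpace ℝ (Fin N) => (0 : ℝ)) = fun _ => 0 :=
    fun i => funext fun y => pd_const 0
  simp [h0]

lemma continuous_mul_of_tsupport (hu : ∀ x ∈ tsupport v, ContinuousAt u x) (hv : Continuous v) :
    Continuous fun x => u x * v x := by
  rw [continuous_iff_continuousAt]
  intro x
  by_cases hx : x ∈ tsupport v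
  · exact (hu x hx).mul hv.continuousAt
  · have : (fun y => u y * v y) =ᶠ[nhds x] fun _ => 0 := by
      filter_upwards [(isClosed_tsupport v).isOpen_compl.mem_nhds hx] with y hy
      rw [image_eq_zero_of_notMem_tsupport hy, mul_zero]
    exact this.continuousAt

lemma integrable_mul_of_tsupport (hu : ∀ x ∈ tsupport v, ContinuousAt u x) (hv : Continuous v)
    (hc : HasCompactSupport v) : Integrable fun x => u x * v x :=
  (continuous_mul_of_tsupport hu hv).integrable_of_hasCompactSupport hc.mul_left

lemma ContDiff.continuous_pd {i : Fin N} (h : ContDiff ℝ 1 u) : Continuous (_root_.pd i u) :=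
  (h.continuous_fderiv one_ne_zero).clm_apply continuous_const

lemma HasCompactSupport.pd {i : Fin N} (h : HasCompactSupport u) :
    HasCompactSupport (_root_.pd i u) :=
  h.mono' ((subset_tsupport _).trans tsupport_pd_subset)

lemma integral_mul_pd {i : Fin N} (hu : ∀ x ∈ tsupport v, ContDiffAt ℝ 1 u x)
    (hv : ContDiff ℝ 1 v) (hc : HasCompactSupport v) :
    ∫ x, u x * pd i v x = -∫ x, pd i u x * v x := by
  refine integral_mul_fderiv_eq_neg_fderiv_mul_of_integrable ?_ ?_ ?_ ?_ ?_
  · exact integrable_mul_of_tsupport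
      (fun x hx => ((hu x hx).pd (i := i) (m := 0) (by norm_num)).continuousAt) hv.continuous hc
  · exact integrable_mul_of_tsupport (v := pd i v)
      (fun x hx => (hu x (tsupport_pd_subset hx)).continuousAt) hv.continuous_pd hc.pd
  · exact integrable_mul_of_tsupport (fun x hx => (hu x hx).continuousAt) hv.continuous hc
  · exact fun x hx => (hu x hx).differentiableAt one_ne_zero
  · exact fun x _ => hv.differentiable one_ne_zero x

lemma ContDiff.pd {n m : WithTop ℕ∞} {i : Fin N} (h : ContDiff ℝ n u) (hm : m + 1 ≤ n) :
    ContDiff ℝ m (_root_.pd i u) :=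
  contDiff_iff_contDiffAt.2 fun _ => h.contDiffAt.pd hm

lemma integral_mul_lap (hu : ∀ x ∈ tsupport v, ContDiffAt ℝ 2 u x)
    (hv : ContDiff ℝ 2 v) (hc : HasCompactSupport v) :
    ∫ x, u x * lap v x = ∫ x, lap u x * v x := by
  have hvi : ∀ i, ContDiff ℝ 1 (pd i v) := fun i => hv.pd (by norm_num)
  have e1 : ∀ x, u x * lap v x = ∑ i, u x * pd i (pd i v) x := fun x => by
    rw [lap_eq hv.contDiffAt, Finset.mul_sum]
  have e2 : ∀ x, lap u x * v x = ∑ i, pd i (pd i u) x * v x := fun x => by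
    by_cases hx : x ∈ tsupport v
    · rw [lap_eq (hu x hx), Finset.sum_mul]
    · simp [image_eq_zero_of_notMem_tsupport hx]
  simp only [e1, e2]
  rw [integral_finsetSum, integral_finsetSum]
  · refine Finset.sum_congr rfl fun i _ => ?_
    have h1 := integral_mul_pd (i := i) (u := u) (v := pd i v)
      (fun x hx => (hu x (tsupport_pd_subset hx)).of_le (by norm_num)) (hvi i) hc.pd
    have h2 := integral_mul_pd (i := i) (u := pd i u) (v := v)
      (fun x hx => (hu x hx).pd (by norm_num)) (hv.of_le (by norm_num)) hc
    rw [h1, h2, neg_neg]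
  · intro i _
    exact integrable_mul_of_tsupport (fun x hx => ((hu x hx).pd (i := i) (m := 1)
      (by norm_num)).pd (i := i) (m := 0) (by norm_num) |>.continuousAt) hv.continuous hc
  · intro i _
    exact integrable_mul_of_tsupport (v := pd i (pd i v))
      (fun x hx => (hu x (tsupport_pd_subset (tsupport_pd_subset hx))).continuousAt)
      (hvi i).continuous_pd hc.pd.pd

end Calculus

/-- A smooth bump on `ℝ` supported in `[1/4, 1]` and equal to `1` on `[3/8, 7/8]`. -/
noncomputable def radialBump : ContDiffBump (5 / 8 : ℝ) :=
  ⟨1 / 4, 3 / 8, by norm_num, by norm_num⟩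

/-- A smooth step: the primitive of `radialBump`. -/
noncomputable def radialStep (s : ℝ) : ℝ := ∫ τ in (0 : ℝ)..s, radialBump τ

lemma radialBump_contDiff {n : ℕ∞} : ContDiff ℝ n (radialBump : ℝ → ℝ) := radialBump.contDiff

lemma radialBump_continuous : Continuous (radialBump : ℝ → ℝ) := radialBump.continuous

lemma radialBump_nonneg (s : ℝ) : 0 ≤ radialBump s := radialBump.nonneg

lemma radialBump_le_one (s : ℝ) : radialBump s ≤ 1 := radialBump.le_one

lemma radialBump_eq_zero {s : ℝ} (h : s ≤ 1 / 4 ∨ 1 ≤ s) : radialBump s = 0 := by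
  refine radialBump.zero_of_le_dist ?_
  simp only [radialBump, Real.dist_eq]
  rcases h with h | h
  · rw [abs_of_nonpos (by linarith)]; linarith
  · rw [abs_of_nonneg (by linarith)]; linarith

lemma radialBump_eq_one {s : ℝ} (h : 3 / 8 ≤ s) (h' : s ≤ 7 / 8) : radialBump s = 1 := by
  refine radialBump.one_of_mem_closedBall ?_
  simp only [radialBump, mem_closedBall, Real.dist_eq, abs_le]
  constructor <;> linarith

lemma radialStep_hasDerivAt (s : ℝ) : HasDerivAt radialStep (radialBump s) s :=
  (radialBump_continuous.integral_hasStrictDerivAt 0 s).hasDerivAt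

lemma radialStep_contDiff : ContDiff ℝ (⊤ : ℕ∞) radialStep := by
  rw [contDiff_infty_iff_deriv]
  refine ⟨fun s => (radialStep_hasDerivAt s).differentiableAt, ?_⟩
  have : deriv radialStep = radialBump := funext fun s => (radialStep_hasDerivAt s).deriv
  rw [this]
  exact radialBump_contDiff

lemma radialStep_mono : Monotone radialStep :=
  monotone_of_hasDerivAt_nonneg (fun s => radialStep_hasDerivAt s) (fun s => radialBump_nonneg s)

lemma radialStep_eq_zero {s : ℝ} (h : s ≤ 1 / 4) : radialStep s = 0 := by
  rw [radialStep, intervalIntegral.integral_congr (g := fun _ => 0)]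
  · simp
  · intro t ht
    refine radialBump_eq_zero (Or.inl ?_)
    exact ht.2.trans (max_le (by norm_num) h)

lemma radialStep_sub (s t : ℝ) : radialStep t - radialStep s = ∫ τ in s..t, radialBump τ :=
  intervalIntegral.integral_interval_sub_left (radialBump_continuous.intervalIntegrable _ _)
    (radialBump_continuous.intervalIntegrable _ _)

lemma radialStep_eq {s : ℝ} (h : 1 ≤ s) : radialStep s = radialStep 1 := by
  have : radialStep s - radialStep 1 = 0 := by
    rw [radialStep_sub, intervalIntegral.integral_congr (g := fun _ => 0)]
    · simp
    · intro t ht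
      rw [uIcc_of_le h] at ht
      exact radialBump_eq_zero (Or.inr ht.1)
  linarith

lemma radialStep_nonneg (s : ℝ) : 0 ≤ radialStep s := by
  rcases le_total s (1 / 4) with h | h
  · rw [radialStep_eq_zero h]
  · rw [← radialStep_eq_zero le_rfl]; exact radialStep_mono h

lemma radialStep_le_one (s : ℝ) : radialStep s ≤ 1 := by
  have h1 : radialStep 1 ≤ 1 := by
    have := intervalIntegral.integral_mono_on (a := 0) (b := 1) (μ := volume) (by norm_num)
      (radialBump_continuous.intervalIntegrable _ _)
      (continuous_const.intervalIntegrable _ _) (fun t _ => radialBump_le_one t)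
    simpa [radialStep] using this
  rcases le_total s 1 with h | h
  · exact (radialStep_mono h).trans h1
  · rwa [radialStep_eq h]

lemma half_le_radialStep_one : 1 / 2 ≤ radialStep 1 := by
  have h1 : radialStep (7 / 8) - radialStep (3 / 8) = 1 / 2 := by
    rw [radialStep_sub, intervalIntegral.integral_congr (g := fun _ => 1)]
    · simp; norm_num
    · intro t ht
      rw [uIcc_of_le (by norm_num)] at ht
      exact radialBump_eq_one ht.1 ht.2
  have h2 := radialStep_nonneg (3 / 8)
  have h3 := radialStep_mono (show (7 / 8 : ℝ) ≤ 1 by norm_num)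
  linarith

/-- The negative derivative of the radial profile `kerProfile`. -/
noncomputable def kerSlope (N : ℕ) (r R s : ℝ) : ℝ :=
  s ^ (-((N : ℝ) / 2)) * (radialStep (s / r ^ 2) - radialStep (s / R ^ 2))

section Slope

variable {N : ℕ} {r R s : ℝ}

lemma kerSlope_eq_zero_of_le (hr : 0 < r) (hrR : r ≤ R) (h : s ≤ r ^ 2 / 4) :
    kerSlope N r R s = 0 := by
  have hR : 0 < R := hr.trans_le hrR
  rw [kerSlope, radialStep_eq_zero, radialStep_eq_zero]
  · simp
  · rw [div_le_iff₀ (by positivity)]; nlinarith [pow_le_pow_left₀ hr.le hrR 2]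
  · rw [div_le_iff₀ (by positivity)]; linarith

lemma kerSlope_eq_zero_of_ge (hr : 0 < r) (hrR : r ≤ R) (h : R ^ 2 ≤ s) :
    kerSlope N r R s = 0 := by
  have hR : 0 < R := hr.trans_le hrR
  rw [kerSlope, radialStep_eq (s := s / r ^ 2), radialStep_eq (s := s / R ^ 2)]
  · simp
  · rw [le_div_iff₀ (by positivity)]; linarith
  · rw [le_div_iff₀ (by positivity)]; nlinarith [pow_le_pow_left₀ hr.le hrR 2]

lemma kerSlope_nonneg (hr : 0 < r) (hrR : r ≤ R) (s : ℝ) : 0 ≤ kerSlope N r R s := by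
  have hR : 0 < R := hr.trans_le hrR
  rcases le_total s (r ^ 2 / 4) with h | h
  · rw [kerSlope_eq_zero_of_le hr hrR h]
  · have hs : 0 < s := by
      have : 0 < r ^ 2 / 4 := by positivity
      linarith
    refine mul_nonneg (by positivity) (sub_nonneg.2 (radialStep_mono ?_))
    gcongr

lemma kerSlope_le (hs : 0 ≤ s) : kerSlope N r R s ≤ s ^ (-((N : ℝ) / 2)) := by
  refine mul_le_of_le_one_right (by positivity) ?_
  linarith [radialStep_le_one (s / r ^ 2), radialStep_nonneg (s / R ^ 2)]

lemma kerSlope_contDiff (hr : 0 < r) (hrR : r ≤ R) : ContDiff ℝ (⊤ : ℕ∞) (kerSlope N r R) := by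
  rw [contDiff_iff_contDiffAt]
  intro s
  rcases lt_or_ge 0 s with h | h
  · have h1 : ContDiffAt ℝ (⊤ : ℕ∞) (fun s : ℝ => s ^ (-((N : ℝ) / 2))) s :=
      Real.contDiffAt_rpow_const_of_ne h.ne'
    have h2 : ContDiff ℝ (⊤ : ℕ∞) fun s : ℝ => radialStep (s / r ^ 2) - radialStep (s / R ^ 2) :=
      (radialStep_contDiff.comp (contDiff_id.div_const _)).sub
        (radialStep_contDiff.comp (contDiff_id.div_const _))
    exact h1.mul h2.contDiffAt
  · have : kerSlope N r R =ᶠ[nhds s] fun _ => 0 := by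
      have h0 : 0 < r ^ 2 / 4 := by positivity
      filter_upwards [Iio_mem_nhds (h.trans_lt h0)] with t ht
      exact kerSlope_eq_zero_of_le hr hrR ht.le
    exact contDiffAt_const.congr_of_eventuallyEq this

lemma kerSlope_hasDerivAt (hs : 0 < s) : HasDerivAt (kerSlope N r R)
    (-((N : ℝ) / 2) * s⁻¹ * kerSlope N r R s + s ^ (-((N : ℝ) / 2)) *
      (radialBump (s / r ^ 2) / r ^ 2 - radialBump (s / R ^ 2) / R ^ 2)) s := by
  have h1 := Real.hasDerivAt_rpow_const (x := s) (p := -((N : ℝ) / 2)) (Or.inl hs.ne')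
  have h2 := ((radialStep_hasDerivAt (s / r ^ 2)).comp s ((hasDerivAt_id s).div_const (r ^ 2))).sub
    ((radialStep_hasDerivAt (s / R ^ 2)).comp s ((hasDerivAt_id s).div_const (R ^ 2)))
  refine (h1.mul h2).congr_deriv ?_
  simp only [kerSlope, Function.comp_def, Pi.sub_apply, id]
  rw [Real.rpow_sub_one hs.ne']
  ring

end Slope

/-- The radial profile of the truncated fundamental solution, as a function of `|z|²`. -/
noncomputable def kerProfile (N : ℕ) (r R s : ℝ) : ℝ := ∫ τ in s..R ^ 2, kerSlope N r R τ

section Profile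

variable {N : ℕ} {r R s : ℝ}

lemma kerProfile_hasDerivAt (hr : 0 < r) (hrR : r ≤ R) (s : ℝ) :
    HasDerivAt (kerProfile N r R) (-kerSlope N r R s) s := by
  have hc := (kerSlope_contDiff (N := N) hr hrR).continuous
  exact intervalIntegral.integral_hasDerivAt_left (hc.intervalIntegrable _ _)
    hc.stronglyMeasurable.stronglyMeasurableAtFilter hc.continuousAt

lemma kerProfile_contDiff (hr : 0 < r) (hrR : r ≤ R) : ContDiff ℝ (⊤ : ℕ∞) (kerProfile N r R) := by
  rw [contDiff_infty_iff_deriv]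
  refine ⟨fun s => (kerProfile_hasDerivAt hr hrR s).differentiableAt, ?_⟩
  have : deriv (kerProfile N r R) = fun s => -kerSlope N r R s :=
    funext fun s => (kerProfile_hasDerivAt hr hrR s).deriv
  rw [this]
  exact (kerSlope_contDiff hr hrR).neg

lemma kerProfile_eq_zero (hr : 0 < r) (hrR : r ≤ R) (h : R ^ 2 ≤ s) : kerProfile N r R s = 0 := by
  rw [kerProfile, intervalIntegral.integral_congr (g := fun _ => 0)]
  · simp
  · intro t ht
    rw [uIcc_of_ge h] at ht
    exact kerSlope_eq_zero_of_ge hr hrR ht.1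

lemma kerProfile_nonneg (hr : 0 < r) (hrR : r ≤ R) (s : ℝ) : 0 ≤ kerProfile N r R s := by
  rcases le_total (R ^ 2) s with h | h
  · rw [kerProfile_eq_zero hr hrR h]
  · exact intervalIntegral.integral_nonneg h fun t _ => kerSlope_nonneg hr hrR t

lemma kerProfile_le (hN : 3 ≤ N) (hr : 0 < r) (hrR : r ≤ R) (hs : 0 < s) :
    kerProfile N r R s ≤ 2 * s ^ (1 - (N : ℝ) / 2) := by
  rcases le_total (R ^ 2) s with h | h
  · rw [kerProfile_eq_zero hr hrR h]; positivity
  have hN' : (3 : ℝ) ≤ N := by exact_mod_cast hN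
  have hc := (kerSlope_contDiff (N := N) hr hrR).continuous
  have h0 : (0 : ℝ) ∉ uIcc s (R ^ 2) := by
    rw [uIcc_of_le h]; exact fun h' => absurd h'.1 (not_le.2 hs)
  have h1 : kerProfile N r R s ≤ ∫ τ in s..R ^ 2, τ ^ (-((N : ℝ) / 2)) := by
    refine intervalIntegral.integral_mono_on h (hc.intervalIntegrable _ _)
      (intervalIntegral.intervalIntegrable_rpow (Or.inr h0)) fun t ht => ?_
    exact kerSlope_le (hs.le.trans ht.1)
  rw [integral_rpow (Or.inr ⟨by linarith, h0⟩)] at h1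
  have e : -((N : ℝ) / 2) + 1 = -((N : ℝ) / 2 - 1) := by ring
  have e' : 1 - (N : ℝ) / 2 = -((N : ℝ) / 2 - 1) := by ring
  rw [e] at h1
  rw [e']
  set A := (R ^ 2) ^ (-((N : ℝ) / 2 - 1))
  set S := s ^ (-((N : ℝ) / 2 - 1))
  have hA : 0 ≤ A := by positivity
  have hS : 0 ≤ S := by positivity
  have h2 : (A - S) / -((N : ℝ) / 2 - 1) = (S - A) / ((N : ℝ) / 2 - 1) := by
    rw [div_neg, ← neg_div]; ring
  rw [h2] at h1
  refine h1.trans ?_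
  rw [div_le_iff₀ (by linarith)]
  nlinarith

lemma le_kerProfile (hr : 0 < r) (hrR : 8 * r ≤ R) (hs : s ≤ R ^ 2 / 16) :
    3 / 32 * (R ^ 2) ^ (1 - (N : ℝ) / 2) ≤ kerProfile N r R s := by
  have hR : 0 < R := by linarith
  have hrR' : r ≤ R := by linarith
  have hc := (kerSlope_contDiff (N := N) hr hrR').continuous
  have hi : ∀ x y, IntervalIntegrable (kerSlope N r R) volume x y :=
    fun x y => hc.intervalIntegrable _ _
  have e : kerProfile N r R s = (∫ τ in s..R ^ 2 / 16, kerSlope N r R τ) +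
      ((∫ τ in R ^ 2 / 16..R ^ 2 / 4, kerSlope N r R τ) +
        ∫ τ in R ^ 2 / 4..R ^ 2, kerSlope N r R τ) := by
    rw [intervalIntegral.integral_add_adjacent_intervals (hi _ _) (hi _ _),
      intervalIntegral.integral_add_adjacent_intervals (hi _ _) (hi _ _), kerProfile]
  have hR2 : 0 < R ^ 2 := by positivity
  have h1 : 0 ≤ ∫ τ in s..R ^ 2 / 16, kerSlope N r R τ :=
    intervalIntegral.integral_nonneg hs fun t _ => kerSlope_nonneg hr hrR' t
  have h3 : 0 ≤ ∫ τ in R ^ 2 / 4..R ^ 2, kerSlope N r R τ :=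
    intervalIntegral.integral_nonneg (by linarith) fun t _ => kerSlope_nonneg hr hrR' t
  have h2 : ∫ _ in R ^ 2 / 16..R ^ 2 / 4, (R ^ 2) ^ (-((N : ℝ) / 2)) * (1 / 2)
      ≤ ∫ τ in R ^ 2 / 16..R ^ 2 / 4, kerSlope N r R τ := by
    refine intervalIntegral.integral_mono_on (by linarith)
      (continuous_const.intervalIntegrable _ _) (hi _ _) fun t ht => ?_
    have ht0 : 0 < t := by linarith [ht.1]
    have s1 : radialStep (t / r ^ 2) = radialStep 1 := by
      refine radialStep_eq ?_
      rw [le_div_iff₀ (by positivity)]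
      nlinarith [ht.1, pow_le_pow_left₀ (by positivity) hrR 2]
    have s2 : radialStep (t / R ^ 2) = 0 := by
      refine radialStep_eq_zero ?_
      rw [div_le_iff₀ (by positivity)]
      linarith [ht.2]
    rw [kerSlope, s1, s2, sub_zero]
    refine mul_le_mul ?_ half_le_radialStep_one (by norm_num) (by positivity)
    exact Real.rpow_le_rpow_of_nonpos ht0 (by linarith [ht.2])
      (by simp only [Left.neg_nonpos_iff]; positivity)
  rw [intervalIntegral.integral_const, smul_eq_mul] at h2
  have e2 : (R ^ 2) ^ (1 - (N : ℝ) / 2) = R ^ 2 * (R ^ 2) ^ (-((N : ℝ) / 2)) := by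
    rw [sub_eq_add_neg, Real.rpow_add hR2, Real.rpow_one]
  rw [e2, e]
  nlinarith

end Profile

section Kernel

variable {N : ℕ}

/-- A truncation, at radii `r < R`, of the fundamental solution of `-Δ`. -/
noncomputable def truncKer (r R : ℝ) (z : EuclideanSpace ℝ (Fin N)) : ℝ :=
  kerProfile N r R (‖z‖ ^ 2)

/-- The unscaled shell averaging kernel. -/
noncomputable def unitShell (z : EuclideanSpace ℝ (Fin N)) : ℝ :=
  4 * (‖z‖ ^ 2) ^ (1 - (N : ℝ) / 2) * radialBump (‖z‖ ^ 2)

/-- The averaging kernel on the shell of radius comparable to `R`. -/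
noncomputable def shellKer (R : ℝ) (z : EuclideanSpace ℝ (Fin N)) : ℝ :=
  (R ^ N)⁻¹ * unitShell (R⁻¹ • z)

variable {r R : ℝ} {z : EuclideanSpace ℝ (Fin N)}

lemma normSq_rpow (α : ℝ) : (‖z‖ ^ 2) ^ α = ‖z‖ ^ (2 * α) := by
  rw [Real.rpow_mul (norm_nonneg z)]; norm_cast

lemma truncKer_contDiff (hr : 0 < r) (hrR : r ≤ R) {n : ℕ∞} :
    ContDiff ℝ n (truncKer r R : EuclideanSpace ℝ (Fin N) → ℝ) :=
  ((kerProfile_contDiff hr hrR).of_le (by exact_mod_cast le_top)).comp (contDiff_norm_sq ℝ)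

lemma truncKer_eq_zero (hr : 0 < r) (hrR : r ≤ R) (h : R ≤ ‖z‖) : truncKer r R z = 0 :=
  kerProfile_eq_zero hr hrR (pow_le_pow_left₀ (hr.le.trans hrR) h 2)

lemma tsupport_truncKer (hr : 0 < r) (hrR : r ≤ R) :
    tsupport (truncKer r R : EuclideanSpace ℝ (Fin N) → ℝ) ⊆ closedBall 0 R := by
  refine closure_minimal (fun z hz => ?_) isClosed_closedBall
  by_contra h
  rw [mem_closedBall_zero_iff, not_le] at h
  exact hz (truncKer_eq_zero hr hrR h.le)

lemma truncKer_hasCompactSupport (hr : 0 < r) (hrR : r ≤ R) :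
    HasCompactSupport (truncKer r R : EuclideanSpace ℝ (Fin N) → ℝ) :=
  (isCompact_closedBall 0 R).of_isClosed_subset (isClosed_tsupport _) (tsupport_truncKer hr hrR)

lemma truncKer_nonneg (hr : 0 < r) (hrR : r ≤ R) : 0 ≤ truncKer r R z :=
  kerProfile_nonneg hr hrR _

lemma truncKer_le (hN : 3 ≤ N) (hr : 0 < r) (hrR : r ≤ R) (hz : z ≠ 0) :
    truncKer r R z ≤ 2 * ‖z‖ ^ (2 - (N : ℝ)) := by
  have h := kerProfile_le hN hr hrR (s := ‖z‖ ^ 2) (by positivity)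
  rwa [normSq_rpow, show 2 * (1 - (N : ℝ) / 2) = 2 - N by ring] at h

lemma le_truncKer (hr : 0 < r) (hrR : 8 * r ≤ R) (hz : ‖z‖ ≤ R / 4) :
    3 / 32 * R ^ (2 - (N : ℝ)) ≤ truncKer r R z := by
  have hR : 0 < R := by linarith
  have h := le_kerProfile (N := N) hr hrR (s := ‖z‖ ^ 2)
    (by nlinarith [pow_le_pow_left₀ (norm_nonneg z) hz 2])
  rwa [show (R ^ 2) ^ (1 - (N : ℝ) / 2) = R ^ (2 - (N : ℝ)) by
    rw [show 2 - (N : ℝ) = 2 * (1 - (N : ℝ) / 2) by ring, Real.rpow_mul hR.le]; norm_cast] at h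

lemma abs_coord_le (i : Fin N) : |z i| ≤ ‖z‖ := by
  have := EuclideanSpace.norm_sq_eq z
  refine abs_le_of_sq_le_sq ?_ (norm_nonneg z)
  rw [this]
  have h2 := Finset.single_le_sum (f := fun j => ‖z j‖ ^ 2) (fun j _ => sq_nonneg _)
    (Finset.mem_univ i)
  simpa using h2

lemma pd_truncKer (hr : 0 < r) (hrR : r ≤ R) (i : Fin N) :
    pd i (truncKer r R) z = -(2 * z i * kerSlope N r R (‖z‖ ^ 2)) := by
  have := pd_comp (i := i) (u := fun y : EuclideanSpace ℝ (Fin N) => ‖y‖ ^ 2)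
    (kerProfile_hasDerivAt (N := N) hr hrR (‖z‖ ^ 2)) differentiableAt_normSq
  rw [pd_normSq] at this
  rw [show truncKer r R = fun y : EuclideanSpace ℝ (Fin N) => kerProfile N r R (‖y‖ ^ 2) from rfl,
    this]
  ring

lemma abs_pd_truncKer_le (hr : 0 < r) (hrR : r ≤ R) (i : Fin N) (hz : z ≠ 0) :
    |pd i (truncKer r R) z| ≤ 2 * ‖z‖ ^ (1 - (N : ℝ)) := by
  have hz' : 0 < ‖z‖ := norm_pos_iff.2 hz
  have hk := kerSlope_nonneg (N := N) hr hrR (‖z‖ ^ 2)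
  rw [pd_truncKer hr hrR, abs_neg, abs_mul, abs_mul, abs_of_nonneg hk, abs_two]
  have h1 := kerSlope_le (N := N) (r := r) (R := R) (s := ‖z‖ ^ 2) (by positivity)
  rw [normSq_rpow] at h1
  have h2 : ‖z‖ ^ (1 - (N : ℝ)) = ‖z‖ * ‖z‖ ^ (2 * -((N : ℝ) / 2)) := by
    rw [show 1 - (N : ℝ) = 1 + 2 * -((N : ℝ) / 2) by ring, Real.rpow_add hz', Real.rpow_one]
  rw [h2, mul_assoc]
  have := mul_le_mul (abs_coord_le (z := z) i) h1 hk hz'.le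
  linarith

lemma pd_truncKer_eq_zero (hr : 0 < r) (hrR : r ≤ R) (i : Fin N) (h : R ≤ ‖z‖) :
    pd i (truncKer r R) z = 0 := by
  rw [pd_truncKer hr hrR, kerSlope_eq_zero_of_ge hr hrR
    (pow_le_pow_left₀ (hr.le.trans hrR) h 2)]
  ring

lemma unitShell_contDiff {n : ℕ∞} :
    ContDiff ℝ n (unitShell : EuclideanSpace ℝ (Fin N) → ℝ) := by
  rw [contDiff_iff_contDiffAt]
  intro z
  have hq : ContDiffAt ℝ n (fun y : EuclideanSpace ℝ (Fin N) => ‖y‖ ^ 2) z :=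
    (contDiff_norm_sq ℝ).contDiffAt
  by_cases hz : z = 0
  · have : unitShell =ᶠ[nhds z] fun _ => 0 := by
      have hc : ContinuousAt (fun y : EuclideanSpace ℝ (Fin N) => ‖y‖ ^ 2) z := hq.continuousAt
      filter_upwards [hc.eventually_lt_const (u := 1 / 4) (by simp [hz])] with y hy
      rw [unitShell, radialBump_eq_zero (Or.inl (le_of_lt hy)), mul_zero]
    exact contDiffAt_const.congr_of_eventuallyEq this
  · have h1 : ContDiffAt ℝ n (fun s : ℝ => s ^ (1 - (N : ℝ) / 2)) (‖z‖ ^ 2) :=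
      Real.contDiffAt_rpow_const_of_ne (by positivity)
    exact (contDiffAt_const.mul (h1.comp z hq)).mul (radialBump_contDiff.contDiffAt.comp z hq)

lemma shellKer_contDiff {n : ℕ∞} :
    ContDiff ℝ n (shellKer R : EuclideanSpace ℝ (Fin N) → ℝ) :=
  contDiff_const.mul (unitShell_contDiff.comp (contDiff_const_smul _))

lemma shellKer_eq (hR : 0 < R) : shellKer R z =
    4 * (‖z‖ ^ 2) ^ (1 - (N : ℝ) / 2) * radialBump (‖z‖ ^ 2 / R ^ 2) / R ^ 2 := by
  have h1 : ‖R⁻¹ • z‖ ^ 2 = ‖z‖ ^ 2 / R ^ 2 := by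
    rw [norm_smul, mul_pow, norm_inv, Real.norm_of_nonneg hR.le, inv_pow]; ring
  have h2 : (R ^ 2) ^ (1 - (N : ℝ) / 2) = R ^ 2 / R ^ N := by
    rw [Real.rpow_sub (by positivity), Real.rpow_one]
    congr 1
    rw [← Real.rpow_natCast, ← Real.rpow_mul hR.le, ← Real.rpow_natCast]
    congr 1; push_cast; ring
  rw [shellKer, unitShell, h1, Real.div_rpow (by positivity) (by positivity), h2]
  field_simp

lemma shellKer_nonneg (hR : 0 < R) : 0 ≤ shellKer R z := by
  rw [shellKer_eq hR]
  have := radialBump_nonneg (‖z‖ ^ 2 / R ^ 2)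
  positivity

lemma shellKer_eq_zero (hR : 0 < R) (h : R ≤ ‖z‖) : shellKer R z = 0 := by
  rw [shellKer_eq hR, radialBump_eq_zero (Or.inr ?_)]
  · simp
  · rw [le_div_iff₀ (by positivity), one_mul]
    exact pow_le_pow_left₀ hR.le h 2

lemma tsupport_shellKer (hR : 0 < R) :
    tsupport (shellKer R : EuclideanSpace ℝ (Fin N) → ℝ) ⊆ closedBall 0 R := by
  refine closure_minimal (fun z hz => ?_) isClosed_closedBall
  by_contra h
  rw [mem_closedBall_zero_iff, not_le] at h
  exact hz (shellKer_eq_zero hR h.le)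

lemma shellKer_hasCompactSupport (hR : 0 < R) :
    HasCompactSupport (shellKer R : EuclideanSpace ℝ (Fin N) → ℝ) :=
  (isCompact_closedBall 0 R).of_isClosed_subset (isClosed_tsupport _) (tsupport_shellKer hR)

lemma exists_unitShell_bound (N : ℕ) : ∃ C : ℝ, 0 < C ∧ ∀ z : EuclideanSpace ℝ (Fin N),
    unitShell z ≤ C ∧ ∀ i, |pd i unitShell z| ≤ C := by
  have e : (unitShell : EuclideanSpace ℝ (Fin N) → ℝ) = shellKer 1 := by
    funext z; simp [shellKer]
  have hc : HasCompactSupport (unitShell : EuclideanSpace ℝ (Fin N) → ℝ) := by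
    rw [e]; exact shellKer_hasCompactSupport one_pos
  obtain ⟨C, hC⟩ := hc.exists_bound_of_continuous
    (unitShell_contDiff (n := 0)).continuous
  obtain ⟨D, hD⟩ := (hc.fderiv (𝕜 := ℝ)).exists_bound_of_continuous
    ((unitShell_contDiff (n := 1)).continuous_fderiv one_ne_zero)
  refine ⟨max (max C D) 1, by positivity, fun z => ⟨?_, fun i => ?_⟩⟩
  · exact (le_abs_self _).trans ((hC z).trans (by simp))
  · have := (fderiv ℝ unitShell z).le_opNorm (EuclideanSpace.single i 1)
    simp only [PiLp.norm_single, norm_one, mul_one] at this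
    exact this.trans ((hD z).trans (by simp))

lemma pd_shellKer (i : Fin N) :
    pd i (shellKer R) z = (R ^ N)⁻¹ * R⁻¹ * pd i unitShell (R⁻¹ • z) := by
  have hd : DifferentiableAt ℝ (fun y : EuclideanSpace ℝ (Fin N) => unitShell (R⁻¹ • y)) z :=
    ((unitShell_contDiff (n := 1)).comp (contDiff_const_smul _)).differentiable one_ne_zero z
  rw [show shellKer R = fun y : EuclideanSpace ℝ (Fin N) =>
    (R ^ N)⁻¹ * unitShell (R⁻¹ • y) from rfl,
    pd_const_mul _ hd, pd_smul_arg, mul_assoc]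

lemma le_shellKer (hN : 2 ≤ N) (hR : 0 < R) (h : 3 / 8 * R ^ 2 ≤ ‖z‖ ^ 2)
    (h' : ‖z‖ ^ 2 ≤ 7 / 8 * R ^ 2) :
    4 * (R ^ N)⁻¹ ≤ shellKer R z := by
  have hN' : (2 : ℝ) ≤ N := by exact_mod_cast hN
  have hR2 : 0 < R ^ 2 := by positivity
  have hz : ‖R⁻¹ • z‖ ^ 2 = ‖z‖ ^ 2 / R ^ 2 := by
    rw [norm_smul, mul_pow, norm_inv, Real.norm_of_nonneg hR.le, inv_pow]; ring
  have h1 : 3 / 8 ≤ ‖z‖ ^ 2 / R ^ 2 := by rwa [le_div_iff₀ hR2]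
  have h2 : ‖z‖ ^ 2 / R ^ 2 ≤ 7 / 8 := by rwa [div_le_iff₀ hR2]
  rw [shellKer, unitShell, hz, radialBump_eq_one h1 h2, mul_one, mul_comm]
  have h3 : (1 : ℝ) ≤ (‖z‖ ^ 2 / R ^ 2) ^ (1 - (N : ℝ) / 2) :=
    Real.one_le_rpow_of_pos_of_le_one_of_nonpos (by linarith) (by linarith) (by linarith)
  have : 0 < (R ^ N)⁻¹ := by positivity
  nlinarith

lemma lap_normSq : lap (fun y : EuclideanSpace ℝ (Fin N) => ‖y‖ ^ 2) z = 2 * N := by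
  rw [lap_eq (contDiff_norm_sq ℝ).contDiffAt]
  have : ∀ i : Fin N, pd i (fun y : EuclideanSpace ℝ (Fin N) => ‖y‖ ^ 2) = fun y => 2 * y i :=
    fun i => funext fun y => pd_normSq i
  simp only [this]
  simp [pd_const_mul _ (differentiableAt_coord _), pd_coord, mul_comm]

lemma lap_truncKer (hr : 0 < r) (hrR : r ≤ R) :
    lap (truncKer r R) z = shellKer R z - shellKer r z := by
  have hR : 0 < R := hr.trans_le hrR
  by_cases hz : z = 0
  · have h0 : ∀ ρ : ℝ, 0 < ρ → shellKer ρ z = 0 := fun ρ hρ => by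
      rw [shellKer_eq hρ, radialBump_eq_zero (Or.inl (by simp [hz]))]; simp
    rw [h0 r hr, h0 R hR, sub_zero]
    have hc : ContinuousAt (fun y : EuclideanSpace ℝ (Fin N) => ‖y‖ ^ 2) z := by fun_prop
    have hpd : ∀ i : Fin N, pd i (truncKer r R) =ᶠ[nhds z] fun _ => 0 := fun i => by
      have hpos : 0 < r ^ 2 / 4 := by positivity
      filter_upwards [hc.eventually_lt_const (u := r ^ 2 / 4) (by simpa [hz] using hpos)]
        with y hy
      rw [pd_truncKer hr hrR, kerSlope_eq_zero_of_le hr hrR (le_of_lt hy)]; ring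
    rw [lap_eq (truncKer_contDiff hr hrR (n := 2)).contDiffAt]
    exact Finset.sum_eq_zero fun i _ => by rw [pd_congr (hpd i), pd_const]
  · have hs : 0 < ‖z‖ ^ 2 := by positivity
    have := lap_comp (u := fun y : EuclideanSpace ℝ (Fin N) => ‖y‖ ^ 2) (x := z)
      (g := kerProfile N r R) (g' := fun s => -kerSlope N r R s) (contDiff_norm_sq ℝ).contDiffAt
      ((kerProfile_contDiff hr hrR).contDiffAt.of_le (WithTop.coe_le_coe.2 le_top))
      (Eventually.of_forall fun t => kerProfile_hasDerivAt hr hrR t)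
      (kerSlope_hasDerivAt hs).fun_neg
    rw [show truncKer r R = fun y : EuclideanSpace ℝ (Fin N) => kerProfile N r R (‖y‖ ^ 2) from rfl,
      this, lap_normSq, shellKer_eq hr, shellKer_eq hR]
    have hsum : ∑ i, pd i (fun y : EuclideanSpace ℝ (Fin N) => ‖y‖ ^ 2) z ^ 2 = 4 * ‖z‖ ^ 2 := by
      simp only [pd_normSq, mul_pow]
      rw [← Finset.mul_sum, EuclideanSpace.norm_sq_eq]
      simp; norm_num
    have e2 : (‖z‖ ^ 2) ^ (1 - (N : ℝ) / 2) = ‖z‖ ^ 2 * (‖z‖ ^ 2) ^ (-((N : ℝ) / 2)) := by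
      rw [sub_eq_add_neg, Real.rpow_add hs, Real.rpow_one]
    rw [hsum, e2]
    field_simp
    ring

lemma integral_shellKer_eq (hr : 0 < r) (hrR : r ≤ R) :
    ∫ z : EuclideanSpace ℝ (Fin N), shellKer r z =
      ∫ z : EuclideanSpace ℝ (Fin N), shellKer R z := by
  have hR : 0 < R := hr.trans_le hrR
  have hi : ∀ ρ : ℝ, 0 < ρ → Integrable (shellKer ρ : EuclideanSpace ℝ (Fin N) → ℝ) := fun ρ hρ =>
    (shellKer_contDiff (n := 0)).continuous.integrable_of_hasCompactSupport
      (shellKer_hasCompactSupport hρ)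
  have h := integral_mul_lap (N := N) (u := fun _ => 1) (v := truncKer r R)
    (fun x _ => contDiffAt_const) (truncKer_contDiff hr hrR (n := 2))
    (truncKer_hasCompactSupport hr hrR)
  have h1 : ∀ x : EuclideanSpace ℝ (Fin N),
    lap (fun _ : EuclideanSpace ℝ (Fin N) => (1 : ℝ)) x = 0 :=
    fun x => by
      rw [lap_eq contDiffAt_const]
      have h0 : ∀ i : Fin N, pd i (fun _ : EuclideanSpace ℝ (Fin N) => (1 : ℝ)) = fun _ => 0 :=
        fun i => funext fun y => pd_const 1
      simp [h0, pd_const]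
  simp only [one_mul, h1, zero_mul, integral_zero, lap_truncKer hr hrR] at h
  rw [integral_sub (hi R hR) (hi r hr)] at h
  linarith

/-- The common mass of the shell kernels. -/
noncomputable def shellMass (N : ℕ) : ℝ := ∫ z : EuclideanSpace ℝ (Fin N), shellKer 1 z

lemma integral_shellKer (hR : 0 < R) :
    ∫ z : EuclideanSpace ℝ (Fin N), shellKer R z = shellMass N := by
  rcases le_total R 1 with h | h
  · exact integral_shellKer_eq hR h
  · exact (integral_shellKer_eq one_pos h).symm

lemma shellKer_integrable (hR : 0 < R) :
    Integrable (shellKer R : EuclideanSpace ℝ (Fin N) → ℝ) :=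
  (shellKer_contDiff (n := 0)).continuous.integrable_of_hasCompactSupport
    (shellKer_hasCompactSupport hR)

lemma shellMass_pos (hN : 3 ≤ N) : 0 < shellMass N := by
  refine integral_pos_of_integrable_nonneg_nonzero
    (x := EuclideanSpace.single ⟨0, by omega⟩ (3 / 4 : ℝ))
    (shellKer_contDiff (n := 0)).continuous (shellKer_integrable one_pos)
    (fun z => shellKer_nonneg one_pos) ?_
  have := le_shellKer (N := N) (R := 1) (z := EuclideanSpace.single ⟨0, by omega⟩ (3 / 4 : ℝ))
    (by omega) one_pos (by simp; norm_num) (by simp; norm_num)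
  norm_num at this ⊢
  linarith

end Kernel

section WeakForm

variable {N : ℕ}

lemma locallyIntegrable_norm_rpow (hN : 1 ≤ N) {γ : ℝ} (hγ : -(N : ℝ) < γ) :
    LocallyIntegrable fun x : EuclideanSpace ℝ (Fin N) => ‖x‖ ^ γ := by
  refine locallyIntegrable_of_norm_le_rpow (C := 1) (α := -γ) (by simpa using hN)
    (by simp; linarith) (Eventually.of_forall fun x => ?_)
    (by fun_prop : Measurable _).aestronglyMeasurable
  rw [neg_neg, one_mul, Real.norm_of_nonneg (by positivity)]

/-- `U` is locally bounded, and twice continuously differentiable away from the origin. -/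
structure RegularOffOrigin (U : EuclideanSpace ℝ (Fin N) → ℝ) : Prop where
  contDiffAt : ∀ x ≠ 0, ContDiffAt ℝ 2 U x
  bounded : ∀ R : ℝ, ∃ M, ∀ x, ‖x‖ ≤ R → |U x| ≤ M

lemma aestronglyMeasurable_of_continuousAt {U : EuclideanSpace ℝ (Fin N) → ℝ} (hN : 1 ≤ N)
    (h : ∀ x ≠ 0, ContinuousAt U x) : AEStronglyMeasurable U := by
  have : Nonempty (Fin N) := ⟨⟨0, by omega⟩⟩
  have h1 : ContinuousOn U {0}ᶜ := fun x hx => (h x hx).continuousWithinAt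
  have h2 := h1.aestronglyMeasurable (μ := volume) (measurableSet_singleton 0).compl
  rwa [Measure.restrict_eq_self_of_ae_mem] at h2
  exact compl_mem_ae_iff.2 (measure_singleton 0)

lemma RegularOffOrigin.aestronglyMeasurable {U : EuclideanSpace ℝ (Fin N) → ℝ} (hN : 1 ≤ N)
    (h : RegularOffOrigin U) : AEStronglyMeasurable U :=
  aestronglyMeasurable_of_continuousAt hN fun x hx => (h.contDiffAt x hx).continuousAt

/-- A bump at the origin of `ℝ^N`. -/
noncomputable def originBump (N : ℕ) : ContDiffBump (0 : EuclideanSpace ℝ (Fin N)) :=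
  ⟨1, 2, by norm_num, by norm_num⟩

/-- A cutoff which vanishes on the ball of radius `ε` and equals `1` off the ball of
radius `2 * ε`. -/
noncomputable def originCutoff (ε : ℝ) (x : EuclideanSpace ℝ (Fin N)) : ℝ :=
  1 - originBump N (ε⁻¹ • x)

variable {ε : ℝ} {x : EuclideanSpace ℝ (Fin N)}

lemma originCutoff_contDiff {n : ℕ∞} :
    ContDiff ℝ n (originCutoff ε : EuclideanSpace ℝ (Fin N) → ℝ) :=
  contDiff_const.sub ((originBump N).contDiff.comp (contDiff_const_smul _))

lemma originCutoff_eq_zero (hε : 0 < ε) (hx : ‖x‖ ≤ ε) : originCutoff ε x = 0 := by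
  rw [originCutoff, (originBump N).one_of_mem_closedBall, sub_self]
  rw [mem_closedBall_zero_iff, norm_smul, norm_inv, Real.norm_of_nonneg hε.le]
  exact inv_mul_le_one_of_le₀ hx hε.le

lemma originCutoff_eq_one (hε : 0 < ε) (hx : 2 * ε ≤ ‖x‖) : originCutoff ε x = 1 := by
  rw [originCutoff, (originBump N).zero_of_le_dist, sub_zero]
  rw [dist_zero_right, norm_smul, norm_inv, Real.norm_of_nonneg hε.le]
  change (2 : ℝ) ≤ _
  rw [inv_mul_eq_div, le_div_iff₀ hε]
  exact hx

lemma originCutoff_nonneg : 0 ≤ originCutoff ε x := sub_nonneg.2 (originBump N).le_one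

lemma originCutoff_le_one : originCutoff ε x ≤ 1 := sub_le_self _ (originBump N).nonneg

lemma tsupport_originCutoff (hε : 0 < ε) :
    (0 : EuclideanSpace ℝ (Fin N)) ∉ tsupport (originCutoff ε) := by
  rw [notMem_tsupport_iff_eventuallyEq]
  filter_upwards [ball_mem_nhds _ hε] with y hy
  exact originCutoff_eq_zero hε (mem_ball_zero_iff.1 hy).le

lemma pd_originCutoff (i : Fin N) :
    pd i (originCutoff ε) x = -(ε⁻¹ * pd i (originBump N) (ε⁻¹ • x)) := by
  have h1 : DifferentiableAt ℝ (fun y => originBump N (ε⁻¹ • y)) x :=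
    ((originBump N).contDiff (n := 1) |>.comp (contDiff_const_smul _)).differentiable one_ne_zero x
  rw [show originCutoff ε = fun y => 1 - originBump N (ε⁻¹ • y) from rfl,
    pd_sub (differentiableAt_const _) h1, pd_const, pd_smul_arg, zero_sub]

lemma lap_originCutoff :
    lap (originCutoff ε) x = -(ε⁻¹ ^ 2 * lap (originBump N) (ε⁻¹ • x)) := by
  have h0 : ContDiff ℝ 2 (originBump N) := (originBump N).contDiff
  have h1 : ContDiffAt ℝ 2 (fun y => originBump N (ε⁻¹ • y)) x :=
    (h0.comp (contDiff_const_smul _)).contDiffAt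
  have e : (originCutoff ε : EuclideanSpace ℝ (Fin N) → ℝ) =
      fun y => 1 + (-1) * originBump N (ε⁻¹ • y) := by
    funext y; simp [originCutoff, sub_eq_add_neg]
  rw [e, lap_add contDiffAt_const (contDiffAt_const.mul h1), lap_const_mul _ h1,
    lap_smul_arg _ h0.contDiffAt, lap_eq contDiffAt_const]
  have h0 : ∀ i : Fin N, pd i (fun _ : EuclideanSpace ℝ (Fin N) => (1 : ℝ)) = fun _ => 0 :=
    fun i => funext fun y => pd_const 1
  simp [h0, pd_const]

lemma ContDiff.continuous_lap {u : EuclideanSpace ℝ (Fin N) → ℝ} (h : ContDiff ℝ 2 u) :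
    Continuous (lap u) := by
  have : lap u = fun x => ∑ i, _root_.pd i (_root_.pd i u) x := funext fun x => lap_eq h.contDiffAt
  rw [this]
  exact continuous_finsetSum _ fun i _ => (h.pd (m := 1) (by norm_num)).continuous_pd

lemma HasCompactSupport.lap {u : EuclideanSpace ℝ (Fin N) → ℝ} (h : HasCompactSupport u) :
    HasCompactSupport (_root_.lap u) :=
  h.mono' fun x hx => by
    by_contra h'
    exact hx (lap_eq_zero_of_notMem_tsupport h')

lemma exists_originCutoff_bound (N : ℕ) : ∃ C : ℝ, 0 < C ∧ ∀ ε : ℝ, 0 < ε →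
    ∀ x : EuclideanSpace ℝ (Fin N), (∀ i, |pd i (originCutoff ε) x| ≤ C * ε⁻¹) ∧
      |lap (originCutoff ε) x| ≤ C * ε⁻¹ ^ 2 := by
  have hc := (originBump N).hasCompactSupport
  have h0 : ContDiff ℝ 2 (originBump N) := (originBump N).contDiff
  obtain ⟨C, hC⟩ := hc.lap.exists_bound_of_continuous h0.continuous_lap
  obtain ⟨D, hD⟩ := (hc.fderiv (𝕜 := ℝ)).exists_bound_of_continuous
    (h0.continuous_fderiv two_ne_zero)
  refine ⟨max (max C D) 1, by positivity, fun ε hε x => ⟨fun i => ?_, ?_⟩⟩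
  · rw [pd_originCutoff, abs_neg, abs_mul, abs_of_pos (inv_pos.2 hε), mul_comm]
    refine mul_le_mul_of_nonneg_right ?_ (inv_pos.2 hε).le
    have := (fderiv ℝ (originBump N) (ε⁻¹ • x)).le_opNorm (EuclideanSpace.single i 1)
    simp only [PiLp.norm_single, norm_one, mul_one] at this
    exact this.trans ((hD _).trans (by simp))
  · rw [lap_originCutoff, abs_neg, abs_mul, abs_of_pos (by positivity), mul_comm]
    refine mul_le_mul_of_nonneg_right ?_ (by positivity)
    exact (hC _).trans (by simp)

lemma pd_originCutoff_eq_zero (hε : 0 < ε) (hx : 2 * ε < ‖x‖) (i : Fin N) :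
    pd i (originCutoff ε) x = 0 := by
  have : originCutoff ε =ᶠ[nhds x] fun _ => 1 := by
    filter_upwards [continuous_norm.continuousAt.eventually_const_lt hx] with y hy
    exact originCutoff_eq_one hε hy.le
  rw [pd_congr this, pd_const]

lemma tendsto_originCutoff (hx : x ≠ 0) :
    ∀ᶠ k : ℕ in atTop, 2 * (1 / ((k : ℝ) + 1)) < ‖x‖ := by
  have h := (tendsto_one_div_add_atTop_nhds_zero_nat (𝕜 := ℝ)).const_mul 2
  rw [mul_zero] at h
  exact h.eventually_lt_const (norm_pos_iff.2 hx)

/-- Cutting off the origin does not change the distributional Laplacian in dimension `≥ 3`. -/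
lemma tendsto_integral_mul_lap_cutoff (hN : 3 ≤ N) {U ψ : EuclideanSpace ℝ (Fin N) → ℝ}
    (hU : RegularOffOrigin U) (hψ : ContDiff ℝ 2 ψ) (hc : HasCompactSupport ψ) :
    Tendsto (fun k : ℕ => ∫ x, U x * lap (fun y => ψ y * originCutoff (1 / ((k : ℝ) + 1)) y) x)
      atTop (nhds (∫ x, U x * lap ψ x)) := by
  obtain ⟨C, hC0, hC⟩ := exists_originCutoff_bound N
  obtain ⟨A, hA⟩ := hc.exists_bound_of_continuous hψ.continuous
  obtain ⟨B, hB⟩ := hc.lap.exists_bound_of_continuous hψ.continuous_lap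
  obtain ⟨D, hD⟩ := (hc.fderiv (𝕜 := ℝ)).exists_bound_of_continuous
    (hψ.continuous_fderiv two_ne_zero)
  have hpd : ∀ i x, |pd i ψ x| ≤ D := fun i x => by
    have := (fderiv ℝ ψ x).le_opNorm (EuclideanSpace.single i 1)
    simp only [PiLp.norm_single, norm_one, mul_one] at this
    exact this.trans (hD _)
  have hA0 : 0 ≤ A := (norm_nonneg _).trans (hA 0)
  have hB0 : 0 ≤ B := (norm_nonneg _).trans (hB 0)
  have hD0 : 0 ≤ D := (norm_nonneg _).trans (hD 0)
  obtain ⟨R, hR0, hR⟩ := hc.isBounded.exists_pos_norm_lt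
  obtain ⟨M, hM⟩ := hU.bounded R
  have hM0 : 0 ≤ M := (abs_nonneg _).trans (hM 0 (by simpa using hR0.le))
  set K : ℝ := 4 * (A * C + 2 * (N * (D * C))) with hK
  have hK0 : 0 ≤ K := by positivity
  have hζ : ∀ ε : ℝ, ContDiff ℝ 2 (originCutoff ε : EuclideanSpace ℝ (Fin N) → ℝ) :=
    fun ε => originCutoff_contDiff (n := 2)
  have hbound : ∀ k : ℕ, ∀ x : EuclideanSpace ℝ (Fin N), x ≠ 0 →
      |lap (fun y => ψ y * originCutoff (1 / ((k : ℝ) + 1)) y) x| ≤ B + K * ‖x‖ ^ (-2 : ℝ) := by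
    intro k x hx
    have hx0 : 0 < ‖x‖ := norm_pos_iff.2 hx
    set ε : ℝ := 1 / ((k : ℝ) + 1) with hε
    have hε0 : 0 < ε := by positivity
    have hε1 : ε ≤ 1 := by
      rw [hε, div_le_one (by positivity)]; linarith [(Nat.cast_nonneg k : (0 : ℝ) ≤ k)]
    rcases lt_or_ge (2 * ε) ‖x‖ with h | h
    · have e : (fun y => ψ y * originCutoff ε y) =ᶠ[nhds x] ψ := by
        filter_upwards [continuous_norm.continuousAt.eventually_const_lt h] with y hy
        rw [originCutoff_eq_one hε0 hy.le, mul_one]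
      rw [lap_congr e]
      have : 0 ≤ K * ‖x‖ ^ (-2 : ℝ) := by positivity
      exact (hB x).trans (by linarith)
    · rw [lap_mul hψ.contDiffAt (hζ ε).contDiffAt]
      have hsum : |∑ i, pd i ψ x * pd i (originCutoff ε) x| ≤ N * (D * (C * ε⁻¹)) := by
        refine (Finset.abs_sum_le_sum_abs _ _).trans ?_
        refine (Finset.sum_le_card_nsmul _ _ (D * (C * ε⁻¹)) fun i _ => ?_).trans (by simp)
        rw [abs_mul]
        exact mul_le_mul (hpd i x) ((hC ε hε0 x).1 i) (abs_nonneg _) hD0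
      have h1 : |ψ x * lap (originCutoff ε) x| ≤ A * (C * ε⁻¹ ^ 2) := by
        rw [abs_mul]
        exact mul_le_mul (hA x) (hC ε hε0 x).2 (abs_nonneg _) hA0
      have h2 : |originCutoff ε x * lap ψ x| ≤ B := by
        rw [abs_mul, abs_of_nonneg originCutoff_nonneg]
        exact (mul_le_of_le_one_left (abs_nonneg _) originCutoff_le_one).trans (hB x)
      have h3 : ε⁻¹ ≤ ε⁻¹ ^ 2 := by
        have : 1 ≤ ε⁻¹ := (one_le_inv₀ hε0).2 hε1
        nlinarith
      have h4 : ε⁻¹ ^ 2 ≤ 4 * ‖x‖ ^ (-2 : ℝ) := by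
        rw [Real.rpow_neg hx0.le, show (2 : ℝ) = ((2 : ℕ) : ℝ) by norm_num, Real.rpow_natCast,
          ← div_eq_mul_inv, inv_pow, inv_le_comm₀ (by positivity) (by positivity), inv_div,
          div_le_iff₀ (by norm_num)]
        nlinarith
      have h5 : N * (D * (C * ε⁻¹)) ≤ N * (D * (C * ε⁻¹ ^ 2)) := by gcongr
      calc _ ≤ |ψ x * lap (originCutoff ε) x| + |2 * ∑ i, pd i ψ x * pd i (originCutoff ε) x|
            + |originCutoff ε x * lap ψ x| := abs_add_three _ _ _
        _ ≤ A * (C * ε⁻¹ ^ 2) + 2 * (N * (D * (C * ε⁻¹ ^ 2))) + B := by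
            rw [abs_mul 2, abs_two]; linarith
        _ = B + (A * C + 2 * (N * (D * C))) * ε⁻¹ ^ 2 := by ring
        _ ≤ B + (A * C + 2 * (N * (D * C))) * (4 * ‖x‖ ^ (-2 : ℝ)) := by gcongr
        _ = _ := by rw [hK]; ring
  have : Nonempty (Fin N) := ⟨⟨0, by omega⟩⟩
  have hne : ∀ᵐ x : EuclideanSpace ℝ (Fin N), x ≠ 0 := compl_mem_ae_iff.2 (measure_singleton 0)
  refine tendsto_integral_of_dominated_convergence
    ((ball 0 R).indicator fun x => M * (B + K * ‖x‖ ^ (-2 : ℝ))) ?_ ?_ ?_ ?_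
  · intro k
    exact (hU.aestronglyMeasurable (by omega)).mul
      (hψ.mul (hζ _)).continuous_lap.aestronglyMeasurable
  · rw [integrable_indicator_iff measurableSet_ball]
    have h1 : IntegrableOn (fun x : EuclideanSpace ℝ (Fin N) => ‖x‖ ^ (-2 : ℝ)) (ball 0 R) :=
      ((locallyIntegrable_norm_rpow (by omega) (by
        have : (3 : ℝ) ≤ N := by exact_mod_cast hN
        linarith)).integrableOn_isCompact (isCompact_closedBall 0 R)).mono_set
          ball_subset_closedBall
    have h2 : IntegrableOn (fun _ : EuclideanSpace ℝ (Fin N) => B) (ball 0 R) :=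
      integrableOn_const measure_ball_lt_top.ne
    exact (h2.add (h1.const_mul K)).const_mul M
  · intro k
    filter_upwards [hne] with x hx
    by_cases hxR : x ∈ ball (0 : EuclideanSpace ℝ (Fin N)) R
    · rw [indicator_of_mem hxR, norm_mul]
      have hb := hbound k x hx
      exact mul_le_mul (hM x (mem_ball_zero_iff.1 hxR).le) hb (norm_nonneg _) hM0
    · rw [indicator_of_notMem hxR, lap_eq_zero_of_notMem_tsupport]
      · simp
      · intro hx'
        exact hxR (mem_ball_zero_iff.2 (hR x (closure_mono
          (fun y hy => left_ne_zero_of_mul hy) hx')))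
  · filter_upwards [hne] with x hx
    refine tendsto_nhds_of_eventually_eq ?_
    filter_upwards [tendsto_originCutoff hx] with k hk
    rw [lap_congr (v := ψ)]
    filter_upwards [continuous_norm.continuousAt.eventually_const_lt hk] with y hy
    rw [originCutoff_eq_one (by positivity) hy.le, mul_one]

lemma integral_mul_lap_cutoff {U ψ : EuclideanSpace ℝ (Fin N) → ℝ}
    (hU : RegularOffOrigin U) (hψ : ContDiff ℝ 2 ψ) (hc : HasCompactSupport ψ) (hε : 0 < ε) :
    ∫ x, U x * lap (fun y => ψ y * originCutoff ε y) x
      = ∫ x, lap U x * (ψ x * originCutoff ε x) := by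
  refine integral_mul_lap (v := fun y => ψ y * originCutoff ε y) (fun x hx => ?_)
    (hψ.mul (originCutoff_contDiff (n := 2))) hc.mul_right
  refine hU.contDiffAt x ?_
  rintro rfl
  exact tsupport_originCutoff hε (closure_mono (fun y hy => right_ne_zero_of_mul hy) hx)

/-- The weak form of `-Δ U = f`. -/
lemma integral_mul_lap_eq (hN : 3 ≤ N) {U f ψ : EuclideanSpace ℝ (Fin N) → ℝ}
    (hU : RegularOffOrigin U) (hf : LocallyIntegrable f) (h : ∀ x ≠ 0, -lap U x = f x)
    (hψ : ContDiff ℝ 2 ψ) (hc : HasCompactSupport ψ) :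
    ∫ x, U x * lap ψ x = -∫ x, f x * ψ x := by
  have : Nonempty (Fin N) := ⟨⟨0, by omega⟩⟩
  have hne : ∀ᵐ x : EuclideanSpace ℝ (Fin N), x ≠ 0 := compl_mem_ae_iff.2 (measure_singleton 0)
  have hi : Integrable fun x => f x * ψ x := by
    simpa [mul_comm] using hf.integrable_smul_right_of_hasCompactSupport hψ.continuous hc
  refine tendsto_nhds_unique (tendsto_integral_mul_lap_cutoff hN hU hψ hc) ?_
  rw [← integral_neg]
  refine tendsto_integral_of_dominated_convergence (fun x => |f x * ψ x|) ?_ hi.abs ?_ ?_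
    |>.congr fun k => (integral_mul_lap_cutoff hU hψ hc (by positivity)).symm
  · intro k
    refine (AEStronglyMeasurable.neg (hi.aestronglyMeasurable.mul (originCutoff_contDiff
      (ε := 1 / ((k : ℝ) + 1)) (n := 2)).continuous.aestronglyMeasurable)).congr ?_
    filter_upwards [hne] with x hx
    simp only [Pi.neg_apply, Pi.mul_apply, ← h x hx]; ring
  · intro k
    filter_upwards [hne] with x hx
    rw [← h x hx, norm_mul, norm_mul, abs_mul, abs_neg, Real.norm_eq_abs, Real.norm_eq_abs,
      Real.norm_of_nonneg originCutoff_nonneg]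
    exact mul_le_mul_of_nonneg_left (mul_le_of_le_one_right (abs_nonneg _) originCutoff_le_one)
      (abs_nonneg _)
  · filter_upwards [hne] with x hx
    refine tendsto_nhds_of_eventually_eq ?_
    filter_upwards [tendsto_originCutoff hx] with k hk
    rw [originCutoff_eq_one (by positivity) hk.le, ← h x hx]; ring

/-- The weak form of `0 ≤ Δ z`. -/
lemma integral_mul_lap_nonneg (hN : 3 ≤ N) {z ψ : EuclideanSpace ℝ (Fin N) → ℝ}
    (hz : RegularOffOrigin z) (h : ∀ x ≠ 0, 0 ≤ lap z x)
    (hψ : ContDiff ℝ 2 ψ) (hc : HasCompactSupport ψ) (hψ0 : ∀ x, 0 ≤ ψ x) :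
    0 ≤ ∫ x, z x * lap ψ x := by
  have : Nonempty (Fin N) := ⟨⟨0, by omega⟩⟩
  have hne : ∀ᵐ x : EuclideanSpace ℝ (Fin N), x ≠ 0 := compl_mem_ae_iff.2 (measure_singleton 0)
  refine ge_of_tendsto' (tendsto_integral_mul_lap_cutoff hN hz hψ hc) fun k => ?_
  rw [integral_mul_lap_cutoff hz hψ hc (by positivity)]
  refine integral_nonneg_of_ae ?_
  filter_upwards [hne] with x hx
  exact mul_nonneg (h x hx) (mul_nonneg (hψ0 x) originCutoff_nonneg)

end WeakForm

section Potential

variable {N : ℕ} {x : EuclideanSpace ℝ (Fin N)} {r R : ℝ}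

lemma tsupport_translate_subset {ψ : EuclideanSpace ℝ (Fin N) → ℝ}
    (h : tsupport ψ ⊆ closedBall 0 R) : tsupport (fun y => ψ (y - x)) ⊆ closedBall x R := by
  refine closure_minimal (fun y hy => ?_) isClosed_closedBall
  have := h (subset_tsupport ψ (show y - x ∈ Function.support ψ from hy))
  rwa [mem_closedBall_zero_iff, ← dist_eq_norm] at this

lemma hasCompactSupport_translate {ψ : EuclideanSpace ℝ (Fin N) → ℝ}
    (h : tsupport ψ ⊆ closedBall 0 R) : HasCompactSupport (fun y => ψ (y - x)) :=
  (isCompact_closedBall x R).of_isClosed_subset (isClosed_tsupport _) (tsupport_translate_subset h)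

lemma contDiff_translate {ψ : EuclideanSpace ℝ (Fin N) → ℝ} {n : WithTop ℕ∞}
    (h : ContDiff ℝ n ψ) : ContDiff ℝ n (fun y => ψ (y - x)) :=
  h.comp (contDiff_id.sub contDiff_const)

lemma RegularOffOrigin.locallyIntegrable {U : EuclideanSpace ℝ (Fin N) → ℝ} (hN : 1 ≤ N)
    (h : RegularOffOrigin U) : LocallyIntegrable U := by
  rw [locallyIntegrable_iff]
  intro K hK
  obtain ⟨ρ, hρ0, hρ⟩ := hK.isBounded.exists_pos_norm_lt
  obtain ⟨M, hM⟩ := h.bounded ρ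
  refine Measure.integrableOn_of_bounded (M := M) hK.measure_lt_top.ne
    (h.aestronglyMeasurable hN) ?_
  filter_upwards [ae_restrict_mem hK.measurableSet] with y hy
  exact hM y (hρ y hy).le

lemma LocallyIntegrable.integrable_mul_translate {f ψ : EuclideanSpace ℝ (Fin N) → ℝ}
    (hf : LocallyIntegrable f) (hψ : Continuous ψ) (h : tsupport ψ ⊆ closedBall 0 R) :
    Integrable fun y => f y * ψ (y - x) := by
  have := hf.integrable_smul_right_of_hasCompactSupport
    (hψ.comp (continuous_id.sub continuous_const)) (hasCompactSupport_translate (x := x) h)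
  simpa [mul_comm] using this

/-- Shell averages converge to point values. -/
lemma tendsto_integral_shellKer {G : EuclideanSpace ℝ (Fin N) → ℝ}
    (hG : ∀ᶠ y in nhds x, ContinuousAt G y) :
    Tendsto (fun r : ℝ => ∫ y, G y * shellKer r (y - x)) (nhdsWithin 0 (Ioi 0))
      (nhds (shellMass N * G x)) := by
  have hm : 0 ≤ shellMass N := integral_nonneg fun z => shellKer_nonneg one_pos
  rw [Metric.tendsto_nhdsWithin_nhds]
  intro δ hδ
  obtain ⟨ρ₁, hρ₁, h1⟩ := Metric.eventually_nhds_iff.1 hG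
  set η := δ / (2 * (shellMass N + 1))
  have hη : 0 < η := by positivity
  obtain ⟨ρ₂, hρ₂, h2⟩ := Metric.continuousAt_iff.1 hG.self_of_nhds η hη
  refine ⟨min ρ₁ ρ₂, by positivity, fun r hr hrd => ?_⟩
  have hr0 : 0 < r := hr
  rw [Real.dist_eq, sub_zero, abs_of_pos hr0, lt_min_iff] at hrd
  have hts : tsupport (fun y : EuclideanSpace ℝ (Fin N) => shellKer r (y - x)) ⊆ closedBall x r :=
    tsupport_translate_subset (tsupport_shellKer hr0)
  have hcont : Continuous fun y : EuclideanSpace ℝ (Fin N) => shellKer r (y - x) :=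
    (contDiff_translate (shellKer_contDiff (n := 0))).continuous
  have hsi : Integrable fun y : EuclideanSpace ℝ (Fin N) => shellKer r (y - x) :=
    (shellKer_integrable hr0).comp_sub_right x
  have hI : ∫ y : EuclideanSpace ℝ (Fin N), shellKer r (y - x) = shellMass N := by
    rw [integral_sub_right_eq_self (fun y => shellKer r y), integral_shellKer hr0]
  have hGi : Integrable fun y => G y * shellKer r (y - x) :=
    integrable_mul_of_tsupport (fun y hy => h1 ((hts hy : dist y x ≤ r).trans_lt hrd.1)) hcont
      (hasCompactSupport_translate (tsupport_shellKer hr0))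
  have e : (∫ y, G y * shellKer r (y - x)) - shellMass N * G x
      = ∫ y, (G y * shellKer r (y - x) - G x * shellKer r (y - x)) := by
    rw [integral_sub hGi (hsi.const_mul _), integral_const_mul, hI, mul_comm]
  rw [Real.dist_eq, e]
  have hle : ‖∫ y, (G y * shellKer r (y - x) - G x * shellKer r (y - x))‖
      ≤ ∫ y, η * shellKer r (y - x) := by
    refine norm_integral_le_of_norm_le (hsi.const_mul _) (Eventually.of_forall fun y => ?_)
    rw [← sub_mul, norm_mul, Real.norm_of_nonneg (shellKer_nonneg hr0)]
    by_cases hy : ‖y - x‖ < r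
    · refine mul_le_mul_of_nonneg_right ?_ (shellKer_nonneg hr0)
      rw [← dist_eq_norm]
      exact (h2 (by rw [dist_eq_norm]; exact hy.trans hrd.2)).le
    · rw [shellKer_eq_zero hr0 (not_lt.1 hy)]; simp
  rw [integral_const_mul, hI] at hle
  refine (Real.norm_eq_abs _ ▸ hle).trans_lt ?_
  have : η * (2 * (shellMass N + 1)) = δ := by
    simp only [η]; field_simp
  nlinarith

/-- `U ≥ 0` solves `-Δ U = f ≥ 0` off the origin, with `U` locally bounded and `f` locally
integrable. -/
structure IsSuperPair (U f : EuclideanSpace ℝ (Fin N) → ℝ) : Prop where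
  reg : RegularOffOrigin U
  locallyIntegrable : LocallyIntegrable f
  neg_lap : ∀ x ≠ 0, -lap U x = f x
  nonneg : ∀ x, 0 ≤ U x
  rhs_nonneg : ∀ x, 0 ≤ f x

lemma eventually_continuousAt_of_c2 {U : EuclideanSpace ℝ (Fin N) → ℝ} (h : ContDiffAt ℝ 2 U x) :
    ∀ᶠ y in nhds x, ContinuousAt U y :=
  (eventually_c2 h).mono fun _ hy => hy.continuousAt

lemma lap_truncKer_translate (hr : 0 < r) (hrR : r ≤ R) (y : EuclideanSpace ℝ (Fin N)) :
    lap (fun y => truncKer r R (y - x)) y = shellKer R (y - x) - shellKer r (y - x) := by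
  rw [lap_translate x (truncKer_contDiff hr hrR (n := 2)).contDiffAt, lap_truncKer hr hrR]

variable {U f : EuclideanSpace ℝ (Fin N) → ℝ}

lemma IsSuperPair.representation (hN : 3 ≤ N) (h : IsSuperPair U f) (hr : 0 < r) (hrR : r ≤ R) :
    ∫ y, U y * shellKer r (y - x) =
      (∫ y, U y * shellKer R (y - x)) + ∫ y, f y * truncKer r R (y - x) := by
  have hUi : ∀ ρ : ℝ, 0 < ρ → Integrable fun y => U y * shellKer ρ (y - x) := fun ρ hρ =>
    LocallyIntegrable.integrable_mul_translate (h.reg.locallyIntegrable (by omega))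
      (shellKer_contDiff (n := 0)).continuous (tsupport_shellKer hρ)
  have := integral_mul_lap_eq hN h.reg h.locallyIntegrable h.neg_lap
    (contDiff_translate (x := x) (truncKer_contDiff hr hrR (n := 2)))
    (hasCompactSupport_translate (tsupport_truncKer hr hrR))
  simp only [lap_truncKer_translate hr hrR, mul_sub] at this
  rw [integral_sub (hUi R (hr.trans_le hrR)) (hUi r hr)] at this
  linarith

lemma IsSuperPair.integrable_mul_truncKer (h : IsSuperPair U f) (hr : 0 < r) (hrR : r ≤ R) :
    Integrable fun y => f y * truncKer r R (y - x) :=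
  LocallyIntegrable.integrable_mul_translate h.locallyIntegrable
    (truncKer_contDiff hr hrR (n := 0)).continuous (tsupport_truncKer hr hrR)

lemma IsSuperPair.integrable_mul_shellKer (hN : 3 ≤ N) (h : IsSuperPair U f) (hr : 0 < r) :
    Integrable fun y => U y * shellKer r (y - x) :=
  LocallyIntegrable.integrable_mul_translate (h.reg.locallyIntegrable (by omega))
    (shellKer_contDiff (n := 0)).continuous (tsupport_shellKer hr)

lemma eventually_small (hR : 0 < R) : ∀ᶠ r : ℝ in nhdsWithin 0 (Ioi 0), 0 < r ∧ 8 * r ≤ R := by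
  filter_upwards [Ioo_mem_nhdsGT (show (0 : ℝ) < R / 8 by positivity)] with r hr
  exact ⟨hr.1, by linarith [hr.2]⟩

lemma IsSuperPair.lower_potential (hN : 3 ≤ N) (h : IsSuperPair U f) (hx : x ≠ 0) (hR : 0 < R)
    {A : Set (EuclideanSpace ℝ (Fin N))} (hA : MeasurableSet A) (hAR : A ⊆ closedBall x (R / 4)) :
    3 / 32 * R ^ (2 - (N : ℝ)) * ∫ y in A, f y ≤ shellMass N * U x := by
  refine ge_of_tendsto (tendsto_integral_shellKer
    (eventually_continuousAt_of_c2 (h.reg.contDiffAt x hx))) ?_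
  filter_upwards [eventually_small hR] with r hr
  have hrR : r ≤ R := by linarith [hr.1, hr.2]
  rw [h.representation hN hr.1 hrR, ← integral_const_mul, ← integral_indicator hA]
  have h1 : 0 ≤ ∫ y, U y * shellKer R (y - x) :=
    integral_nonneg fun y => mul_nonneg (h.nonneg y) (shellKer_nonneg hR)
  have hfA : IntegrableOn f A := (h.locallyIntegrable.integrableOn_isCompact
    (isCompact_closedBall x (R / 4))).mono_set hAR
  have h2 := integral_mono (((integrable_indicator_iff hA).2
    (hfA.const_mul (3 / 32 * R ^ (2 - (N : ℝ)))))) (h.integrable_mul_truncKer (x := x) hr.1 hrR)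
    fun y => by
      by_cases hy : y ∈ A
      · simp only [indicator_of_mem hy]
        rw [mul_comm]
        exact mul_le_mul_of_nonneg_left (le_truncKer hr.1 hr.2
          (by rw [← dist_eq_norm]; exact hAR hy)) (h.rhs_nonneg y)
      · simp only [indicator_of_notMem hy]
        exact mul_nonneg (h.rhs_nonneg y) (truncKer_nonneg hr.1 hrR)
  linarith

lemma IsSuperPair.lower_shell (hN : 3 ≤ N) (h : IsSuperPair U f) (hx : x ≠ 0) (hR : 0 < R)
    {A : Set (EuclideanSpace ℝ (Fin N))} (hA : MeasurableSet A)
    (hAR : ∀ y ∈ A, 3 / 8 * R ^ 2 ≤ ‖y - x‖ ^ 2 ∧ ‖y - x‖ ^ 2 ≤ 7 / 8 * R ^ 2) :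
    4 * (R ^ N)⁻¹ * ∫ y in A, U y ≤ shellMass N * U x := by
  refine ge_of_tendsto (tendsto_integral_shellKer
    (eventually_continuousAt_of_c2 (h.reg.contDiffAt x hx))) ?_
  filter_upwards [eventually_small hR] with r hr
  have hrR : r ≤ R := by linarith [hr.1, hr.2]
  rw [h.representation hN hr.1 hrR, ← integral_const_mul, ← integral_indicator hA]
  have h1 : 0 ≤ ∫ y, f y * truncKer r R (y - x) :=
    integral_nonneg fun y => mul_nonneg (h.rhs_nonneg y) (truncKer_nonneg hr.1 hrR)
  have hsub : A ⊆ closedBall x R := fun y hy => by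
    rw [mem_closedBall, dist_eq_norm]
    refine le_of_sq_le_sq ?_ hR.le
    nlinarith [(hAR y hy).2]
  have hUA : IntegrableOn U A := ((h.reg.locallyIntegrable (by omega)).integrableOn_isCompact
    (isCompact_closedBall x R)).mono_set hsub
  have h2 := integral_mono (((integrable_indicator_iff hA).2
    (hUA.const_mul (4 * (R ^ N)⁻¹)))) (h.integrable_mul_shellKer hN (x := x) hR)
    fun y => by
      by_cases hy : y ∈ A
      · simp only [indicator_of_mem hy]
        rw [mul_comm]
        exact mul_le_mul_of_nonneg_left (le_shellKer (by omega) hR (hAR y hy).1 (hAR y hy).2)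
          (h.nonneg y)
      · simp only [indicator_of_notMem hy]
        exact mul_nonneg (h.nonneg y) (shellKer_nonneg hR)
  linarith

lemma subharmonic_le_shell (hN : 3 ≤ N) {z : EuclideanSpace ℝ (Fin N) → ℝ}
    (hz : RegularOffOrigin z) (h : ∀ x ≠ 0, 0 ≤ lap z x) (hx : x ≠ 0) (hR : 0 < R) :
    shellMass N * z x ≤ ∫ y, z y * shellKer R (y - x) := by
  refine le_of_tendsto (tendsto_integral_shellKer
    (eventually_continuousAt_of_c2 (hz.contDiffAt x hx))) ?_
  filter_upwards [eventually_small hR] with r hr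
  have hrR : r ≤ R := by linarith [hr.1, hr.2]
  have hUi : ∀ ρ : ℝ, 0 < ρ → Integrable fun y => z y * shellKer ρ (y - x) := fun ρ hρ =>
    LocallyIntegrable.integrable_mul_translate (hz.locallyIntegrable (by omega))
      (shellKer_contDiff (n := 0)).continuous (tsupport_shellKer hρ)
  have := integral_mul_lap_nonneg hN hz h
    (contDiff_translate (x := x) (truncKer_contDiff hr.1 hrR (n := 2)))
    (hasCompactSupport_translate (tsupport_truncKer hr.1 hrR))
    (fun y => truncKer_nonneg hr.1 hrR)
  simp only [lap_truncKer_translate hr.1 hrR, mul_sub] at this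
  rw [integral_sub (hUi R hR) (hUi r hr.1)] at this
  linarith

lemma shellKer_le {C : ℝ} (hR : 0 < R) (hC : ∀ z : EuclideanSpace ℝ (Fin N), unitShell z ≤ C)
    (z : EuclideanSpace ℝ (Fin N)) : shellKer R z ≤ C * (R ^ N)⁻¹ := by
  rw [shellKer, mul_comm]
  exact mul_le_mul_of_nonneg_right (hC _) (by positivity)

/-- Averages of a nonnegative function against the shell kernel and plain averages. -/
lemma integral_mul_shellKer_le {C : ℝ} (hR : 0 < R)
    (hC : ∀ z : EuclideanSpace ℝ (Fin N), unitShell z ≤ C) (hU : LocallyIntegrable U)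
    (h0 : ∀ y, 0 ≤ U y) :
    ∫ y, U y * shellKer R (y - x) ≤ C * (R ^ N)⁻¹ * ∫ y in ball x R, U y := by
  rw [← integral_const_mul, ← integral_indicator measurableSet_ball]
  have hi : IntegrableOn U (ball x R) :=
    (hU.integrableOn_isCompact (isCompact_closedBall x R)).mono_set ball_subset_closedBall
  refine integral_mono (LocallyIntegrable.integrable_mul_translate hU
      (shellKer_contDiff (n := 0)).continuous (tsupport_shellKer hR))
    ((integrable_indicator_iff measurableSet_ball).2 (hi.const_mul _)) fun y => ?_
  by_cases hy : y ∈ ball x R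
  · simp only [indicator_of_mem hy]
    rw [mul_comm]
    exact mul_le_mul_of_nonneg_right (shellKer_le hR hC _) (h0 y)
  · simp only [indicator_of_notMem hy]
    rw [shellKer_eq_zero hR, mul_zero]
    rw [mem_ball, dist_eq_norm, not_lt] at hy
    exact hy

lemma ofReal_integral_mul_le {k w : EuclideanSpace ℝ (Fin N) → ℝ} (hN : 1 ≤ N)
    (hf : ∀ y, 0 ≤ f y)
    (hk : ∀ z ≠ 0, |k z| ≤ w z) (hk0 : ∀ z, R ≤ ‖z‖ → k z = 0) :
    ENNReal.ofReal |∫ y, f y * k (y - x)| ≤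
      ∫⁻ y in ball x R, ENNReal.ofReal (f y) * ENNReal.ofReal (w (y - x)) := by
  have : Nonempty (Fin N) := ⟨⟨0, by omega⟩⟩
  have h1 : ENNReal.ofReal |∫ y, f y * k (y - x)| ≤ ∫⁻ y, ‖f y * k (y - x)‖ₑ := by
    rw [← Real.norm_eq_abs, ofReal_norm]
    exact enorm_integral_le_lintegral_enorm _
  refine h1.trans ?_
  rw [← lintegral_indicator measurableSet_ball]
  refine lintegral_mono_ae ?_
  have hne : ∀ᵐ y : EuclideanSpace ℝ (Fin N), y ≠ x := compl_mem_ae_iff.2 (measure_singleton x)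
  filter_upwards [hne] with y hy
  by_cases hyR : y ∈ ball x R
  · rw [indicator_of_mem hyR, ← ofReal_norm, norm_mul, Real.norm_of_nonneg (hf y),
      ENNReal.ofReal_mul (hf y)]
    gcongr
    exact hk _ (sub_ne_zero.2 hy)
  · rw [indicator_of_notMem hyR, hk0]
    · simp
    · rw [mem_ball, dist_eq_norm, not_lt] at hyR
      exact hyR

/-- Pointwise potential bound. -/
lemma IsSuperPair.upper_potential (hN : 3 ≤ N) (h : IsSuperPair U f) (hx : x ≠ 0) (hR : 0 < R)
    {C : ℝ} (hC : ∀ z : EuclideanSpace ℝ (Fin N), unitShell z ≤ C) :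
    ENNReal.ofReal (shellMass N * U x) ≤
      ENNReal.ofReal (C * (R ^ N)⁻¹ * ∫ y in ball x R, U y) +
        ∫⁻ y in ball x R, ENNReal.ofReal (f y) * ENNReal.ofReal (2 * ‖y - x‖ ^ (2 - (N : ℝ))) := by
  refine le_of_tendsto ((ENNReal.continuous_ofReal.tendsto _).comp (tendsto_integral_shellKer
    (eventually_continuousAt_of_c2 (h.reg.contDiffAt x hx)))) ?_
  filter_upwards [eventually_small hR] with r hr
  have hrR : r ≤ R := by linarith [hr.1, hr.2]
  rw [Function.comp_apply, h.representation hN hr.1 hrR]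
  refine ENNReal.ofReal_add_le.trans (add_le_add (ENNReal.ofReal_le_ofReal
    (integral_mul_shellKer_le hR hC (h.reg.locallyIntegrable (by omega)) h.nonneg)) ?_)
  refine (ENNReal.ofReal_le_ofReal (le_abs_self _)).trans
    (ofReal_integral_mul_le (by omega) h.rhs_nonneg
      (w := fun z => 2 * ‖z‖ ^ (2 - (N : ℝ))) (fun z hz => ?_)
      (fun z hz => truncKer_eq_zero hr.1 hrR hz))
  rw [abs_of_nonneg (truncKer_nonneg hr.1 hrR)]
  exact truncKer_le hN hr.1 hrR hz

lemma tsupport_pd_truncKer (hr : 0 < r) (hrR : r ≤ R) (i : Fin N) :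
    tsupport (pd i (truncKer r R)) ⊆ closedBall 0 R :=
  tsupport_pd_subset.trans (tsupport_truncKer hr hrR)

/-- Pointwise gradient bound. -/
lemma IsSuperPair.gradient_potential (hN : 3 ≤ N) (h : IsSuperPair U f) (hx : x ≠ 0) (hR : 0 < R)
    {C : ℝ} (i : Fin N) (hC : ∀ z : EuclideanSpace ℝ (Fin N), |pd i unitShell z| ≤ C) :
    ENNReal.ofReal (shellMass N * |pd i U x|) ≤
      ENNReal.ofReal (C * ((R ^ N)⁻¹ * R⁻¹) * ∫ y in ball x R, U y) +
        ∫⁻ y in ball x R, ENNReal.ofReal (f y) * ENNReal.ofReal (2 * ‖y - x‖ ^ (1 - (N : ℝ))) := by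
  have hUl := h.reg.locallyIntegrable (by omega)
  have hm : 0 ≤ shellMass N := (shellMass_pos hN).le
  have hcx : ∀ᶠ y in nhds x, ContinuousAt (pd i U) y :=
    (eventually_c2 (h.reg.contDiffAt x hx)).mono fun y hy =>
      (hy.pd (m := 1) (i := i) (by norm_num)).continuousAt
  have hlim := ((tendsto_integral_shellKer hcx).abs)
  rw [abs_mul, abs_of_nonneg hm] at hlim
  refine le_of_tendsto ((ENNReal.continuous_ofReal.tendsto _).comp hlim) ?_
  filter_upwards [eventually_small hR, Ioo_mem_nhdsGT (norm_pos_iff.2 hx)] with r hr hrx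
  have hrR : r ≤ R := by linarith [hr.1, hr.2]
  have hsm : ContDiff ℝ 2 (pd i (truncKer r R) : EuclideanSpace ℝ (Fin N) → ℝ) :=
    (truncKer_contDiff hr.1 hrR (n := 3)).pd (by norm_num)
  have hshell : ∀ ρ : ℝ, ContDiff ℝ 1 (shellKer ρ : EuclideanSpace ℝ (Fin N) → ℝ) :=
    fun ρ => shellKer_contDiff (n := 1)
  have hlap : ∀ y, lap (fun y => pd i (truncKer r R) (y - x)) y =
      pd i (shellKer R) (y - x) - pd i (shellKer r) (y - x) := fun y => by
    rw [lap_translate x hsm.contDiffAt, lap_pd (truncKer_contDiff hr.1 hrR (n := 3)).contDiffAt,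
      ← pd_sub ((hshell R).differentiable one_ne_zero _) ((hshell r).differentiable one_ne_zero _)]
    exact pd_congr (Eventually.of_forall fun z => lap_truncKer hr.1 hrR)
  have hw := integral_mul_lap_eq hN h.reg h.locallyIntegrable h.neg_lap
    (contDiff_translate (x := x) hsm)
    (hasCompactSupport_translate (tsupport_pd_truncKer hr.1 hrR i))
  simp only [hlap, mul_sub] at hw
  have hsi : ∀ ρ : ℝ, 0 < ρ → Integrable fun y => U y * pd i (shellKer ρ) (y - x) := fun ρ hρ =>
    LocallyIntegrable.integrable_mul_translate hUl (hshell ρ).continuous_pd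
      (tsupport_pd_subset.trans (tsupport_shellKer hρ))
  rw [integral_sub (hsi R hR) (hsi r hr.1)] at hw
  have hparts : ∫ y, U y * pd i (shellKer r) (y - x) = -∫ y, pd i U y * shellKer r (y - x) := by
    have := integral_mul_pd (i := i) (u := U) (v := fun y => shellKer r (y - x)) (fun y hy => ?_)
      (contDiff_translate (hshell r)) (hasCompactSupport_translate (tsupport_shellKer hr.1))
    · simpa only [pd_translate] using this
    · refine (h.reg.contDiffAt y ?_).of_le (by norm_num)
      rintro rfl
      have := tsupport_translate_subset (tsupport_shellKer hr.1) hy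
      rw [mem_closedBall, dist_comm, dist_zero_right] at this
      exact absurd this (not_le.2 hrx.2)
  have hkey : ∫ y, pd i U y * shellKer r (y - x) =
      -(∫ y, f y * pd i (truncKer r R) (y - x)) - ∫ y, U y * pd i (shellKer R) (y - x) := by
    linarith
  have hUb : |∫ y, U y * pd i (shellKer R) (y - x)| ≤
      C * ((R ^ N)⁻¹ * R⁻¹) * ∫ y in ball x R, U y := by
    rw [← integral_const_mul, ← integral_indicator measurableSet_ball, ← Real.norm_eq_abs]
    have hi : IntegrableOn U (ball x R) :=
      (hUl.integrableOn_isCompact (isCompact_closedBall x R)).mono_set ball_subset_closedBall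
    refine norm_integral_le_of_norm_le ((integrable_indicator_iff measurableSet_ball).2
      (hi.const_mul _)) (Eventually.of_forall fun y => ?_)
    rw [norm_mul, Real.norm_of_nonneg (h.nonneg y), Real.norm_eq_abs]
    by_cases hy : y ∈ ball x R
    · rw [indicator_of_mem hy, mul_comm]
      refine mul_le_mul_of_nonneg_right ?_ (h.nonneg y)
      rw [pd_shellKer, abs_mul, abs_of_nonneg (by positivity), mul_comm]
      exact mul_le_mul_of_nonneg_right (hC _) (by positivity)
    · rw [indicator_of_notMem hy]
      rw [mem_ball, dist_eq_norm, not_lt] at hy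
      have hz : pd i (shellKer R) (y - x) = 0 := by
        by_contra hne
        have hn0 : 0 ≤ C := (abs_nonneg _).trans (hC 0)
        have hcl : pd i (shellKer R) (y - x) = 0 := by
          have hmin : IsLocalMin (shellKer R) (y - x) :=
            Eventually.of_forall fun w => by
              rw [shellKer_eq_zero hR hy]; exact shellKer_nonneg hR
          simp [pd, hmin.fderiv_eq_zero]
        exact hne hcl
      simp [hz]
  have htri : |∫ y, pd i U y * shellKer r (y - x)| ≤
      C * ((R ^ N)⁻¹ * R⁻¹) * (∫ y in ball x R, U y) +
        |∫ y, f y * pd i (truncKer r R) (y - x)| := by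
    rw [hkey]
    refine (abs_sub _ _).trans ?_
    rw [abs_neg]
    linarith
  rw [Function.comp_apply]
  refine (ENNReal.ofReal_le_ofReal htri).trans (ENNReal.ofReal_add_le.trans (add_le_add le_rfl ?_))
  exact ofReal_integral_mul_le (by omega) h.rhs_nonneg
    (w := fun z => 2 * ‖z‖ ^ (1 - (N : ℝ))) (fun z hz => abs_pd_truncKer_le hr.1 hrR i hz)
    (fun z hz => pd_truncKer_eq_zero hr.1 hrR i hz)

end Potential

section Solutions

variable {N : ℕ} {a b p q : ℝ} {u v : EuclideanSpace ℝ (Fin N) → ℝ}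

lemma IsHHSol.swap (h : IsHHSol a b p q univ u v) : IsHHSol b a q p univ v u :=
  ⟨h.2.1, h.1, h.2.2.2.1, h.2.2.1, h.2.2.2.2.2.1, h.2.2.2.2.1, h.2.2.2.2.2.2.2, h.2.2.2.2.2.2.1⟩

lemma IsHHSol.pos (h : IsHHSol a b p q univ u v) (x : EuclideanSpace ℝ (Fin N)) : 0 < u x :=
  h.2.2.2.2.1 x (mem_univ x)

lemma IsHHSol.continuous (h : IsHHSol a b p q univ u v) : Continuous u :=
  continuousOn_univ.1 h.1

lemma IsHHSol.contDiffAt (h : IsHHSol a b p q univ u v) {x : EuclideanSpace ℝ (Fin N)}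
    (hx : x ≠ 0) : ContDiffAt ℝ 2 u x :=
  h.2.2.1.contDiffAt ((isOpen_univ.sdiff isClosed_singleton).mem_nhds ⟨mem_univ x, hx⟩)

lemma IsHHSol.neg_lap (h : IsHHSol a b p q univ u v) {x : EuclideanSpace ℝ (Fin N)}
    (hx : x ≠ 0) : -lap u x = ‖x‖ ^ a * v x ^ p :=
  h.2.2.2.2.2.2.1 x ⟨mem_univ x, hx⟩

lemma IsHHSol.regular (h : IsHHSol a b p q univ u v) : RegularOffOrigin u where
  contDiffAt _ hx := h.contDiffAt hx
  bounded R := by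
    obtain ⟨M, hM⟩ :=
      (isCompact_closedBall (0 : EuclideanSpace ℝ (Fin N)) R).exists_bound_of_continuousOn
      h.continuous.continuousOn
    exact ⟨M, fun x hx => hM x (mem_closedBall_zero_iff.2 hx)⟩

lemma locallyIntegrable_weight_mul (hN : 1 ≤ N) (ha : -(N : ℝ) < a)
    {w : EuclideanSpace ℝ (Fin N) → ℝ} (hw : Continuous w) :
    LocallyIntegrable fun x => ‖x‖ ^ a * w x := by
  rw [locallyIntegrable_iff]
  intro K hK
  exact ((locallyIntegrable_norm_rpow hN ha).integrableOn_isCompact hK).mul_continuousOn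
    hw.continuousOn hK

lemma IsHHSol.isSuperPair (hN : 3 ≤ N) (ha : -2 < a) (hp : 0 < p)
    (h : IsHHSol a b p q univ u v) : IsSuperPair u (fun x => ‖x‖ ^ a * v x ^ p) where
  reg := h.regular
  locallyIntegrable := by
    have : (3 : ℝ) ≤ N := by exact_mod_cast hN
    exact locallyIntegrable_weight_mul (by omega) (by linarith)
      (h.swap.continuous.rpow_const fun x => Or.inr hp.le)
  neg_lap _ hx := h.neg_lap hx
  nonneg x := (h.pos x).le
  rhs_nonneg x := mul_nonneg (by positivity) (Real.rpow_nonneg (h.swap.pos x).le _)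

lemma setIntegral_norm_rpow_pos (hN : 1 ≤ N) (ha : -(N : ℝ) < a)
    {A : Set (EuclideanSpace ℝ (Fin N))} (hA : IsOpen A) (hne : A.Nonempty)
    (hb : Bornology.IsBounded A) : 0 < ∫ x in A, ‖x‖ ^ a := by
  have : Nonempty (Fin N) := ⟨⟨0, by omega⟩⟩
  rw [setIntegral_pos_iff_support_of_nonneg_ae (Eventually.of_forall fun x => by positivity)
    (((locallyIntegrable_norm_rpow hN ha).integrableOn_isCompact hb.isCompact_closure).mono_set
      subset_closure)]
  calc 0 < volume A := hA.measure_pos _ hne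
    _ = volume (A \ {0}) := (measure_sdiff_null (measure_singleton 0)).symm
    _ ≤ volume ((Function.support fun x => ‖x‖ ^ a) ∩ A) :=
      measure_mono fun x hx => ⟨(Real.rpow_pos_of_pos (norm_pos_iff.2 hx.2) _).ne', hx.1⟩

/-- A lower bound for `v` forces a lower bound for the mass of `|x|^a v^p`. -/
lemma IsHHSol.rpow_mul_le_setIntegral (hN : 3 ≤ N) (ha : -2 < a) (hp : 0 < p)
    (h : IsHHSol a b p q univ u v) {A : Set (EuclideanSpace ℝ (Fin N))} (hA : MeasurableSet A)
    (hb : Bornology.IsBounded A) {m : ℝ} (hm : 0 ≤ m) (hv : ∀ x ∈ A, x ≠ 0 → m ≤ v x) :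
    m ^ p * ∫ x in A, ‖x‖ ^ a ≤ ∫ x in A, ‖x‖ ^ a * v x ^ p := by
  have : (3 : ℝ) ≤ N := by exact_mod_cast hN
  have : Nonempty (Fin N) := ⟨⟨0, by omega⟩⟩
  rw [← integral_const_mul]
  have hi : ∀ {f : EuclideanSpace ℝ (Fin N) → ℝ}, LocallyIntegrable f → IntegrableOn f A :=
    fun hf => (hf.integrableOn_isCompact hb.isCompact_closure).mono_set subset_closure
  refine setIntegral_mono_on_ae (Integrable.const_mul (hi (locallyIntegrable_norm_rpow (by omega)
    (by linarith))) _) (hi (h.isSuperPair hN ha hp).locallyIntegrable) hA ?_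
  have hne : ∀ᵐ y : EuclideanSpace ℝ (Fin N), y ≠ 0 := compl_mem_ae_iff.2 (measure_singleton 0)
  filter_upwards [hne] with x hx hxA
  rw [mul_comm]
  gcongr
  exact hv x hxA hx

lemma IsHHSol.le_of_setIntegral (hN : 3 ≤ N) (ha : -2 < a) (hp : 0 < p)
    (h : IsHHSol a b p q univ u v) {x : EuclideanSpace ℝ (Fin N)} (hx : x ∈ ball 0 32)
    (hx0 : x ≠ 0) : 3 / 32 * (256 : ℝ) ^ (2 - (N : ℝ)) / shellMass N *
      ∫ y in ball (0 : EuclideanSpace ℝ (Fin N)) 32, ‖y‖ ^ a * v y ^ p ≤ u x := by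
  have := (h.isSuperPair hN ha hp).lower_potential hN hx0 (R := 256) (by norm_num)
    (A := ball 0 32) measurableSet_ball fun y hy => by
      rw [mem_ball_zero_iff] at hx hy
      rw [mem_closedBall, dist_eq_norm]
      linarith [norm_sub_le y x]
  rw [div_mul_eq_mul_div, div_le_iff₀ (shellMass_pos hN)]
  linarith

/-- Universal bound for the mass of the nonlinearity. -/
lemma exists_setIntegral_rhs_le (hN : 3 ≤ N) (ha : -2 < a) (hb : -2 < b) (hp : 0 < p)
    (hq : 0 < q) (hpq : 1 < p * q) : ∃ C : ℝ, 0 < C ∧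
      ∀ u v : EuclideanSpace ℝ (Fin N) → ℝ, IsHHSol a b p q univ u v →
        ∫ y in ball (0 : EuclideanSpace ℝ (Fin N)) 32, ‖y‖ ^ a * v y ^ p ≤ C := by
  have hN3 : (3 : ℝ) ≤ N := by exact_mod_cast hN
  have hm := shellMass_pos hN
  set c : ℝ := 3 / 32 * (256 : ℝ) ^ (2 - (N : ℝ)) / shellMass N
  have hc : 0 < c := by positivity
  set Ia : ℝ := ∫ x in ball (0 : EuclideanSpace ℝ (Fin N)) 32, ‖x‖ ^ a
  set Ib : ℝ := ∫ x in ball (0 : EuclideanSpace ℝ (Fin N)) 32, ‖x‖ ^ b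
  have hIa : 0 < Ia := setIntegral_norm_rpow_pos (by omega) (by linarith) isOpen_ball
    (nonempty_ball.2 (by norm_num)) isBounded_ball
  have hIb : 0 < Ib := setIntegral_norm_rpow_pos (by omega) (by linarith) isOpen_ball
    (nonempty_ball.2 (by norm_num)) isBounded_ball
  set k : ℝ := (c * (c ^ q * Ib)) ^ p * Ia
  have hk : 0 < k := by positivity
  refine ⟨(1 / k) ^ (1 / (p * q - 1)), by positivity, fun u v h => ?_⟩
  set S : ℝ := ∫ y in ball (0 : EuclideanSpace ℝ (Fin N)) 32, ‖y‖ ^ a * v y ^ p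
  set T : ℝ := ∫ y in ball (0 : EuclideanSpace ℝ (Fin N)) 32, ‖y‖ ^ b * u y ^ q
  have hS0 : 0 ≤ S := integral_nonneg (h.isSuperPair hN ha hp).rhs_nonneg
  have hT0 : 0 ≤ T := integral_nonneg (h.swap.isSuperPair hN hb hq).rhs_nonneg
  have hT : (c * S) ^ q * Ib ≤ T := h.swap.rpow_mul_le_setIntegral hN hb hq measurableSet_ball
    isBounded_ball (by positivity) fun x hx hx0 => h.le_of_setIntegral hN ha hp hx hx0
  have hS : (c * T) ^ p * Ia ≤ S := h.rpow_mul_le_setIntegral hN ha hp measurableSet_ball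
    isBounded_ball (by positivity) fun x hx hx0 => h.swap.le_of_setIntegral hN hb hq hx hx0
  rcases hS0.eq_or_lt with hS0 | hS0
  · rw [← hS0]; positivity
  have h1 : k * S ^ (p * q) ≤ S := by
    refine le_trans (le_of_eq ?_) ((mul_le_mul_of_nonneg_right (Real.rpow_le_rpow (by positivity)
      (mul_le_mul_of_nonneg_left hT hc.le) hp.le) hIa.le).trans hS)
    rw [Real.mul_rpow hc.le hS0.le,
      show c * (c ^ q * S ^ q * Ib) = c * (c ^ q * Ib) * S ^ q by ring,
      Real.mul_rpow (by positivity) (by positivity), ← Real.rpow_mul hS0.le, mul_comm q p]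
    ring
  have h2 : S ^ (p * q - 1) ≤ 1 / k := by
    rw [Real.rpow_sub_one hS0.ne', div_le_div_iff₀ hS0 hk]
    linarith
  calc S = (S ^ (p * q - 1)) ^ (1 / (p * q - 1)) := by
        rw [← Real.rpow_mul hS0.le, mul_one_div_cancel (by linarith), Real.rpow_one]
    _ ≤ _ := Real.rpow_le_rpow (by positivity) h2 (by
        have : 0 < p * q - 1 := by linarith
        positivity)

/-- Universal bound for the mass of a solution. -/
lemma exists_setIntegral_le (hN : 3 ≤ N) (ha : -2 < a) (hb : -2 < b) (hp : 0 < p)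
    (hq : 0 < q) (hpq : 1 < p * q) : ∃ C : ℝ, 0 < C ∧
      ∀ u v : EuclideanSpace ℝ (Fin N) → ℝ, IsHHSol a b p q univ u v →
        ∫ y in ball (0 : EuclideanSpace ℝ (Fin N)) 4, v y ≤ C := by
  have hN3 : (3 : ℝ) ≤ N := by exact_mod_cast hN
  have : Nonempty (Fin N) := ⟨⟨0, by omega⟩⟩
  have hm := shellMass_pos hN
  obtain ⟨C, hC, hbd⟩ := exists_setIntegral_rhs_le hN ha hb hp hq hpq
  set A : Set (EuclideanSpace ℝ (Fin N)) := ball 0 25 \ closedBall 0 24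
  have hAo : IsOpen A := isOpen_ball.sdiff isClosed_closedBall
  have hAb : Bornology.IsBounded A := isBounded_ball.subset sdiff_subset
  have hAn : A.Nonempty := by
    obtain ⟨x, hx⟩ := exists_norm_eq (EuclideanSpace ℝ (Fin N)) (c := 24.5) (by norm_num)
    exact ⟨x, by rw [mem_ball_zero_iff, hx]; norm_num,
      by rw [mem_closedBall_zero_iff, hx]; norm_num⟩
  set I : ℝ := ∫ x in A, ‖x‖ ^ a
  have hI : 0 < I := setIntegral_norm_rpow_pos (by omega) (by linarith) hAo hAn hAb
  set c : ℝ := 4 * ((32 : ℝ) ^ N)⁻¹ / shellMass N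
  have hc : 0 < c := by positivity
  refine ⟨(C / I) ^ (1 / p) / c, by positivity, fun u v h => ?_⟩
  set S : ℝ := ∫ y in ball (0 : EuclideanSpace ℝ (Fin N)) 4, v y
  have hS : 0 ≤ S := integral_nonneg fun x => (h.swap.pos x).le
  have hv : ∀ x ∈ A, x ≠ 0 → c * S ≤ v x := fun x hx hx0 => by
    have := (h.swap.isSuperPair hN hb hq).lower_shell hN hx0 (R := 32) (by norm_num)
      (A := ball 0 4) measurableSet_ball fun y hy => by
        have h1 := mem_ball_zero_iff.1 hx.1
        have h2 := mem_closedBall_zero_iff.not.1 hx.2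
        have h3 := mem_ball_zero_iff.1 hy
        have h4 := norm_sub_le y x
        have h5 := norm_sub_norm_le x y
        rw [norm_sub_rev] at h5
        constructor <;> nlinarith [norm_nonneg (y - x), norm_nonneg y]
    rw [div_mul_eq_mul_div, div_le_iff₀ hm]
    linarith
  have h1 := h.rpow_mul_le_setIntegral hN ha hp hAo.measurableSet hAb (by positivity) hv
  have h2 : ∫ x in A, ‖x‖ ^ a * v x ^ p ≤ C := by
    refine (setIntegral_mono_set (((h.isSuperPair hN ha hp).locallyIntegrable.integrableOn_isCompact
      (isCompact_closedBall 0 32)).mono_set ball_subset_closedBall)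
      (Eventually.of_forall (h.isSuperPair hN ha hp).rhs_nonneg) ?_).trans (hbd u v h)
    exact (sdiff_subset.trans (ball_subset_ball (by norm_num))).eventuallyLE
  have h3 : (c * S) ^ p ≤ C / I := by
    rw [le_div_iff₀ hI]; exact h1.trans h2
  rw [le_div_iff₀ hc, mul_comm]
  calc c * S = ((c * S) ^ p) ^ (1 / p) := by
        rw [← Real.rpow_mul (by positivity), mul_one_div_cancel hp.ne', Real.rpow_one]
    _ ≤ _ := Real.rpow_le_rpow (by positivity) h3 (by positivity)

end Solutions

section Rescaling

variable {N : ℕ} {a b p q : ℝ} {u v : EuclideanSpace ℝ (Fin N) → ℝ}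

/-- The exponent with which the first component of a solution rescales; that of the second
component is `scaleExp b a q p`. -/
noncomputable def scaleExp (a b p q : ℝ) : ℝ := (2 * (p + 1) + a + b * p) / (p * q - 1)

lemma scaleExp_pos (ha : -2 < a) (hb : -2 < b) (hp : 0 < p) (hpq : 1 < p * q) :
    0 < scaleExp a b p q := by
  refine div_pos ?_ (by linarith)
  nlinarith

lemma scaleExp_add (hpq : 1 < p * q) :
    scaleExp a b p q + 2 + a = scaleExp b a q p * p := by
  have h : p * q - 1 ≠ 0 := by linarith
  rw [scaleExp, scaleExp, mul_comm q p]
  field_simp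
  ring

lemma rescale_equation (hpq : 1 < p * q) {R : ℝ} (hR : 0 < R) (h : IsHHSol a b p q univ u v)
    {x : EuclideanSpace ℝ (Fin N)} (hx : x ≠ 0) :
    -lap (fun y => R ^ scaleExp a b p q * u (R • y)) x =
      ‖x‖ ^ a * (R ^ scaleExp b a q p * v (R • x)) ^ p := by
  have hRx : R • x ≠ 0 := smul_ne_zero hR.ne' hx
  have hc : ContDiffAt ℝ 2 (fun y => u (R • y)) x :=
    (h.contDiffAt hRx).comp x (contDiff_const_smul R).contDiffAt
  rw [lap_const_mul _ hc, lap_smul_arg R (h.contDiffAt hRx), Real.mul_rpow (by positivity)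
    (h.swap.pos _).le, ← Real.rpow_mul hR.le, ← scaleExp_add hpq, Real.rpow_add hR,
    Real.rpow_add hR, Real.rpow_two]
  have := h.neg_lap hRx
  rw [norm_smul, Real.norm_of_nonneg hR.le, Real.mul_rpow hR.le (norm_nonneg x)] at this
  linear_combination R ^ scaleExp a b p q * R ^ 2 * this

lemma IsHHSol.rescale (hpq : 1 < p * q) {R : ℝ} (hR : 0 < R) (h : IsHHSol a b p q univ u v) :
    IsHHSol a b p q univ (fun x => R ^ scaleExp a b p q * u (R • x))
      (fun x => R ^ scaleExp b a q p * v (R • x)) := by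
  have hc : ∀ {a b p q : ℝ} {u v : EuclideanSpace ℝ (Fin N) → ℝ}, IsHHSol a b p q univ u v →
      Continuous (fun x => R ^ scaleExp a b p q * u (R • x)) ∧
      ContDiffOn ℝ 2 (fun x => R ^ scaleExp a b p q * u (R • x)) (univ \ {0}) :=
    fun h => ⟨continuous_const.mul (h.continuous.comp (continuous_const_smul R)),
      fun x hx => (contDiffAt_const.mul ((h.contDiffAt (smul_ne_zero hR.ne' hx.2)).comp x
        (contDiff_const_smul R).contDiffAt)).contDiffWithinAt⟩
  refine ⟨(hc h).1.continuousOn, (hc h.swap).1.continuousOn, (hc h).2, (hc h.swap).2,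
    fun x _ => mul_pos (by positivity) (h.pos _), fun x _ => mul_pos (by positivity) (h.swap.pos _),
    fun x hx => rescale_equation hpq hR h hx.2,
    fun x hx => rescale_equation (mul_comm p q ▸ hpq) hR h.swap hx.2⟩

/-- Averages of a solution over large balls decay. -/
lemma IsHHSol.tendsto_average (hN : 3 ≤ N) (ha : -2 < a) (hb : -2 < b) (hp : 0 < p)
    (hq : 0 < q) (hpq : 1 < p * q) (h : IsHHSol a b p q univ u v) :
    Tendsto (fun R : ℝ => (R ^ N)⁻¹ * ∫ x in ball (0 : EuclideanSpace ℝ (Fin N)) (4 * R), v x)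
      atTop (nhds 0) := by
  obtain ⟨C, hC, hbd⟩ := exists_setIntegral_le hN ha hb hp hq hpq
  have hβ := scaleExp_pos hb ha hq (mul_comm p q ▸ hpq)
  have hlim : Tendsto (fun R : ℝ => C * R ^ (-scaleExp b a q p)) atTop (nhds 0) := by
    simpa using (tendsto_rpow_neg_atTop hβ).const_mul C
  refine squeeze_zero' ?_ ?_ hlim
  · filter_upwards [eventually_gt_atTop 0] with R hR
    exact mul_nonneg (by positivity) (integral_nonneg fun x => (h.swap.pos x).le)
  · filter_upwards [eventually_gt_atTop 0] with R hR
    have := hbd _ _ (h.rescale hpq hR)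
    rw [integral_const_mul, Measure.setIntegral_comp_smul_of_pos _ _ _ hR, _root_.smul_ball hR.ne',
      finrank_euclideanSpace_fin, smul_zero, Real.norm_of_nonneg hR.le, mul_comm R 4,
      smul_eq_mul] at this
    rw [Real.rpow_neg hR.le, ← div_eq_mul_inv, le_div_iff₀ (by positivity)]
    linarith

end Rescaling

section Comparison

variable {N : ℕ} {a b p q : ℝ} {u v : EuclideanSpace ℝ (Fin N) → ℝ}

lemma hasDerivAt_posPart_pow (n : ℕ) (t : ℝ) :
    HasDerivAt (fun t : ℝ => (max t 0) ^ (n + 2)) ((n + 2 : ℕ) * (max t 0) ^ (n + 1)) t := by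
  rcases lt_trichotomy t 0 with ht | rfl | ht
  · have : (fun s : ℝ => (max s 0) ^ (n + 2)) =ᶠ[nhds t] fun _ => 0 := by
      filter_upwards [Iio_mem_nhds ht] with s hs
      rw [max_eq_right (le_of_lt hs)]; simp
    rw [max_eq_right ht.le]
    simpa using (hasDerivAt_const t (0 : ℝ)).congr_of_eventuallyEq this
  · rw [hasDerivAt_iff_isLittleO_nhds_zero]
    simp only [zero_add, max_self, ne_eq, Nat.add_eq_zero_iff, OfNat.ofNat_ne_zero, and_false,
      not_false_eq_true, zero_pow, sub_zero, one_ne_zero, mul_zero, smul_zero]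
    refine Asymptotics.IsBigO.trans_isLittleO (g := fun s : ℝ => s ^ (n + 2)) ?_ ?_
    · refine Asymptotics.IsBigO.of_bound 1 (Eventually.of_forall fun s => ?_)
      rw [one_mul, norm_pow, norm_pow]
      gcongr
      rw [Real.norm_of_nonneg (le_max_right _ _), Real.norm_eq_abs]
      exact max_le (le_abs_self s) (abs_nonneg s)
    · simpa using Asymptotics.isLittleO_pow_pow (𝕜 := ℝ) (show 1 < n + 2 by omega)
  · have : (fun s : ℝ => (max s 0) ^ (n + 2)) =ᶠ[nhds t] fun s => s ^ (n + 2) := by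
      filter_upwards [Ioi_mem_nhds ht] with s hs
      rw [max_eq_left (le_of_lt hs)]
    rw [max_eq_left ht.le]
    exact (hasDerivAt_pow (n + 2) t).congr_of_eventuallyEq this

lemma contDiff_posPart_cube : ContDiff ℝ 2 fun t : ℝ => (max t 0) ^ 3 := by
  have h1 : deriv (fun t : ℝ => (max t 0) ^ 3) = fun t => 3 * (max t 0) ^ 2 := by
    ext t; simpa using (hasDerivAt_posPart_pow 1 t).deriv
  have h2 : deriv (fun t : ℝ => 3 * (max t 0) ^ 2) = fun t => 3 * (2 * max t 0) := by
    ext t; simpa using ((hasDerivAt_posPart_pow 0 t).const_mul 3).deriv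
  rw [show (2 : WithTop ℕ∞) = 1 + 1 by norm_num, contDiff_succ_iff_deriv]
  refine ⟨fun t => (hasDerivAt_posPart_pow 1 t).differentiableAt, by simp, ?_⟩
  rw [h1, contDiff_one_iff_deriv, h2]
  exact ⟨fun t => ((hasDerivAt_posPart_pow 0 t).const_mul 3).differentiableAt, by fun_prop⟩

lemma lap_posPart_cube_nonneg {w : EuclideanSpace ℝ (Fin N) → ℝ} {x : EuclideanSpace ℝ (Fin N)}
    (hw : ContDiffAt ℝ 2 w x) (h : 0 < w x → 0 ≤ lap w x) :
    0 ≤ lap (fun y => (max (w y) 0) ^ 3) x := by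
  rw [lap_comp (g' := fun t => 3 * (max t 0) ^ 2) (g'' := 3 * (2 * max (w x) 0)) hw
    contDiff_posPart_cube.contDiffAt
    (Eventually.of_forall fun t => by simpa using hasDerivAt_posPart_pow 1 t)
    (by simpa using (hasDerivAt_posPart_pow 0 (w x)).const_mul 3)]
  have h1 : 0 ≤ max (w x) 0 := le_max_right _ _
  have h2 : 0 ≤ ∑ i, pd i w x ^ 2 := Finset.sum_nonneg fun i _ => sq_nonneg _
  rcases le_or_gt (w x) 0 with h0 | h0
  · simp [max_eq_right h0]
  · have := h h0
    positivity

/-- The Laplacian of `exp (σ log u - h log |x|)`. -/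
lemma lap_exp_log_le {σ h : ℝ} (hσ0 : 0 ≤ σ) (hσ1 : σ ≤ 1) (hh0 : 0 ≤ h)
    (hh : h ≤ (1 - σ) * (N - 2)) {x : EuclideanSpace ℝ (Fin N)} (hx : x ≠ 0)
    (hu : ContDiffAt ℝ 2 u x) (hux : 0 < u x) :
    ContDiffAt ℝ 2 (fun y => Real.exp (σ * Real.log (u y) + -(h / 2) * Real.log (‖y‖ ^ 2))) x ∧
    lap (fun y => Real.exp (σ * Real.log (u y) + -(h / 2) * Real.log (‖y‖ ^ 2))) x ≤
      Real.exp (σ * Real.log (u x) + -(h / 2) * Real.log (‖x‖ ^ 2)) * (σ * (lap u x / u x)) := by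
  have hs : 0 < ‖x‖ ^ 2 := by positivity
  have hn : ContDiffAt ℝ 2 (fun y : EuclideanSpace ℝ (Fin N) => ‖y‖ ^ 2) x :=
    (contDiff_norm_sq ℝ).contDiffAt
  have hlu : ContDiffAt ℝ 2 (fun y => Real.log (u y)) x := hu.log hux.ne'
  have hln : ContDiffAt ℝ 2 (fun y : EuclideanSpace ℝ (Fin N) => Real.log (‖y‖ ^ 2)) x :=
    hn.log hs.ne'
  have hlogd : ∀ {t : ℝ}, 0 < t → ∀ᶠ s in nhds t, HasDerivAt Real.log s⁻¹ s := fun ht => by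
    filter_upwards [Ioi_mem_nhds ht] with s hs using Real.hasDerivAt_log (ne_of_gt hs)
  have hlogd2 : ∀ {t : ℝ}, 0 < t → HasDerivAt (fun s : ℝ => s⁻¹) (-(t ^ 2)⁻¹) t :=
    fun ht => hasDerivAt_inv ht.ne'
  have e1 := lap_comp hu (Real.contDiffAt_log.2 hux.ne') (hlogd hux) (hlogd2 hux)
  have e2 := lap_comp hn (Real.contDiffAt_log.2 hs.ne') (hlogd hs) (hlogd2 hs)
  have hL : ContDiffAt ℝ 2 (fun y => σ * Real.log (u y) + -(h / 2) * Real.log (‖y‖ ^ 2)) x :=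
    (contDiffAt_const.mul hlu).add (contDiffAt_const.mul hln)
  have e3 := lap_comp (g := Real.exp) hL Real.contDiff_exp.contDiffAt
    (Eventually.of_forall fun t => Real.hasDerivAt_exp t) (Real.hasDerivAt_exp _)
  have e4 := lap_add (u := fun y => σ * Real.log (u y))
    (v := fun y : EuclideanSpace ℝ (Fin N) => -(h / 2) * Real.log (‖y‖ ^ 2))
    (contDiffAt_const.mul hlu) (contDiffAt_const.mul hln)
  rw [lap_const_mul _ hlu, lap_const_mul _ hln, e1, e2, lap_normSq] at e4
  have e5 : ∀ i, pd i (fun y => σ * Real.log (u y) + -(h / 2) * Real.log (‖y‖ ^ 2)) x =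
      σ * ((u x)⁻¹ * pd i u x) + -(h / 2) * ((‖x‖ ^ 2)⁻¹ * (2 * x i)) := fun i => by
    rw [pd_add (differentiableAt_of_c2 (contDiffAt_const.mul hlu))
      (differentiableAt_of_c2 (contDiffAt_const.mul hln)),
      pd_const_mul _ (differentiableAt_of_c2 hlu), pd_const_mul _ (differentiableAt_of_c2 hln),
      pd_comp (Real.hasDerivAt_log hux.ne') (differentiableAt_of_c2 hu),
      pd_comp (Real.hasDerivAt_log hs.ne') (differentiableAt_of_c2 hn), pd_normSq]
  refine ⟨hL.exp, ?_⟩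
  rw [e3, e4, ← mul_add]
  refine mul_le_mul_of_nonneg_left ?_ (Real.exp_pos _).le
  simp only [e5, pd_normSq]
  set s := ‖x‖ ^ 2
  have hX : ∑ i, x i ^ 2 = s := (EuclideanSpace.real_norm_sq_eq x).symm
  set A := ∑ i, pd i u x ^ 2
  set B := ∑ i, pd i u x * x i
  have h1 : ∑ i, (σ * ((u x)⁻¹ * pd i u x) + -(h / 2) * (s⁻¹ * (2 * x i))) ^ 2 =
      σ ^ 2 * (u x)⁻¹ ^ 2 * A - 2 * σ * h * (u x)⁻¹ * s⁻¹ * B + h ^ 2 * s⁻¹ ^ 2 * s := by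
    rw [← hX, Finset.mul_sum, Finset.mul_sum, Finset.mul_sum, ← Finset.sum_sub_distrib,
      ← Finset.sum_add_distrib, hX]
    exact Finset.sum_congr rfl fun i _ => by ring
  have h2 : 0 ≤ (1 - σ) ^ 2 * (u x)⁻¹ ^ 2 * A + 2 * (1 - σ) * h * (u x)⁻¹ * s⁻¹ * B +
      h ^ 2 * s⁻¹ ^ 2 * s := by
    have : 0 ≤ ∑ i, ((1 - σ) * (u x)⁻¹ * pd i u x + h * s⁻¹ * x i) ^ 2 :=
      Finset.sum_nonneg fun i _ => sq_nonneg _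
    refine this.trans_eq ?_
    rw [← hX, Finset.mul_sum, Finset.mul_sum, Finset.mul_sum, ← Finset.sum_add_distrib,
      ← Finset.sum_add_distrib, hX]
    exact Finset.sum_congr rfl fun i _ => by ring
  have h3 : ∑ i, (2 * x i) ^ 2 = 4 * s := by
    rw [← hX, Finset.mul_sum]
    exact Finset.sum_congr rfl fun i _ => by ring
  rw [h1, h3]
  have hss : s⁻¹ * s = 1 := inv_mul_cancel₀ hs.ne'
  have hsi : 0 < s⁻¹ := inv_pos.2 hs
  have e6 : -(s ^ 2)⁻¹ * (4 * s) = -(4 * s⁻¹) := by field_simp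
  rw [e6, ← inv_pow (u x)]
  have e7 : s⁻¹ ^ 2 * s = s⁻¹ := by rw [sq, mul_assoc, hss, mul_one]
  rw [mul_assoc (h ^ 2), e7] at h2 ⊢
  rw [div_eq_inv_mul (lap u x)]
  rcases hσ1.eq_or_lt with rfl | hlt
  · obtain rfl : h = 0 := le_antisymm (by simpa using hh) hh0
    linarith
  · have hk : 0 < 1 - σ := by linarith
    have h4 : h * s⁻¹ * h ≤ h * s⁻¹ * ((1 - σ) * (N - 2)) := by gcongr
    refine le_of_mul_le_mul_left ?_ hk
    nlinarith [mul_nonneg hσ0 h2, h4]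

/-- The pointwise comparison of the two nonlinearities along a bounded solution. -/
lemma IsHHSol.comparison (hN : 3 ≤ N) (ha : -2 < a) (hb : -2 < b) (hq : 0 < q) (hqp : q ≤ p)
    (hpq : 1 < p * q) (hab : 0 ≤ a - b) (hab' : a - b ≤ ((N : ℝ) - 2) * (p - q))
    (h : IsHHSol a b p q univ u v) {M : ℝ} (hM : ∀ x, v x ≤ M) {x : EuclideanSpace ℝ (Fin N)}
    (hx : x ≠ 0) :
    ‖x‖ ^ a * v x ^ (p + 1) ≤ (p + 1) / (q + 1) * (‖x‖ ^ b * u x ^ (q + 1)) := by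
  have hp : 0 < p := hq.trans_le hqp
  set σ := (q + 1) / (p + 1)
  set k := (a - b) / (p + 1)
  have hσ : 0 < σ := by positivity
  have hσ1 : σ ≤ 1 := (div_le_one (by positivity)).2 (by linarith)
  have hσp : σ * (p + 1) = q + 1 := div_mul_cancel₀ _ (by positivity)
  have hkp : k * (p + 1) = a - b := div_mul_cancel₀ _ (by positivity)
  have hk0 : 0 ≤ k := by positivity
  have hk : k ≤ (1 - σ) * (N - 2) := by
    refine le_of_mul_le_mul_right ?_ (show 0 < p + 1 by positivity)
    rw [hkp, show (1 - σ) * ((N : ℝ) - 2) * (p + 1) = (p + 1 - σ * (p + 1)) * (N - 2) by ring, hσp]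
    linarith
  set l := (1 / σ) ^ (1 / (p + 1))
  have hl : 0 < l := by positivity
  have hlp : l ^ (p + 1) * σ = 1 := by
    rw [← Real.rpow_mul (by positivity), one_div_mul_cancel (by positivity), Real.rpow_one,
      one_div_mul_cancel hσ.ne']
  set E : EuclideanSpace ℝ (Fin N) → ℝ :=
    fun y => Real.exp (σ * Real.log (u y) + -(k / 2) * Real.log (‖y‖ ^ 2))
  have hE : ∀ y, y ≠ 0 → E y = ‖y‖ ^ (-k) * u y ^ σ := fun y hy => by
    rw [Real.rpow_def_of_pos (h.pos y), Real.rpow_def_of_pos (norm_pos_iff.2 hy), ← Real.exp_add]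
    simp only [E, Real.log_pow]
    congr 1
    push_cast
    ring
  have hEpow : ∀ y, y ≠ 0 → ‖y‖ ^ a * E y ^ (p + 1) = ‖y‖ ^ b * u y ^ (q + 1) := fun y hy => by
    have hn := norm_pos_iff.2 hy
    rw [hE y hy, Real.mul_rpow (by positivity) (Real.rpow_nonneg (h.pos y).le _),
      ← Real.rpow_mul hn.le, ← Real.rpow_mul (h.pos y).le, hσp, ← mul_assoc, ← Real.rpow_add hn]
    congr 2
    linarith
  set w : EuclideanSpace ℝ (Fin N) → ℝ := fun y => v y + -l * E y
  have hEl := fun y (hy : y ≠ 0) => lap_exp_log_le hσ.le hσ1 hk0 hk hy (h.contDiffAt hy) (h.pos y)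
  have hwc : ∀ y, y ≠ 0 → ContDiffAt ℝ 2 w y := fun y hy =>
    (h.swap.contDiffAt hy).add (contDiffAt_const.mul (hEl y hy).1)
  have hwlap : ∀ y, y ≠ 0 → 0 < w y → 0 ≤ lap w y := fun y hy hpos => by
    have hEy : 0 < E y := Real.exp_pos _
    have e1 : lap w y = lap v y + -l * lap E y := by
      rw [lap_add (h.swap.contDiffAt hy) (contDiffAt_const.mul (hEl y hy).1),
        lap_const_mul _ (hEl y hy).1]
    have e2 : lap u y = -(‖y‖ ^ a * v y ^ p) := by linarith [h.neg_lap hy]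
    have e3 : lap v y = -(‖y‖ ^ b * u y ^ q) := by linarith [h.swap.neg_lap hy]
    have e4 : lap E y ≤ E y * (σ * (lap u y / u y)) := (hEl y hy).2
    have hv : l * E y ≤ v y := by simp only [w] at hpos; linarith
    have e5 : l ^ p * E y ^ p ≤ v y ^ p := by
      rw [← Real.mul_rpow hl.le hEy.le]
      exact Real.rpow_le_rpow (by positivity) hv hp.le
    have hup := h.pos y
    have e6 : ‖y‖ ^ b * u y ^ q * u y ≤ l * E y * σ * (‖y‖ ^ a * v y ^ p) := by
      calc ‖y‖ ^ b * u y ^ q * u y = ‖y‖ ^ b * u y ^ (q + 1) := by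
            rw [Real.rpow_add_one hup.ne', mul_assoc]
        _ = (l ^ (p + 1) * σ) * (‖y‖ ^ a * E y ^ (p + 1)) := by rw [hlp, one_mul, hEpow y hy]
        _ = l * E y * σ * (‖y‖ ^ a * (l ^ p * E y ^ p)) := by
            rw [Real.rpow_add_one hl.ne', Real.rpow_add_one hEy.ne']; ring
        _ ≤ _ := by gcongr
    rw [e1, e3]
    rw [e2] at e4
    have e7 : ‖y‖ ^ b * u y ^ q ≤ l * (E y * (σ * (‖y‖ ^ a * v y ^ p / u y))) := by
      rw [show l * (E y * (σ * (‖y‖ ^ a * v y ^ p / u y))) =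
        l * E y * σ * (‖y‖ ^ a * v y ^ p) / u y by ring, le_div_iff₀ hup]
      exact e6
    have e8 : E y * (σ * (-(‖y‖ ^ a * v y ^ p) / u y)) =
      -(E y * (σ * (‖y‖ ^ a * v y ^ p / u y))) := by ring
    rw [e8] at e4
    nlinarith
  set z : EuclideanSpace ℝ (Fin N) → ℝ := fun y => (max (w y) 0) ^ 3
  have hz0 : ∀ y, 0 ≤ z y := fun y => pow_nonneg (le_max_right _ _) 3
  have hM0 : 0 < M := (h.swap.pos 0).trans_le (hM 0)
  have hzv : ∀ y, z y ≤ M ^ 2 * v y := fun y => by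
    have hEy : 0 < E y := Real.exp_pos _
    have h1 : max (w y) 0 ≤ v y := max_le (by
      simp only [w]; nlinarith [mul_pos hl hEy]) (h.swap.pos y).le
    calc z y ≤ v y ^ 3 := pow_le_pow_left₀ (le_max_right _ _) h1 3
      _ = v y ^ 2 * v y := by ring
      _ ≤ M ^ 2 * v y := by
        have := h.swap.pos y
        gcongr
        exact hM y
  have hzr : RegularOffOrigin z := ⟨fun y hy =>
      contDiff_posPart_cube.contDiffAt.comp y (hwc y hy), fun R => ⟨M ^ 2 * M, fun y _ => by
        rw [abs_of_nonneg (hz0 y)]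
        exact (hzv y).trans (by gcongr; exact hM y)⟩⟩
  have hzl : ∀ y ≠ 0, 0 ≤ lap z y := fun y hy =>
    lap_posPart_cube_nonneg (hwc y hy) (hwlap y hy)
  obtain ⟨C, hC0, hC⟩ := exists_unitShell_bound N
  have hlim := (h.tendsto_average hN ha hb hp hq hpq).const_mul (C * M ^ 2)
  rw [mul_zero] at hlim
  have hzx : shellMass N * z x ≤ 0 := by
    refine ge_of_tendsto hlim ?_
    filter_upwards [eventually_ge_atTop ‖x‖] with R hR
    have hR0 : 0 < R := (norm_pos_iff.2 hx).trans_le hR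
    have hzi := hzr.locallyIntegrable (by omega : 1 ≤ N)
    have hvi := h.swap.regular.locallyIntegrable (by omega : 1 ≤ N)
    have hvb : IntegrableOn v (ball 0 (4 * R)) :=
      (hvi.integrableOn_isCompact (isCompact_closedBall _ _)).mono_set ball_subset_closedBall
    have hsub : ball x R ⊆ ball 0 (4 * R) := ball_subset_ball' (by rw [dist_zero_right]; linarith)
    have e1 := (subharmonic_le_shell hN hzr hzl hx hR0).trans
      (integral_mul_shellKer_le hR0 (fun y => (hC y).1) hzi hz0)
    have e2 : ∫ y in ball x R, z y ≤ M ^ 2 * ∫ y in ball 0 (4 * R), v y := by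
      rw [← integral_const_mul]
      refine (setIntegral_mono_on ((hzi.integrableOn_isCompact (isCompact_closedBall x R)).mono_set
        ball_subset_closedBall) ((hvb.mono_set hsub).const_mul _) measurableSet_ball
        fun y _ => hzv y).trans (setIntegral_mono_set (hvb.const_mul _) (Eventually.of_forall
          fun y => mul_nonneg (by positivity) (h.swap.pos y).le) hsub.eventuallyLE)
    refine e1.trans ((mul_le_mul_of_nonneg_left e2 (by positivity)).trans_eq ?_)
    ring
  have hw0 : w x ≤ 0 := by
    by_contra! hw
    have : 0 < z x := pow_pos (lt_max_of_lt_left hw) 3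
    have := mul_pos (shellMass_pos hN) this
    linarith
  have hvE : v x ≤ l * E x := by simp only [w] at hw0; linarith
  have hEx : 0 < E x := Real.exp_pos _
  calc ‖x‖ ^ a * v x ^ (p + 1) ≤ ‖x‖ ^ a * (l * E x) ^ (p + 1) := by
        gcongr
        exact (h.swap.pos x).le
    _ = l ^ (p + 1) * (‖x‖ ^ a * E x ^ (p + 1)) := by
        rw [Real.mul_rpow hl.le hEx.le]; ring
    _ = _ := by
        rw [hEpow x hx]
        congr 1
        rw [eq_div_iff (by positivity), ← hσp, ← mul_assoc, hlp, one_mul]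

end Comparison

section Riesz

lemma lintegral_ball_enorm_rpow_lt_top {E : Type*} [NormedAddCommGroup E] [NormedSpace ℝ E]
    [FiniteDimensional ℝ E] [MeasurableSpace E] [BorelSpace E] (μ : Measure E)
    [μ.IsAddHaarMeasure] (hE : 1 ≤ Module.finrank ℝ E) {γ : ℝ} (hγ : γ < Module.finrank ℝ E) :
    ∫⁻ z in ball (0 : E) 1, ‖z‖ₑ ^ (-γ) ∂μ < ⊤ := by
  have : Nontrivial E := Module.finrank_pos_iff.1 (by omega : 0 < Module.finrank ℝ E)
  have h : LocallyIntegrable (fun z : E => ‖z‖ ^ (-γ)) μ :=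
    locallyIntegrable_of_norm_le_rpow (C := 1) (α := γ) hE hγ
      (Eventually.of_forall fun x => by
        rw [one_mul, Real.norm_of_nonneg (by positivity)])
      (by fun_prop : Measurable _).aestronglyMeasurable
  have h2 := ((h.integrableOn_isCompact (isCompact_closedBall 0 1)).mono_set
    (ball_subset_closedBall)).2
  rw [hasFiniteIntegral_iff_enorm] at h2
  refine (lintegral_mono_ae ?_).trans_lt h2
  have hne : ∀ᵐ z ∂(μ.restrict (ball (0 : E) 1)), z ≠ 0 :=
    ae_restrict_of_ae (compl_mem_ae_iff.2 (measure_singleton 0))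
  filter_upwards [hne] with z hz
  rw [Real.enorm_eq_ofReal (by positivity), ← ofReal_norm,
    ENNReal.ofReal_rpow_of_pos (norm_pos_iff.2 hz)]

variable {N : ℕ}

/-- The Riesz-type potential of order `m`, truncated to unit distance. -/
noncomputable def rieszPot (m : ℝ) (F : EuclideanSpace ℝ (Fin N) → ENNReal)
    (x : EuclideanSpace ℝ (Fin N)) : ENNReal :=
  ∫⁻ y in ball x 1, F y * ‖y - x‖ₑ ^ (-m)

/-- The potential of a mass distribution seen from the sphere of radius `r`. -/
noncomputable def radialPot (τ : ℝ) (G : EuclideanSpace ℝ (Fin N) → ENNReal) (r : ℝ) : ENNReal :=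
  ∫⁻ y, G y * ‖‖y‖ - r‖ₑ ^ (-τ)

lemma setLIntegral_ball_comp_sub (g : EuclideanSpace ℝ (Fin N) → ENNReal)
    (x : EuclideanSpace ℝ (Fin N)) : ∫⁻ y in ball x 1, g (y - x) = ∫⁻ z in ball 0 1, g z := by
  rw [← lintegral_indicator measurableSet_ball, ← lintegral_indicator measurableSet_ball,
    ← lintegral_sub_right_eq_self ((ball 0 1).indicator g) x]
  congr 1
  ext y
  by_cases h : y ∈ ball x 1
  · rw [indicator_of_mem h, indicator_of_mem (by simpa [dist_eq_norm] using h)]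
  · rw [indicator_of_notMem h, indicator_of_notMem (by simpa [dist_eq_norm] using h)]

lemma enorm_norm_sub_norm_le (x y : EuclideanSpace ℝ (Fin N)) : ‖‖y‖ - ‖x‖‖ₑ ≤ ‖y - x‖ₑ := by
  rw [← ofReal_norm, ← ofReal_norm (y - x)]
  exact ENNReal.ofReal_le_ofReal (abs_norm_sub_norm_le y x)

lemma enorm_rpow_neg_antitone {s t : ENNReal} (h : s ≤ t) {τ : ℝ} (hτ : 0 ≤ τ) :
    t ^ (-τ) ≤ s ^ (-τ) := by
  rw [ENNReal.rpow_neg, ENNReal.rpow_neg]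
  exact ENNReal.inv_le_inv.2 (ENNReal.rpow_le_rpow h hτ)

lemma kernel_split {φ d l : ENNReal} (hd0 : d ≠ 0) (hd1 : d ≤ 1) (hl : l ≤ d)
    {s lam m γ τ : ℝ} (hs : 1 ≤ s) (hlam : s ≤ lam) (hτ : 0 ≤ τ)
    (hm : m ≤ γ * (1 / lam + 1 - 1 / s) + τ * (1 / s - 1 / lam)) :
    φ * d ^ (-m) ≤ (φ ^ s * d ^ (-γ)) ^ (1 / lam) * (φ ^ s * l ^ (-τ)) ^ (1 / s - 1 / lam) *
      (d ^ (-γ)) ^ (1 - 1 / s) := by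
  have hs0 : 0 < s := by linarith
  have hl0 : 0 < lam := by linarith
  have h1 : 0 ≤ 1 / lam := by positivity
  have h2 : 0 ≤ 1 / s - 1 / lam := sub_nonneg.2 (one_div_le_one_div_of_le hs0 hlam)
  have hdt : d ≠ ⊤ := (hd1.trans_lt ENNReal.one_lt_top).ne
  calc φ * d ^ (-m)
      ≤ φ * d ^ (-γ * (1 / lam) + -τ * (1 / s - 1 / lam) + -γ * (1 - 1 / s)) := by
        gcongr φ * ?_
        exact ENNReal.rpow_le_rpow_of_exponent_ge hd1 (by linarith)
    _ = (φ ^ (s * (1 / lam)) * φ ^ (s * (1 / s - 1 / lam))) * (d ^ (-γ * (1 / lam)) *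
          d ^ (-τ * (1 / s - 1 / lam)) * d ^ (-γ * (1 - 1 / s))) := by
        rw [← ENNReal.rpow_add_of_nonneg _ _ (by positivity) (by positivity),
          ENNReal.rpow_add _ _ hd0 hdt, ENNReal.rpow_add _ _ hd0 hdt,
          show s * (1 / lam) + s * (1 / s - 1 / lam) = 1 by field_simp; ring, ENNReal.rpow_one]
    _ ≤ (φ ^ (s * (1 / lam)) * φ ^ (s * (1 / s - 1 / lam))) * (d ^ (-γ * (1 / lam)) *
          l ^ (-τ * (1 / s - 1 / lam)) * d ^ (-γ * (1 - 1 / s))) := by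
        gcongr _ * (_ * ?_ * _)
        rw [neg_mul]
        exact enorm_rpow_neg_antitone hl (by positivity)
    _ = _ := by
        rw [ENNReal.mul_rpow_of_nonneg _ _ h1, ENNReal.mul_rpow_of_nonneg _ _ h2]
        simp only [ENNReal.rpow_mul]
        ring

/-- Hölder bound for the potential in terms of the radial potential. -/
lemma rieszPot_rpow_le (hN : 1 ≤ N) {F : EuclideanSpace ℝ (Fin N) → ENNReal} (hF : Measurable F)
    {s lam m γ τ : ℝ} (hs : 1 ≤ s) (hlam : s ≤ lam) (hτ : 0 ≤ τ)
    (hm : m ≤ γ * (1 / lam + 1 - 1 / s) + τ * (1 / s - 1 / lam))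
    (x : EuclideanSpace ℝ (Fin N)) :
    rieszPot m F x ^ lam ≤ (∫⁻ y in ball x 1, F y ^ s * ‖y - x‖ₑ ^ (-γ)) *
      (radialPot τ (fun y => F y ^ s) ‖x‖) ^ (lam / s - 1) *
      (∫⁻ z in ball (0 : EuclideanSpace ℝ (Fin N)) 1, ‖z‖ₑ ^ (-γ)) ^ (lam * (1 - 1 / s)) := by
  have : Nonempty (Fin N) := ⟨⟨0, by omega⟩⟩
  have hs0 : 0 < s := by linarith
  have hl0 : 0 < lam := by linarith
  have h1 : 0 ≤ 1 / lam := by positivity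
  have h2 : 0 ≤ 1 / s - 1 / lam := sub_nonneg.2 (one_div_le_one_div_of_le hs0 hlam)
  have h3 : 0 ≤ 1 - 1 / s := sub_nonneg.2 ((div_le_one hs0).2 hs)
  have hne : ∀ᵐ y ∂(volume.restrict (ball x 1)), y ≠ x :=
    ae_restrict_of_ae (compl_mem_ae_iff.2 (measure_singleton x))
  set g : Fin 3 → EuclideanSpace ℝ (Fin N) → ENNReal :=
    ![fun y => F y ^ s * ‖y - x‖ₑ ^ (-γ), fun y => F y ^ s * ‖‖y‖ - ‖x‖‖ₑ ^ (-τ),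
      fun y => ‖y - x‖ₑ ^ (-γ)]
  set w : Fin 3 → ℝ := ![1 / lam, 1 / s - 1 / lam, 1 - 1 / s]
  have hH := ENNReal.lintegral_prod_norm_pow_le (μ := volume.restrict (ball x 1)) Finset.univ
    (f := g) (p := w) (fun i _ => by
      fin_cases i <;> (simp only [g]; refine Measurable.aemeasurable ?_; simp; fun_prop))
    (by simp [w, Fin.sum_univ_three]) (fun i _ => by fin_cases i; exacts [h1, h2, h3])
  simp only [Fin.prod_univ_three, g, w, Matrix.cons_val_zero, Matrix.cons_val_one,
    Matrix.cons_val_two, Matrix.head_cons, Matrix.tail_cons] at hH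
  rw [setLIntegral_ball_comp_sub (fun z => ‖z‖ₑ ^ (-γ))] at hH
  have hle : rieszPot m F x ≤ ∫⁻ y in ball x 1, (F y ^ s * ‖y - x‖ₑ ^ (-γ)) ^ (1 / lam) *
      (F y ^ s * ‖‖y‖ - ‖x‖‖ₑ ^ (-τ)) ^ (1 / s - 1 / lam) * (‖y - x‖ₑ ^ (-γ)) ^ (1 - 1 / s) := by
    refine lintegral_mono_ae ?_
    filter_upwards [hne, ae_restrict_mem measurableSet_ball] with y hy hyb
    refine kernel_split (by simpa [sub_eq_zero] using hy) ?_ (enorm_norm_sub_norm_le x y) hs hlam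
      hτ hm
    rw [mem_ball, dist_eq_norm] at hyb
    rw [← ofReal_norm]
    exact ENNReal.ofReal_le_one.2 hyb.le
  refine (ENNReal.rpow_le_rpow (hle.trans hH) hl0.le).trans ?_
  rw [ENNReal.mul_rpow_of_nonneg _ _ hl0.le, ENNReal.mul_rpow_of_nonneg _ _ hl0.le,
    ← ENNReal.rpow_mul, ← ENNReal.rpow_mul, ← ENNReal.rpow_mul, one_div_mul_cancel hl0.ne',
    ENNReal.rpow_one, show (1 / s - 1 / lam) * lam = lam / s - 1 by field_simp,
    mul_comm (1 - 1 / s)]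
  gcongr
  · exact sub_nonneg.2 ((one_le_div hs0).2 hlam)
  · exact setLIntegral_le_lintegral _ _

lemma lintegral_lintegral_ball_mul {G : EuclideanSpace ℝ (Fin N) → ENNReal} (hG : Measurable G)
    (γ : ℝ) (c : ENNReal) : ∫⁻ x, (∫⁻ y in ball x 1, G y * ‖y - x‖ₑ ^ (-γ)) * c =
      (∫⁻ y, G y) * (∫⁻ z in ball (0 : EuclideanSpace ℝ (Fin N)) 1, ‖z‖ₑ ^ (-γ)) * c := by
  set k : EuclideanSpace ℝ (Fin N) → ENNReal := (ball 0 1).indicator fun z => ‖z‖ₑ ^ (-γ)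
  have hk : Measurable k := Measurable.indicator (by fun_prop) measurableSet_ball
  have h1 : ∀ x, ∫⁻ y in ball x 1, G y * ‖y - x‖ₑ ^ (-γ) = ∫⁻ y, G y * k (y - x) := fun x => by
    rw [← lintegral_indicator measurableSet_ball]
    congr 1
    ext y
    by_cases h : y ∈ ball x 1
    · rw [indicator_of_mem h]
      simp only [k]
      rw [indicator_of_mem (by simpa [dist_eq_norm] using h)]
    · rw [indicator_of_notMem h]
      simp only [k]
      rw [indicator_of_notMem (by simpa [dist_eq_norm] using h), mul_zero]
  have hmeas : Measurable fun z : EuclideanSpace ℝ (Fin N) × EuclideanSpace ℝ (Fin N) =>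
      G z.2 * k (z.2 - z.1) := by fun_prop
  simp only [h1]
  rw [lintegral_mul_const _ hmeas.lintegral_prod_right',
    lintegral_lintegral_swap hmeas.aemeasurable]
  have h2 : ∀ y, ∫⁻ x, G y * k (y - x) = G y * ∫⁻ z, k z := fun y => by
    rw [lintegral_const_mul _ (by fun_prop), lintegral_sub_left_eq_self]
  simp only [h2]
  rw [lintegral_mul_const _ hG, lintegral_indicator measurableSet_ball]

/-- Riesz potential estimate over the spheres on which the radial potential is controlled. -/
lemma setLIntegral_rieszPot_le (hN : 1 ≤ N) {F : EuclideanSpace ℝ (Fin N) → ENNReal}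
    (hF : Measurable F) {s lam m γ τ : ℝ} (hs : 1 ≤ s) (hlam : s ≤ lam) (hτ : 0 ≤ τ)
    (hm : m ≤ γ * (1 / lam + 1 - 1 / s) + τ * (1 / s - 1 / lam))
    {K : Set ℝ} {J K₀ : ENNReal} (hK : ∀ r ∈ K, radialPot τ (fun y => F y ^ s) r ≤ K₀ * J)
    (hKm : MeasurableSet K) (hJ : ∫⁻ y, F y ^ s ≤ J) :
    ∫⁻ x in {x : EuclideanSpace ℝ (Fin N) | ‖x‖ ∈ K}, rieszPot m F x ^ lam ≤
      (∫⁻ z in ball (0 : EuclideanSpace ℝ (Fin N)) 1, ‖z‖ₑ ^ (-γ)) ^ (1 + lam * (1 - 1 / s)) *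
        K₀ ^ (lam / s - 1) * J ^ (lam / s) := by
  have hs0 : 0 < s := by linarith
  have hl0 : 0 < lam := by linarith
  have h3 : 0 ≤ 1 - 1 / s := sub_nonneg.2 ((div_le_one hs0).2 hs)
  have h4 : 0 ≤ lam / s - 1 := sub_nonneg.2 ((one_le_div hs0).2 hlam)
  set W := ∫⁻ z in ball (0 : EuclideanSpace ℝ (Fin N)) 1, ‖z‖ₑ ^ (-γ)
  have hA : MeasurableSet {x : EuclideanSpace ℝ (Fin N) | ‖x‖ ∈ K} := measurable_norm hKm
  calc ∫⁻ x in {x : EuclideanSpace ℝ (Fin N) | ‖x‖ ∈ K}, rieszPot m F x ^ lam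
      ≤ ∫⁻ x in {x : EuclideanSpace ℝ (Fin N) | ‖x‖ ∈ K},
          (∫⁻ y in ball x 1, F y ^ s * ‖y - x‖ₑ ^ (-γ)) *
            ((K₀ * J) ^ (lam / s - 1) * W ^ (lam * (1 - 1 / s))) := by
        refine setLIntegral_mono' hA fun x hx => ?_
        refine (rieszPot_rpow_le hN hF hs hlam hτ hm x).trans ?_
        rw [mul_assoc]
        gcongr
        exact hK _ hx
    _ ≤ ∫⁻ x, (∫⁻ y in ball x 1, F y ^ s * ‖y - x‖ₑ ^ (-γ)) *
            ((K₀ * J) ^ (lam / s - 1) * W ^ (lam * (1 - 1 / s))) := setLIntegral_le_lintegral _ _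
    _ = ((∫⁻ y, F y ^ s) * W) * ((K₀ * J) ^ (lam / s - 1) * W ^ (lam * (1 - 1 / s))) := by
        exact lintegral_lintegral_ball_mul (by fun_prop) _ _
    _ ≤ (J * W) * ((K₀ * J) ^ (lam / s - 1) * W ^ (lam * (1 - 1 / s))) := by gcongr
    _ = _ := by
        have hJ' : J ^ (lam / s) = J * J ^ (lam / s - 1) := by
          conv_lhs => rw [show lam / s = 1 + (lam / s - 1) by ring,
            ENNReal.rpow_add_of_nonneg _ _ zero_le_one h4, ENNReal.rpow_one]
        rw [hJ', ENNReal.mul_rpow_of_nonneg _ _ h4, ENNReal.rpow_add_of_nonneg _ _ zero_le_one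
          (by positivity), ENNReal.rpow_one]
        ring

/-- Radii at which the radial potential is controlled by the total mass. -/
lemma exists_good_radii {τ : ℝ} (hτ0 : 0 ≤ τ) (hτ : τ < 1) : ∃ K₀ : ENNReal, K₀ ≠ ⊤ ∧
    ∀ (N : ℕ) (G : EuclideanSpace ℝ (Fin N) → ENNReal), Measurable G → ∫⁻ y, G y ≤ 1 →
      ∃ K : Set ℝ, IsCompact K ∧ K ⊆ Icc 1 2 ∧ 1 / 2 ≤ volume K ∧
        ∀ r ∈ K, radialPot τ G r ≤ K₀ := by
  set c : ENNReal := 1 + ∫⁻ z in ball (0 : ℝ) 1, ‖z‖ₑ ^ (-τ)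
  have hc : c ≠ ⊤ := ENNReal.add_ne_top.2 ⟨ENNReal.one_ne_top,
    (lintegral_ball_enorm_rpow_lt_top volume (by simp) (by simpa using hτ)).ne⟩
  refine ⟨4 * c, ENNReal.mul_ne_top (by norm_num) hc, fun N G hG hG1 => ?_⟩
  have hmeas : Measurable fun z : ℝ × EuclideanSpace ℝ (Fin N) =>
      G z.2 * ‖‖z.2‖ - z.1‖ₑ ^ (-τ) := by fun_prop
  have hR : Measurable (radialPot τ G) := hmeas.lintegral_prod_right'
  have hker : ∀ t : ℝ, ∫⁻ r in Icc (1 : ℝ) 2, ‖t - r‖ₑ ^ (-τ) ≤ c := fun t => by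
    have h1 : ∀ r ∈ Icc (1 : ℝ) 2, ‖t - r‖ₑ ^ (-τ) ≤
        1 + (ball (0 : ℝ) 1).indicator (fun z => ‖z‖ₑ ^ (-τ)) (t - r) := fun r _ => by
      by_cases h : t - r ∈ ball (0 : ℝ) 1
      · rw [indicator_of_mem h]; exact le_add_self
      · rw [indicator_of_notMem h, add_zero]
        refine (enorm_rpow_neg_antitone (s := 1) ?_ hτ0).trans (by simp)
        rw [mem_ball_zero_iff, not_lt] at h
        rw [← ofReal_norm]
        exact ENNReal.one_le_ofReal.2 h
    refine (setLIntegral_mono' measurableSet_Icc h1).trans ?_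
    rw [lintegral_add_left measurable_const]
    refine add_le_add (by simp; norm_num) ((setLIntegral_le_lintegral _ _).trans_eq ?_)
    rw [lintegral_sub_left_eq_self, lintegral_indicator measurableSet_ball]
  have htot : ∫⁻ r in Icc (1 : ℝ) 2, radialPot τ G r ≤ c := by
    simp only [radialPot]
    rw [lintegral_lintegral_swap hmeas.aemeasurable]
    calc ∫⁻ y, ∫⁻ r in Icc (1 : ℝ) 2, G y * ‖‖y‖ - r‖ₑ ^ (-τ) ≤ ∫⁻ y, G y * c := by
          refine lintegral_mono fun y => ?_
          rw [lintegral_const_mul _ (by fun_prop)]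
          gcongr
          exact hker _
      _ = (∫⁻ y, G y) * c := lintegral_mul_const _ hG
      _ ≤ 1 * c := by gcongr
      _ = c := one_mul c
  have hc0 : c ≠ 0 := by simp [c]
  have hbad : volume (Icc (1 : ℝ) 2 ∩ {r | 4 * c ≤ radialPot τ G r}) ≤ 1 / 4 := by
    have := meas_ge_le_lintegral_div (μ := volume.restrict (Icc (1 : ℝ) 2)) hR.aemeasurable
      (ε := 4 * c) (by simp [hc0]) (ENNReal.mul_ne_top (by norm_num) hc)
    rw [Measure.restrict_apply (measurableSet_le measurable_const hR), inter_comm] at this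
    refine this.trans ((ENNReal.div_le_div_right htot _).trans ?_)
    refine ENNReal.div_le_of_le_mul ?_
    rw [← mul_assoc, one_div, ENNReal.inv_mul_cancel (by norm_num) (by norm_num), one_mul]
  set S : Set ℝ := Icc 1 2 ∩ {r | radialPot τ G r < 4 * c}
  have hS : MeasurableSet S := measurableSet_Icc.inter (hR measurableSet_Iio)
  have hvol : 1 / 2 < volume S := by
    have h1 : volume (Icc (1 : ℝ) 2) ≤
        volume S + volume (Icc (1 : ℝ) 2 ∩ {r | 4 * c ≤ radialPot τ G r}) := by
      refine (measure_mono fun r hr => ?_).trans (measure_union_le _ _)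
      rcases lt_or_ge (radialPot τ G r) (4 * c) with h | h
      · exact Or.inl ⟨hr, h⟩
      · exact Or.inr ⟨hr, h⟩
    by_contra! h
    have h2 := h1.trans (add_le_add h hbad)
    rw [Real.volume_Icc, ← ENNReal.toReal_le_toReal (by simp) (by simp)] at h2
    rw [ENNReal.toReal_add (by simp) (by simp)] at h2
    norm_num at h2
  obtain ⟨K, hKS, hK, hKv⟩ := hS.exists_lt_isCompact hvol
  exact ⟨K, hK, fun r hr => (hKS hr).1, hKv.le, fun r hr => (hKS hr).2.le⟩

end Riesz

section DivergenceBound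

variable {N : ℕ}

lemma pd_comp_norm {g : ℝ → ℝ} {g' : ℝ} {x : EuclideanSpace ℝ (Fin N)} (hx : x ≠ 0)
    (hg : HasDerivAt g g' ‖x‖) (i : Fin N) : pd i (fun y => g ‖y‖) x = g' * (x i / ‖x‖) := by
  have hn : ‖x‖ ^ 2 ≠ 0 := pow_ne_zero 2 (norm_ne_zero_iff.2 hx)
  have h1 := Real.hasDerivAt_sqrt hn
  have h2 : HasDerivAt (fun s => g (Real.sqrt s)) (g' * (1 / (2 * Real.sqrt (‖x‖ ^ 2))))
      (‖x‖ ^ 2) := by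
    refine HasDerivAt.comp (‖x‖ ^ 2) ?_ h1
    rwa [Real.sqrt_sq (norm_nonneg x)]
  have h3 := pd_comp (i := i) (u := fun y : EuclideanSpace ℝ (Fin N) => ‖y‖ ^ 2) h2
    differentiableAt_normSq
  simp only [Real.sqrt_sq (norm_nonneg _), pd_normSq] at h3
  rw [h3]
  field_simp

/-- A divergence inequality tested against a radial cutoff, for fields which are mildly singular
at the origin. -/
lemma integral_div_le_of_cutoff (hN : 3 ≤ N) {Z : Fin N → EuclideanSpace ℝ (Fin N) → ℝ}
    {d : EuclideanSpace ℝ (Fin N) → ℝ} {L : ℝ} (hZ : ∀ i, ∀ x ≠ 0, ContDiffAt ℝ 1 (Z i) x)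
    (hd : ∀ x, 0 ≤ d x) (hdiv : ∀ x ≠ 0, d x ≤ ∑ i, pd i (Z i) x)
    (hdi : IntegrableOn d (ball 0 1)) (hL : ∀ x ≠ 0, ‖x‖ ≤ 1 → ∀ i, |Z i x| ≤ L * ‖x‖⁻¹)
    {w : ℝ → ℝ} (hw : Continuous w) (hw0 : ∀ t, 0 ≤ w t) (hwl : ∀ t ≤ 1 / 2, w t = 0)
    (hwr : ∀ t, 5 / 2 ≤ t → w t = 0) :
    (∫ t in (1 : ℝ)..3, w t) * ∫ x in ball 0 1, d x ≤ ∫ x, (∑ i, |Z i x|) * w ‖x‖ := by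
  have : Nonempty (Fin N) := ⟨⟨0, by omega⟩⟩
  set Φ : ℝ → ℝ := fun r => ∫ t in r..3, w t with hΦ
  have hΦd : ∀ r, HasDerivAt Φ (-w r) r := fun r =>
    intervalIntegral.integral_hasDerivAt_left (hw.intervalIntegrable _ _)
      hw.aestronglyMeasurable.stronglyMeasurableAtFilter hw.continuousAt
  have hΦa : Antitone Φ := antitone_of_hasDerivAt_nonpos hΦd fun r => neg_nonpos.2 (hw0 r)
  have hΦ3 : ∀ r, 3 ≤ r → Φ r = 0 := fun r hr => by
    rw [hΦ]
    refine intervalIntegral.integral_zero_ae (Eventually.of_forall fun t ht => hwr t ?_)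
    rw [uIoc_of_ge hr] at ht
    linarith [ht.1]
  have hΦ0 : ∀ r, 0 ≤ Φ r := fun r => by
    rcases le_total 3 r with h | h
    · exact (hΦ3 r h).ge
    · exact (hΦ3 3 le_rfl).ge.trans (hΦa h)
  have hΦC : ContDiff ℝ 1 Φ := by
    rw [contDiff_one_iff_deriv]
    refine ⟨fun r => (hΦd r).differentiableAt, ?_⟩
    rw [show deriv Φ = fun r => -w r from funext fun r => (hΦd r).deriv]
    exact hw.neg
  obtain ⟨C, hC0, hC⟩ := exists_originCutoff_bound N
  set φ : ℝ → EuclideanSpace ℝ (Fin N) → ℝ := fun ε x => Φ ‖x‖ * originCutoff ε x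
  have hφs : ∀ ε > 0, ∀ x ∈ tsupport (φ ε), x ≠ 0 := fun ε hε x hx h0 =>
    tsupport_originCutoff hε (h0 ▸ tsupport_mul_subset_right hx)
  have hφC : ∀ ε > 0, ContDiff ℝ 1 (φ ε) := fun ε hε => by
    rw [contDiff_iff_contDiffAt]
    intro x
    by_cases hx : x = 0
    · have : φ ε =ᶠ[nhds x] fun _ => 0 := by
        exact notMem_tsupport_iff_eventuallyEq.1 fun h => hφs ε hε x h hx
      exact contDiffAt_const.congr_of_eventuallyEq this
    · exact (hΦC.contDiffAt.comp x (contDiffAt_norm ℝ hx)).mul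
        (originCutoff_contDiff (n := 1)).contDiffAt
  have hφc : ∀ ε, HasCompactSupport (φ ε) := fun ε =>
    HasCompactSupport.intro (isCompact_closedBall 0 3) fun x hx => by
      rw [mem_closedBall_zero_iff, not_le] at hx
      simp only [φ]
      rw [hΦ3 _ hx.le, zero_mul]
  set wn : EuclideanSpace ℝ (Fin N) → ℝ := fun x => w ‖x‖
  have hwn : Continuous wn := hw.comp continuous_norm
  have hwc : HasCompactSupport wn := HasCompactSupport.intro (isCompact_closedBall 0 3)
    fun x hx => by
      rw [mem_closedBall_zero_iff, not_le] at hx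
      exact hwr _ (by linarith)
  have hws : ∀ x ∈ tsupport wn, x ≠ 0 := fun x hx h0 => by
    have : wn =ᶠ[nhds x] 0 := by
      rw [h0]
      filter_upwards [ball_mem_nhds (0 : EuclideanSpace ℝ (Fin N)) one_half_pos] with y hy
      exact hwl _ (mem_ball_zero_iff.1 hy).le
    exact notMem_tsupport_iff_eventuallyEq.2 this hx
  have hmain : Integrable fun x => (∑ i, |Z i x|) * wn x :=
    integrable_mul_of_tsupport (fun x hx => tendsto_finsetSum _ fun i _ =>
      ((hZ i x (hws x hx)).continuousAt.abs)) hwn hwc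
  have hpd : ∀ ε > 0, ∀ x ≠ 0, ∀ i, pd i (φ ε) x =
      -w ‖x‖ * (x i / ‖x‖) * originCutoff ε x + Φ ‖x‖ * pd i (originCutoff ε) x :=
    fun ε hε x hx i => by
      simp only [φ]
      have hn : DifferentiableAt ℝ (fun y : EuclideanSpace ℝ (Fin N) => Φ ‖y‖) x :=
        (hΦd _).differentiableAt.comp x (differentiableAt_id.norm ℝ hx)
      rw [pd_mul hn ((originCutoff_contDiff (n := 1)).differentiable (by simp) x),
        pd_comp_norm hx (hΦd _)]
  have hL0 : 0 ≤ L := by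
    have i : Fin N := ⟨0, by omega⟩
    have := hL (EuclideanSpace.single i (1 : ℝ)) (by simp) (by simp) i
    simpa using (abs_nonneg _).trans this
  set B : ℝ := N * (L * C * Φ 0)
  have hB0 : 0 ≤ B := by have := hΦ0 0; positivity
  have hpt : ∀ ε > 0, 2 * ε ≤ 1 → ∀ x, -∑ i, Z i x * pd i (φ ε) x ≤ (∑ i, |Z i x|) * wn x +
      (closedBall (0 : EuclideanSpace ℝ (Fin N)) (2 * ε)).indicator (fun _ => B * ε⁻¹ ^ 2) x :=
    fun ε hε hε1 x => by
      rcases lt_or_ge ‖x‖ ε with hx | hx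
      · have h0 : φ ε =ᶠ[nhds x] fun _ => 0 := by
          filter_upwards [continuous_norm.continuousAt.eventually_lt_const hx] with y hy
          simp only [φ]
          rw [originCutoff_eq_zero hε (le_of_lt hy), mul_zero]
        simp only [pd_congr h0, pd_const, mul_zero, Finset.sum_const_zero, neg_zero]
        refine add_nonneg (mul_nonneg (Finset.sum_nonneg fun i _ => abs_nonneg _) (hw0 _))
          (indicator_nonneg (fun _ _ => ?_) _)
        positivity
      have hx0 : x ≠ 0 := norm_pos_iff.1 (hε.trans_le hx)
      have hterm : ∀ i, -(Z i x * pd i (φ ε) x) ≤ |Z i x| * wn x +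
          |Z i x| * (Φ ‖x‖ * |pd i (originCutoff ε) x|) := fun i => by
        rw [hpd ε hε x hx0, ← mul_neg, ← mul_add]
        refine (le_abs_self _).trans ?_
        rw [abs_mul]
        refine mul_le_mul_of_nonneg_left ?_ (abs_nonneg _)
        rw [abs_neg]
        refine (abs_add_le _ _).trans (add_le_add ?_ ?_)
        · rw [abs_mul, abs_mul, abs_neg, abs_of_nonneg (hw0 _), abs_div, abs_norm,
            abs_of_nonneg originCutoff_nonneg]
          have h1 : |x i| / ‖x‖ ≤ 1 := div_le_one_of_le₀ (abs_coord_le i) (norm_nonneg _)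
          calc w ‖x‖ * (|x i| / ‖x‖) * originCutoff ε x ≤ w ‖x‖ * 1 * 1 :=
                mul_le_mul (mul_le_mul_of_nonneg_left h1 (hw0 _)) originCutoff_le_one
                  originCutoff_nonneg (by simpa using hw0 _)
            _ = wn x := by simp [wn]
        · rw [abs_mul, abs_of_nonneg (hΦ0 _)]
      rw [← Finset.sum_neg_distrib]
      refine (Finset.sum_le_sum fun i _ => hterm i).trans ?_
      rw [Finset.sum_add_distrib, ← Finset.sum_mul]
      refine add_le_add le_rfl ?_
      by_cases hx2 : x ∈ closedBall (0 : EuclideanSpace ℝ (Fin N)) (2 * ε)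
      · rw [indicator_of_mem hx2]
        rw [mem_closedBall_zero_iff] at hx2
        have : ∀ i ∈ Finset.univ, |Z i x| * (Φ ‖x‖ * |pd i (originCutoff ε) x|) ≤
            L * ε⁻¹ * (Φ 0 * (C * ε⁻¹)) := fun i _ => by
          refine mul_le_mul ((hL x hx0 (hx2.trans hε1) i).trans ?_) ?_
            (mul_nonneg (hΦ0 _) (abs_nonneg _)) (by positivity)
          · gcongr
          · exact mul_le_mul (hΦa (norm_nonneg _)) ((hC ε hε x).1 i) (abs_nonneg _) (hΦ0 _)
        refine (Finset.sum_le_card_nsmul _ _ _ this).trans_eq ?_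
        simp only [Finset.card_univ, Fintype.card_fin, nsmul_eq_mul, B]
        ring
      · rw [indicator_of_notMem hx2]
        rw [mem_closedBall_zero_iff, not_le] at hx2
        simp [pd_originCutoff_eq_zero hε hx2]
  have hstep : ∀ ε > 0, 2 * ε ≤ 1 → Φ 1 * ∫ x in ball 0 1, d x * originCutoff ε x ≤
      (∫ x, (∑ i, |Z i x|) * wn x) +
        volume.real (ball (0 : EuclideanSpace ℝ (Fin N)) 1) * B * 8 * ε := fun ε hε hε1 => by
    have hint1 : ∀ i, Integrable fun x => pd i (Z i) x * φ ε x := fun i =>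
      integrable_mul_of_tsupport (fun x hx => ((hZ i x (hφs ε hε x hx)).pd (i := i) (m := 0)
        (by norm_num)).continuousAt) (hφC ε hε).continuous (hφc ε)
    have hint2 : ∀ i, Integrable fun x => Z i x * pd i (φ ε) x := fun i =>
      integrable_mul_of_tsupport (fun x hx => (hZ i x (hφs ε hε x
        (tsupport_pd_subset hx))).continuousAt) (hφC ε hε).continuous_pd (hφc ε).pd
    have hparts : ∫ x, ∑ i, pd i (Z i) x * φ ε x = ∫ x, -∑ i, Z i x * pd i (φ ε) x := by
      rw [integral_neg, integral_finsetSum _ fun i _ => hint1 i,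
        integral_finsetSum _ fun i _ => hint2 i, ← Finset.sum_neg_distrib]
      exact Finset.sum_congr rfl fun i _ => by
        rw [integral_mul_pd (fun x hx => hZ i x (hφs ε hε x hx)) (hφC ε hε) (hφc ε), neg_neg]
    have hnn : ∀ x, 0 ≤ ∑ i, pd i (Z i) x * φ ε x := fun x => by
      rw [← Finset.sum_mul]
      by_cases hx : x = 0
      · simp only [φ]
        rw [hx, originCutoff_eq_zero hε (by simpa using hε.le), mul_zero, mul_zero]
      · exact mul_nonneg ((hd x).trans (hdiv x hx)) (mul_nonneg (hΦ0 _) originCutoff_nonneg)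
    have hleft : Φ 1 * ∫ x in ball 0 1, d x * originCutoff ε x ≤
        ∫ x, ∑ i, pd i (Z i) x * φ ε x := by
      rw [← integral_const_mul]
      refine le_trans ?_ (setIntegral_le_integral (s := ball 0 1)
        (integrable_finsetSum _ fun i _ => hint1 i) (Eventually.of_forall hnn))
      refine setIntegral_mono_on ?_ (integrable_finsetSum _ fun i _ => hint1 i).integrableOn
        measurableSet_ball fun x hx => ?_
      · refine (hdi.mul_bdd (c := 1) (originCutoff_contDiff
          (n := 1)).continuous.aestronglyMeasurable (Eventually.of_forall fun x => ?_)).const_mul _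
        rw [Real.norm_of_nonneg originCutoff_nonneg]
        exact originCutoff_le_one
      · rw [← Finset.sum_mul]
        by_cases hx0 : x = 0
        · simp only [φ]
          rw [hx0, originCutoff_eq_zero hε (by simpa using hε.le)]
          simp
        · calc Φ 1 * (d x * originCutoff ε x) = d x * (Φ 1 * originCutoff ε x) := by ring
            _ ≤ _ := mul_le_mul (hdiv x hx0) (mul_le_mul_of_nonneg_right
              (hΦa (mem_ball_zero_iff.1 hx).le) originCutoff_nonneg)
              (mul_nonneg (hΦ0 _) originCutoff_nonneg) ((hd x).trans (hdiv x hx0))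
    refine hleft.trans (hparts.trans_le ?_)
    have hind : Integrable ((closedBall (0 : EuclideanSpace ℝ (Fin N)) (2 * ε)).indicator
        (fun _ => B * ε⁻¹ ^ 2)) := by
      rw [integrable_indicator_iff measurableSet_closedBall]
      exact integrableOn_const measure_closedBall_lt_top.ne
    refine (integral_mono (integrable_finsetSum _ fun i _ => hint2 i).neg (hmain.add hind)
      (hpt ε hε hε1)).trans ?_
    simp only [Pi.add_apply]
    rw [integral_add hmain hind, integral_indicator measurableSet_closedBall, setIntegral_const,
      smul_eq_mul]
    refine add_le_add le_rfl ?_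
    rw [Measure.addHaar_real_closedBall _ _ (by positivity), finrank_euclideanSpace_fin]
    have h3 : (2 * ε) ^ N ≤ (2 * ε) ^ 3 := pow_le_pow_of_le_one (by positivity) hε1 hN
    calc (2 * ε) ^ N * volume.real (ball (0 : EuclideanSpace ℝ (Fin N)) 1) * (B * ε⁻¹ ^ 2)
        ≤ (2 * ε) ^ 3 * volume.real (ball (0 : EuclideanSpace ℝ (Fin N)) 1) * (B * ε⁻¹ ^ 2) := by
          gcongr
      _ = _ := by field_simp; ring
  have hlim0 := tendsto_one_div_add_atTop_nhds_zero_nat (𝕜 := ℝ)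
  have hlimL : Tendsto (fun k : ℕ => ∫ x in ball 0 1, d x * originCutoff (1 / ((k : ℝ) + 1)) x)
      atTop (nhds (∫ x in ball 0 1, d x)) := by
    refine tendsto_integral_of_dominated_convergence d (fun k => hdi.1.mul
      (originCutoff_contDiff (n := 1)).continuous.aestronglyMeasurable) hdi
      (fun k => Eventually.of_forall fun x => ?_) ?_
    · rw [norm_mul, Real.norm_of_nonneg (hd x), Real.norm_of_nonneg originCutoff_nonneg]
      exact mul_le_of_le_one_right (hd x) originCutoff_le_one
    · have hne : ∀ᵐ x ∂(volume.restrict (ball (0 : EuclideanSpace ℝ (Fin N)) 1)), x ≠ 0 :=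
        ae_restrict_of_ae (compl_mem_ae_iff.2 (measure_singleton 0))
      filter_upwards [hne] with x hx
      refine tendsto_const_nhds.congr' ?_
      filter_upwards [tendsto_originCutoff hx] with k hk
      rw [originCutoff_eq_one (by positivity) hk.le, mul_one]
  refine le_of_tendsto_of_tendsto (hlimL.const_mul (Φ 1)) (by
    simpa only [mul_zero, add_zero] using
      (hlim0.const_mul (volume.real (ball (0 : EuclideanSpace ℝ (Fin N)) 1) * B * 8)).const_add
        (∫ x, (∑ i, |Z i x|) * wn x)) ?_
  filter_upwards [eventually_ge_atTop 1] with k hk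
  refine hstep _ (by positivity) ?_
  have : (1 : ℝ) ≤ k := by exact_mod_cast hk
  rw [mul_one_div, div_le_one (by positivity)]
  linarith

/-- The same bound, integrated over a compact set of radii. -/
lemma integral_div_le_of_radii (hN : 3 ≤ N) {Z : Fin N → EuclideanSpace ℝ (Fin N) → ℝ}
    {d : EuclideanSpace ℝ (Fin N) → ℝ} {L : ℝ} (hZ : ∀ i, ∀ x ≠ 0, ContDiffAt ℝ 1 (Z i) x)
    (hd : ∀ x, 0 ≤ d x) (hdiv : ∀ x ≠ 0, d x ≤ ∑ i, pd i (Z i) x)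
    (hdi : IntegrableOn d (ball 0 1)) (hL : ∀ x ≠ 0, ‖x‖ ≤ 1 → ∀ i, |Z i x| ≤ L * ‖x‖⁻¹)
    {K : Set ℝ} (hK : IsCompact K) (hK12 : K ⊆ Icc 1 2) :
    volume.real K * ∫ x in ball 0 1, d x ≤ ∫ x in {x | ‖x‖ ∈ K}, ∑ i, |Z i x| := by
  set δ : ℕ → ℝ := fun k => 1 / 2 * (1 / ((k : ℝ) + 1))
  have hδ : ∀ k, 0 < δ k := fun k => by positivity
  have hδ2 : ∀ k, δ k ≤ 1 / 2 := fun k => by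
    refine mul_le_of_le_one_right (by norm_num) ((div_le_one (by positivity)).2 ?_)
    linarith [(Nat.cast_nonneg k : (0 : ℝ) ≤ k)]
  have hδ0 : Tendsto δ atTop (nhds 0) := by
    simpa only [δ, mul_zero] using
      (tendsto_one_div_add_atTop_nhds_zero_nat (𝕜 := ℝ)).const_mul (1 / 2)
  set w : ℕ → ℝ → ℝ := fun k t => thickenedIndicator (hδ k) K t
  have hw : ∀ k, Continuous (w k) := fun k =>
    NNReal.continuous_coe.comp (thickenedIndicator (hδ k) K).continuous
  have hw0 : ∀ k t, 0 ≤ w k t := fun k t => NNReal.coe_nonneg _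
  have hw1 : ∀ k t, w k t ≤ 1 := fun k t => by
    exact_mod_cast thickenedIndicator_le_one (hδ k) K t
  have hwK : ∀ k, ∀ t ∈ K, w k t = 1 := fun k t ht => by
    simp only [w]
    rw [thickenedIndicator_one (hδ k) K ht, NNReal.coe_one]
  have hwz : ∀ k t, t ∉ Ioo (1 / 2 : ℝ) (5 / 2) → w k t = 0 := fun k t ht => by
    simp only [w, NNReal.coe_eq_zero]
    refine thickenedIndicator_zero (hδ k) K fun h => ht ?_
    obtain ⟨z, hz, hzt⟩ := mem_thickening_iff.1 h
    have h1 := hK12 hz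
    rw [Real.dist_eq, abs_lt] at hzt
    constructor <;> linarith [hδ2 k, hzt.1, hzt.2, h1.1, h1.2]
  have hwlim : ∀ t, Tendsto (fun k => w k t) atTop (nhds (K.indicator (fun _ => (1 : ℝ)) t)) :=
    fun t => by
      have h := tendsto_pi_nhds.1 (thickenedIndicator_tendsto_indicator_closure hδ hδ0 K) t
      rw [hK.isClosed.closure_eq] at h
      convert (NNReal.tendsto_coe.2 h) using 2
      by_cases ht : t ∈ K <;> simp [ht]
  set A : Set (EuclideanSpace ℝ (Fin N)) := {x | 1 / 2 ≤ ‖x‖ ∧ ‖x‖ ≤ 5 / 2}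
  have hAc : IsCompact A := by
    refine (isCompact_closedBall (0 : EuclideanSpace ℝ (Fin N)) (5 / 2)).of_isClosed_subset
      ((isClosed_le continuous_const continuous_norm).inter
        (isClosed_le continuous_norm continuous_const)) fun x hx => ?_
    simpa using hx.2
  have hZA : ContinuousOn (fun x => ∑ i, |Z i x|) A := fun x hx => by
    have hx0 : x ≠ 0 := norm_pos_iff.1 (one_half_pos.trans_le hx.1)
    exact (tendsto_finsetSum _ fun i _ =>
      ((hZ i x hx0).continuousAt.abs).continuousWithinAt)
  have hZi : IntegrableOn (fun x => ∑ i, |Z i x|) A := hZA.integrableOn_compact hAc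
  have hstep : ∀ k, volume.real K * ∫ x in ball 0 1, d x ≤ ∫ x in A, (∑ i, |Z i x|) * w k ‖x‖ :=
    fun k => by
      have h1 := integral_div_le_of_cutoff hN hZ hd hdiv hdi hL (hw k) (hw0 k)
        (fun t ht => hwz k t fun h => absurd h.1 (not_lt.2 ht))
        (fun t ht => hwz k t fun h => absurd h.2 (not_lt.2 ht))
      have h2 : volume.real K ≤ ∫ t in (1 : ℝ)..3, w k t := by
        rw [intervalIntegral.integral_of_le (by norm_num), ← integral_Icc_eq_integral_Ioc]
        calc volume.real K = ∫ t in K, w k t := by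
              rw [setIntegral_congr_fun hK.measurableSet fun t ht => hwK k t ht]
              simp
          _ ≤ _ := setIntegral_mono_set (hw k).continuousOn.integrableOn_Icc
              (Eventually.of_forall (hw0 k))
              (LE.le.eventuallyLE fun t ht => ⟨(hK12 ht).1, by linarith [(hK12 ht).2]⟩)
      refine (mul_le_mul_of_nonneg_right h2 (setIntegral_nonneg measurableSet_ball
        fun x _ => hd x)).trans (h1.trans_eq ?_)
      refine (setIntegral_eq_integral_of_forall_compl_eq_zero fun x hx => ?_).symm
      rw [hwz k ‖x‖ fun h => hx ⟨h.1.le, h.2.le⟩, mul_zero]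
  have hlim : Tendsto (fun k => ∫ x in A, (∑ i, |Z i x|) * w k ‖x‖) atTop
      (nhds (∫ x in A, (∑ i, |Z i x|) * K.indicator (fun _ => (1 : ℝ)) ‖x‖)) := by
    refine tendsto_integral_of_dominated_convergence (fun x => ∑ i, |Z i x|)
      (fun k => hZi.1.mul ((hw k).comp continuous_norm).aestronglyMeasurable) hZi
      (fun k => Eventually.of_forall fun x => ?_)
      (Eventually.of_forall fun x => (hwlim _).const_mul _)
    rw [norm_mul, Real.norm_of_nonneg (hw0 _ _),
      Real.norm_of_nonneg (Finset.sum_nonneg fun i _ => abs_nonneg _)]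
    exact mul_le_of_le_one_right (Finset.sum_nonneg fun i _ => abs_nonneg _) (hw1 _ _)
  refine (ge_of_tendsto' hlim hstep).trans_eq ?_
  have hKm : MeasurableSet {x : EuclideanSpace ℝ (Fin N) | ‖x‖ ∈ K} :=
    measurable_norm hK.measurableSet
  have hKA : {x : EuclideanSpace ℝ (Fin N) | ‖x‖ ∈ K} ⊆ A := fun x hx =>
    ⟨by linarith [(hK12 hx).1], by linarith [(hK12 hx).2]⟩
  rw [← integral_indicator hKm, setIntegral_eq_integral_of_forall_compl_eq_zero]
  · congr 1
    ext x
    by_cases hx : ‖x‖ ∈ K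
    · rw [indicator_of_mem hx, indicator_of_mem (by exact hx), mul_one]
    · rw [indicator_of_notMem hx, indicator_of_notMem (by exact hx), mul_zero]
  · intro x hx
    rw [indicator_of_notMem (show ‖x‖ ∉ K from fun h => hx (hKA h)), mul_zero]

end DivergenceBound

section Pohozaev

variable {N : ℕ} {u v G : EuclideanSpace ℝ (Fin N) → ℝ} {x : EuclideanSpace ℝ (Fin N)}
  {a b p q : ℝ}

/-- The derivative of `u` along the position vector. -/
noncomputable def radialPd (u : EuclideanSpace ℝ (Fin N) → ℝ) (x : EuclideanSpace ℝ (Fin N)) : ℝ :=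
  ∑ j, x j * pd j u x

/-- The inner product of the gradients of `u` and `v`. -/
noncomputable def gradInner (u v : EuclideanSpace ℝ (Fin N) → ℝ)
    (x : EuclideanSpace ℝ (Fin N)) : ℝ :=
  ∑ j, pd j u x * pd j v x

/-- The vector field of the Pohozaev identity, with potential density `G`. -/
noncomputable def pohozaevField (c d : ℝ) (u v G : EuclideanSpace ℝ (Fin N) → ℝ) (i : Fin N)
    (x : EuclideanSpace ℝ (Fin N)) : ℝ :=
  radialPd v x * pd i u x + radialPd u x * pd i v x + x i * (G x - gradInner u v x) +
    (c * (v x * pd i u x) + d * (u x * pd i v x))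

lemma contDiffAt_coord {n : WithTop ℕ∞} (j : Fin N) :
    ContDiffAt ℝ n (fun y : EuclideanSpace ℝ (Fin N) => y j) x :=
  (EuclideanSpace.proj (𝕜 := ℝ) j).contDiff.contDiffAt

lemma ContDiffAt.radialPd (hu : ContDiffAt ℝ 2 u x) : ContDiffAt ℝ 1 (radialPd u) x :=
  ContDiffAt.sum fun j _ => (contDiffAt_coord j).mul (hu.pd (by norm_num))

lemma ContDiffAt.gradInner (hu : ContDiffAt ℝ 2 u x) (hv : ContDiffAt ℝ 2 v x) :
    ContDiffAt ℝ 1 (gradInner u v) x :=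
  ContDiffAt.sum fun j _ => (hu.pd (by norm_num)).mul (hv.pd (by norm_num))

lemma ContDiffAt.pohozaevField (hu : ContDiffAt ℝ 2 u x) (hv : ContDiffAt ℝ 2 v x)
    (hG : ContDiffAt ℝ 1 G x) (c d : ℝ) (i : Fin N) :
    ContDiffAt ℝ 1 (pohozaevField c d u v G i) x := by
  have h1 : (1 : WithTop ℕ∞) ≤ 2 := by norm_num
  have hpu : ContDiffAt ℝ 1 (_root_.pd i u) x := hu.pd (by norm_num)
  have hpv : ContDiffAt ℝ 1 (_root_.pd i v) x := hv.pd (by norm_num)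
  exact (((hv.radialPd.mul hpu).add (hu.radialPd.mul hpv)).add
    ((contDiffAt_coord i).mul (hG.sub (hu.gradInner hv)))).add
    ((contDiffAt_const.mul ((hv.of_le h1).mul hpu)).add
      (contDiffAt_const.mul ((hu.of_le h1).mul hpv)))

lemma pd_radialPd (hu : ContDiffAt ℝ 2 u x) (i : Fin N) :
    pd i (radialPd u) x = pd i u x + ∑ j, x j * pd i (pd j u) x := by
  unfold radialPd
  rw [pd_sum _ fun j _ => (differentiableAt_coord j).fun_mul (differentiableAt_pd hu)]
  simp only [pd_mul (differentiableAt_coord _) (differentiableAt_pd hu), pd_coord,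
    Finset.sum_add_distrib, ite_mul, one_mul, zero_mul, Finset.sum_ite_eq, Finset.mem_univ, if_true]

lemma pd_gradInner (hu : ContDiffAt ℝ 2 u x) (hv : ContDiffAt ℝ 2 v x) (i : Fin N) :
    pd i (gradInner u v) x =
      (∑ j, pd i (pd j u) x * pd j v x) + ∑ j, pd j u x * pd i (pd j v) x := by
  unfold gradInner
  rw [pd_sum _ fun j _ => (differentiableAt_pd hu).fun_mul (differentiableAt_pd hv)]
  simp only [pd_mul (differentiableAt_pd hu) (differentiableAt_pd hv), Finset.sum_add_distrib]

/-- The divergence of the Pohozaev field. -/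
lemma sum_pd_pohozaevField (hu : ContDiffAt ℝ 2 u x) (hv : ContDiffAt ℝ 2 v x)
    (hG : ContDiffAt ℝ 1 G x) (c d : ℝ) :
    ∑ i, pd i (pohozaevField c d u v G i) x =
      radialPd v x * lap u x + radialPd u x * lap v x + N * G x + radialPd G x +
        (2 - N + c + d) * gradInner u v x + c * (v x * lap u x) + d * (u x * lap v x) := by
  have hdu := differentiableAt_of_c2 hu
  have hdv := differentiableAt_of_c2 hv
  have hru := hu.radialPd.differentiableAt one_ne_zero
  have hrv := hv.radialPd.differentiableAt one_ne_zero
  have hD := (hu.gradInner hv).differentiableAt one_ne_zero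
  have hGd := hG.differentiableAt one_ne_zero
  have hterm : ∀ i, pd i (pohozaevField c d u v G i) x =
      ((pd i v x + ∑ j, x j * pd i (pd j v) x) * pd i u x + radialPd v x * pd i (pd i u) x) +
      ((pd i u x + ∑ j, x j * pd i (pd j u) x) * pd i v x + radialPd u x * pd i (pd i v) x) +
      (G x - gradInner u v x + x i * (pd i G x - ((∑ j, pd i (pd j u) x * pd j v x) +
        ∑ j, pd j u x * pd i (pd j v) x))) +
      (c * (pd i v x * pd i u x + v x * pd i (pd i u) x) +
        d * (pd i u x * pd i v x + u x * pd i (pd i v) x)) := fun i => by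
    have hpu := differentiableAt_pd (i := i) hu
    have hpv := differentiableAt_pd (i := i) hv
    unfold pohozaevField
    rw [pd_add (((hrv.fun_mul hpu).fun_add (hru.fun_mul hpv)).fun_add
      ((differentiableAt_coord i).fun_mul
        (hGd.fun_sub hD))) (((hdv.fun_mul hpu).const_mul c).fun_add
          ((hdu.fun_mul hpv).const_mul d)),
      pd_add ((hrv.fun_mul hpu).fun_add (hru.fun_mul hpv))
        ((differentiableAt_coord i).fun_mul (hGd.fun_sub hD)),
      pd_add (hrv.fun_mul hpu) (hru.fun_mul hpv), pd_mul hrv hpu, pd_mul hru hpv,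
      pd_mul (differentiableAt_coord i) (hGd.fun_sub hD), pd_sub hGd hD,
      pd_add ((hdv.fun_mul hpu).const_mul c) ((hdu.fun_mul hpv).const_mul d),
      pd_const_mul c (hdv.fun_mul hpu), pd_const_mul d (hdu.fun_mul hpv),
      pd_mul hdv hpu, pd_mul hdu hpv,
      pd_radialPd hu, pd_radialPd hv, pd_gradInner hu hv, pd_coord, if_pos rfl]
    ring
  have hsym1 : ∑ i, x i * ∑ j, pd i (pd j u) x * pd j v x =
      ∑ i, (∑ j, x j * pd i (pd j u) x) * pd i v x := by
    simp only [Finset.mul_sum, Finset.sum_mul]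
    rw [Finset.sum_comm]
    refine Finset.sum_congr rfl fun i _ => Finset.sum_congr rfl fun j _ => ?_
    rw [pd_comm hu]; ring
  have hsym2 : ∑ i, x i * ∑ j, pd j u x * pd i (pd j v) x =
      ∑ i, (∑ j, x j * pd i (pd j v) x) * pd i u x := by
    simp only [Finset.mul_sum, Finset.sum_mul]
    rw [Finset.sum_comm]
    refine Finset.sum_congr rfl fun i _ => Finset.sum_congr rfl fun j _ => ?_
    rw [pd_comm hv]; ring
  have hD' : ∑ i, pd i v x * pd i u x = gradInner u v x :=
    Finset.sum_congr rfl fun i _ => mul_comm _ _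
  simp only [hterm]
  simp only [mul_sub, mul_add, add_mul, Finset.sum_add_distrib, Finset.sum_sub_distrib]
  rw [hsym1, hsym2]
  simp only [← Finset.mul_sum, hD', ← lap_eq hu, ← lap_eq hv, Finset.sum_const, Finset.card_univ,
    Fintype.card_fin, nsmul_eq_mul]
  rw [show ∑ i, pd i u x * pd i v x = gradInner u v x from rfl,
    show ∑ i, x i * pd i G x = radialPd G x from rfl]
  ring

/-- The potential density of the system. -/
noncomputable def potentialDensity (a b p q : ℝ) (u v : EuclideanSpace ℝ (Fin N) → ℝ)
    (x : EuclideanSpace ℝ (Fin N)) : ℝ :=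
  (p + 1)⁻¹ * (‖x‖ ^ a * v x ^ (p + 1)) + (q + 1)⁻¹ * (‖x‖ ^ b * u x ^ (q + 1))

lemma contDiffAt_norm_rpow {n : WithTop ℕ∞} (hx : x ≠ 0) :
    ContDiffAt ℝ n (fun y : EuclideanSpace ℝ (Fin N) => ‖y‖ ^ a) x :=
  (contDiffAt_norm ℝ hx).rpow_const_of_ne (norm_ne_zero_iff.2 hx)

lemma contDiffAt_weight_rpow (hx : x ≠ 0) (hv : ContDiffAt ℝ 2 v x) (hv0 : 0 < v x) :
    ContDiffAt ℝ 1 (fun y => ‖y‖ ^ a * v y ^ (p + 1)) x :=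
  (contDiffAt_norm_rpow hx).mul ((hv.of_le (by norm_num)).rpow_const_of_ne hv0.ne')

lemma radialPd_weight_rpow (hp : 0 < p) (hx : x ≠ 0) (hv : ContDiffAt ℝ 2 v x) (hv0 : 0 < v x) :
    radialPd (fun y => (p + 1)⁻¹ * (‖y‖ ^ a * v y ^ (p + 1))) x =
      a * ((p + 1)⁻¹ * (‖x‖ ^ a * v x ^ (p + 1))) + ‖x‖ ^ a * v x ^ p * radialPd v x := by
  have hn : 0 < ‖x‖ := norm_pos_iff.2 hx
  have hdn : DifferentiableAt ℝ (fun y : EuclideanSpace ℝ (Fin N) => ‖y‖ ^ a) x :=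
    (contDiffAt_norm_rpow (n := 1) hx).differentiableAt one_ne_zero
  have hdv : DifferentiableAt ℝ (fun y => v y ^ (p + 1)) x :=
    ((hv.of_le (by norm_num : (1 : WithTop ℕ∞) ≤ 2)).rpow_const_of_ne
      hv0.ne').differentiableAt one_ne_zero
  have hterm : ∀ j, pd j (fun y => (p + 1)⁻¹ * (‖y‖ ^ a * v y ^ (p + 1))) x =
      (p + 1)⁻¹ * (a * ‖x‖ ^ (a - 1) * (x j / ‖x‖) * v x ^ (p + 1) +
        ‖x‖ ^ a * ((p + 1) * v x ^ p * pd j v x)) := fun j => by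
    rw [pd_const_mul _ (hdn.fun_mul hdv), pd_mul hdn hdv,
      pd_comp_norm hx (Real.hasDerivAt_rpow_const (Or.inl hn.ne')),
      pd_comp (Real.hasDerivAt_rpow_const (Or.inl hv0.ne')) (differentiableAt_of_c2 hv),
      add_sub_cancel_right]
  have hsq : ∑ j, x j * x j = ‖x‖ ^ 2 := by
    rw [EuclideanSpace.real_norm_sq_eq]
    exact Finset.sum_congr rfl fun j _ => (sq _).symm
  have hna : ‖x‖ ^ (a - 1) * ‖x‖ = ‖x‖ ^ a := by
    rw [← Real.rpow_add_one hn.ne', sub_add_cancel]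
  simp only [radialPd, hterm]
  calc ∑ j, x j * ((p + 1)⁻¹ * (a * ‖x‖ ^ (a - 1) * (x j / ‖x‖) * v x ^ (p + 1) +
        ‖x‖ ^ a * ((p + 1) * v x ^ p * pd j v x)))
      = ∑ j, ((p + 1)⁻¹ * a * ‖x‖ ^ (a - 1) * ‖x‖⁻¹ * v x ^ (p + 1) * (x j * x j) +
        ‖x‖ ^ a * v x ^ p * (x j * pd j v x)) := Finset.sum_congr rfl fun j _ => by
          field_simp
    _ = _ := by
      rw [Finset.sum_add_distrib, ← Finset.mul_sum, ← Finset.mul_sum, hsq, ← hna]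
      field_simp

lemma IsHHSol.contDiffAt_potentialDensity (h : IsHHSol a b p q univ u v) (hx : x ≠ 0) :
    ContDiffAt ℝ 1 (potentialDensity a b p q u v) x :=
  (contDiffAt_const.mul (contDiffAt_weight_rpow hx (h.swap.contDiffAt hx) (h.swap.pos x))).add
    (contDiffAt_const.mul (contDiffAt_weight_rpow hx (h.contDiffAt hx) (h.pos x)))

lemma IsHHSol.sum_pd_pohozaevField (hp : 0 < p) (hq : 0 < q) (h : IsHHSol a b p q univ u v)
    (hx : x ≠ 0) {c d : ℝ} (hcd : c + d = N - 2) :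
    ∑ i, pd i (pohozaevField c d u v (potentialDensity a b p q u v) i) x =
      ((N + a) / (p + 1) - c) * (‖x‖ ^ a * v x ^ (p + 1)) +
        ((N + b) / (q + 1) - d) * (‖x‖ ^ b * u x ^ (q + 1)) := by
  have hu := h.contDiffAt hx
  have hv := h.swap.contDiffAt hx
  have hP := (contDiffAt_const (c := (p + 1)⁻¹)).mul
    (contDiffAt_weight_rpow (a := a) (p := p) hx hv (h.swap.pos x))
  have hQ := (contDiffAt_const (c := (q + 1)⁻¹)).mul
    (contDiffAt_weight_rpow (a := b) (p := q) hx hu (h.pos x))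
  have hG : radialPd (potentialDensity a b p q u v) x =
      radialPd (fun y => (p + 1)⁻¹ * (‖y‖ ^ a * v y ^ (p + 1))) x +
        radialPd (fun y => (q + 1)⁻¹ * (‖y‖ ^ b * u y ^ (q + 1))) x := by
    simp only [radialPd]
    rw [← Finset.sum_add_distrib]
    refine Finset.sum_congr rfl fun j _ => ?_
    rw [← mul_add, ← pd_add (hP.differentiableAt one_ne_zero) (hQ.differentiableAt one_ne_zero)]
    rfl
  have hlu : lap u x = -(‖x‖ ^ a * v x ^ p) := by linarith [h.neg_lap hx]
  have hlv : lap v x = -(‖x‖ ^ b * u x ^ q) := by linarith [h.swap.neg_lap hx]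
  have hc : (2 - N + c + d : ℝ) = 0 := by linarith
  rw [_root_.sum_pd_pohozaevField hu hv (h.contDiffAt_potentialDensity hx), hG,
    radialPd_weight_rpow hp hx hv (h.swap.pos x), radialPd_weight_rpow hq hx hu (h.pos x),
    hlu, hlv, hc, potentialDensity, Real.rpow_add_one (h.swap.pos x).ne',
    Real.rpow_add_one (h.pos x).ne']
  ring

end Pohozaev

section PotentialBound

variable {N : ℕ} {U f : EuclideanSpace ℝ (Fin N) → ℝ}

/-- The part of `f` that lives near the shell `1 ≤ ‖x‖ ≤ 2`, as an extended nonnegative function. -/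
noncomputable def shellPart (f : EuclideanSpace ℝ (Fin N) → ℝ) :
    EuclideanSpace ℝ (Fin N) → ENNReal :=
  indicator {y | 1 / 2 < ‖y‖ ∧ ‖y‖ < 5 / 2} fun y => ENNReal.ofReal (f y)

lemma measurableSet_shell :
    MeasurableSet {y : EuclideanSpace ℝ (Fin N) | 1 / 2 < ‖y‖ ∧ ‖y‖ < 5 / 2} :=
  (measurableSet_lt measurable_const measurable_norm).inter
    (measurableSet_lt measurable_norm measurable_const)

lemma ofReal_norm_rpow_neg_le {E : Type*} [NormedAddCommGroup E] {m : ℝ} (hm : 0 < m) (z : E) :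
    ENNReal.ofReal (‖z‖ ^ (-m)) ≤ ‖z‖ₑ ^ (-m) := by
  rcases eq_or_ne z 0 with rfl | hz
  · simp [ENNReal.zero_rpow_of_neg (neg_lt_zero.2 hm)]
  · rw [← ofReal_norm, ENNReal.ofReal_rpow_of_pos (norm_pos_iff.2 hz)]

lemma setLIntegral_le_rieszPot {m : ℝ} (hm : 0 < m) (f : EuclideanSpace ℝ (Fin N) → ℝ)
    {x : EuclideanSpace ℝ (Fin N)} (hx : 1 ≤ ‖x‖) (hx2 : ‖x‖ ≤ 2) :
    ∫⁻ y in ball x (1 / 2), ENNReal.ofReal (f y) * ENNReal.ofReal (2 * ‖y - x‖ ^ (-m)) ≤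
      2 * rieszPot m (shellPart f) x := by
  rw [rieszPot, ← lintegral_const_mul' _ _ (by simp)]
  refine (setLIntegral_mono' measurableSet_ball fun y hy => ?_).trans
    (lintegral_mono_set (ball_subset_ball (by norm_num)))
  have hy' : y ∈ {y : EuclideanSpace ℝ (Fin N) | 1 / 2 < ‖y‖ ∧ ‖y‖ < 5 / 2} := by
    rw [mem_ball_iff_norm] at hy
    have h1 := norm_sub_norm_le x y
    have h2 := norm_sub_norm_le y x
    rw [norm_sub_rev] at h1
    constructor <;> linarith
  rw [shellPart, indicator_of_mem hy', ENNReal.ofReal_mul zero_le_two, ENNReal.ofReal_ofNat,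
    mul_left_comm]
  gcongr
  exact ofReal_norm_rpow_neg_le hm _

lemma rieszPot_mono_exponent {m m' : ℝ} (h : m ≤ m') (F : EuclideanSpace ℝ (Fin N) → ENNReal)
    (x : EuclideanSpace ℝ (Fin N)) : rieszPot m F x ≤ rieszPot m' F x := by
  refine setLIntegral_mono' measurableSet_ball fun y hy => ?_
  rw [mem_ball_iff_norm] at hy
  refine mul_le_mul' le_rfl (ENNReal.rpow_le_rpow_of_exponent_ge ?_ (neg_le_neg h))
  rw [← ofReal_norm]
  exact ENNReal.ofReal_le_one.2 hy.le

/-- Pointwise bounds by Riesz potentials on the shell `1 ≤ ‖x‖ ≤ 2`. -/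
lemma exists_potential_bound (hN : 3 ≤ N) : ∃ C : ENNReal, C ≠ ⊤ ∧
    ∀ U f : EuclideanSpace ℝ (Fin N) → ℝ, IsSuperPair U f → ∀ A, ∫ y in ball 0 4, U y ≤ A →
    ∀ x : EuclideanSpace ℝ (Fin N), 1 ≤ ‖x‖ → ‖x‖ ≤ 2 →
      ENNReal.ofReal (U x) ≤ C * (ENNReal.ofReal A + rieszPot (N - 2) (shellPart f) x) ∧
      ENNReal.ofReal (U x + ∑ i, |pd i U x|) ≤
        C * (ENNReal.ofReal A + rieszPot (N - 1) (shellPart f) x) := by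
  obtain ⟨C, hC, hCz⟩ := exists_unitShell_bound N
  have hσ := shellMass_pos hN
  have hσ' : 0 < ENNReal.ofReal (shellMass N) := ENNReal.ofReal_pos.2 hσ
  have hN' : (3 : ℝ) ≤ N := by exact_mod_cast hN
  set B : ENNReal := (ENNReal.ofReal (shellMass N))⁻¹ *
    (ENNReal.ofReal (C * (((1 / 2 : ℝ) ^ N)⁻¹ * (1 / 2 : ℝ)⁻¹)) + 2) with hB
  have hBtop : B ≠ ⊤ := ENNReal.mul_ne_top
    (ENNReal.inv_ne_top.2 hσ'.ne') (by finiteness)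
  refine ⟨(N + 1) * B, by finiteness, fun U f h A hA x hx1 hx2 => ?_⟩
  have hx : x ≠ 0 := norm_pos_iff.1 (by linarith)
  have hsub : ball x (1 / 2) ⊆ ball (0 : EuclideanSpace ℝ (Fin N)) 4 := fun y hy => by
    rw [mem_ball_iff_norm] at hy
    rw [mem_ball_zero_iff]
    linarith [norm_sub_norm_le y x]
  have hAint : ∫ y in ball x (1 / 2), U y ≤ A := by
    refine (setIntegral_mono_set (((h.reg.locallyIntegrable (by omega)).integrableOn_isCompact
      (isCompact_closedBall 0 4)).mono_set ball_subset_closedBall)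
      (Eventually.of_forall h.nonneg) hsub.eventuallyLE).trans hA
  have hA0 : 0 ≤ A := (setIntegral_nonneg measurableSet_ball fun y _ => h.nonneg y).trans hA
  have key : ∀ w c : ℝ, ∀ X : ENNReal, 0 ≤ c → c ≤ C * (((1 / 2 : ℝ) ^ N)⁻¹ * (1 / 2 : ℝ)⁻¹) →
      ENNReal.ofReal (shellMass N * w) ≤
        ENNReal.ofReal (c * ∫ y in ball x (1 / 2), U y) + X →
      ∀ Y, X ≤ 2 * Y → ENNReal.ofReal w ≤ B * (ENNReal.ofReal A + Y) := by
    intro w c X hc0 hc hw Y hXY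
    rw [ENNReal.ofReal_mul hσ.le, mul_comm] at hw
    have h1 := ENNReal.le_div_iff_mul_le (Or.inl hσ'.ne') (Or.inl ENNReal.ofReal_ne_top) |>.2 hw
    refine h1.trans ?_
    rw [ENNReal.div_eq_inv_mul, hB, mul_assoc]
    gcongr
    rw [mul_add, add_mul, add_mul, ← ENNReal.ofReal_mul (by positivity)]
    have h2 : ENNReal.ofReal (c * ∫ y in ball x (1 / 2), U y) ≤
        ENNReal.ofReal (C * (((1 / 2 : ℝ) ^ N)⁻¹ * (1 / 2 : ℝ)⁻¹) * A) :=
      ENNReal.ofReal_le_ofReal (mul_le_mul hc hAint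
        (setIntegral_nonneg measurableSet_ball fun y _ => h.nonneg y) (hc0.trans hc))
    exact add_le_add (h2.trans (le_add_of_nonneg_right zero_le))
      (hXY.trans (le_add_of_nonneg_left zero_le))
  have hRN : ((1 / 2 : ℝ) ^ N)⁻¹ ≤ ((1 / 2 : ℝ) ^ N)⁻¹ * (1 / 2 : ℝ)⁻¹ :=
    le_mul_of_one_le_right (by positivity) (by norm_num)
  have hu : ENNReal.ofReal (U x) ≤
      B * (ENNReal.ofReal A + rieszPot (N - 2) (shellPart f) x) := by
    refine key _ _ _ (by positivity) (mul_le_mul_of_nonneg_left hRN hC.le)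
      (h.upper_potential hN hx (by norm_num : (0 : ℝ) < 1 / 2) fun z => (hCz z).1) _ ?_
    rw [← neg_sub (N : ℝ) 2]
    exact setLIntegral_le_rieszPot (by linarith) f hx1 hx2
  have hg : ∀ i, ENNReal.ofReal |pd i U x| ≤
      B * (ENNReal.ofReal A + rieszPot (N - 1) (shellPart f) x) := fun i => by
    refine key _ _ _ (by positivity) le_rfl
      (h.gradient_potential hN hx (by norm_num : (0 : ℝ) < 1 / 2) i fun z => (hCz z).2 i) _ ?_
    rw [← neg_sub (N : ℝ) 1]
    exact setLIntegral_le_rieszPot (by linarith) f hx1 hx2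
  have hB1 : B ≤ (N + 1) * B := le_mul_of_one_le_left zero_le (by simp)
  refine ⟨hu.trans (by gcongr), ?_⟩
  rw [ENNReal.ofReal_add (h.nonneg x) (by positivity), ENNReal.ofReal_sum_of_nonneg (by simp)]
  calc _ ≤ B * (ENNReal.ofReal A + rieszPot (N - 1) (shellPart f) x) +
        ∑ _i : Fin N, B * (ENNReal.ofReal A + rieszPot (N - 1) (shellPart f) x) := by
        refine add_le_add (hu.trans ?_) (Finset.sum_le_sum fun i _ => hg i)
        gcongr
        exact rieszPot_mono_exponent (by linarith) _ _
    _ = _ := by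
      rw [Finset.sum_const, Finset.card_univ, Fintype.card_fin, nsmul_eq_mul]
      ring

end PotentialBound

section NearOrigin

variable {N : ℕ} {u v : EuclideanSpace ℝ (Fin N) → ℝ} {a b p q : ℝ}

lemma rieszPot_le_of_le {m : ℝ} {F : EuclideanSpace ℝ (Fin N) → ENNReal} {c : ENNReal}
    (hF : ∀ y, F y ≤ c) (x : EuclideanSpace ℝ (Fin N)) :
    rieszPot m F x ≤ c * ∫⁻ z in ball (0 : EuclideanSpace ℝ (Fin N)) 1, ‖z‖ₑ ^ (-m) := by
  calc rieszPot m F x ≤ ∫⁻ y in ball x 1, c * ‖y - x‖ₑ ^ (-m) :=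
        lintegral_mono fun y => mul_le_mul' (hF y) le_rfl
    _ = ∫⁻ z in ball (0 : EuclideanSpace ℝ (Fin N)) 1, c * ‖z‖ₑ ^ (-m) :=
        setLIntegral_ball_comp_sub (fun z => c * ‖z‖ₑ ^ (-m)) x
    _ = _ := lintegral_const_mul _ (by fun_prop)

lemma rpow_le_of_mem_shell (a : ℝ) : ∃ c > 0, ∀ r : ℝ, 1 / 2 < r → r < 5 / 2 → r ^ a ≤ c := by
  refine ⟨(1 / 2) ^ a + (5 / 2) ^ a, by positivity, fun r h1 h2 => ?_⟩
  rcases le_total 0 a with ha | ha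
  · exact (Real.rpow_le_rpow (by linarith) h2.le ha).trans
      (le_add_of_nonneg_left (by positivity))
  · exact (Real.rpow_le_rpow_of_nonpos (by norm_num) h1.le ha).trans
      (le_add_of_nonneg_right (by positivity))

/-- The gradient of a solution is at most of order `‖x‖⁻¹` near the origin. -/
lemma IsHHSol.exists_pd_le (hN : 3 ≤ N) (ha : -2 < a) (hp : 0 < p) (hpq : 1 < p * q)
    (h : IsHHSol a b p q univ u v) :
    ∃ L, ∀ x ≠ 0, ‖x‖ ≤ 1 → ∀ i, |pd i u x| ≤ L * ‖x‖⁻¹ := by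
  obtain ⟨C, hC, hpot⟩ := exists_potential_bound hN
  obtain ⟨c, hc, hca⟩ := rpow_le_of_mem_shell a
  obtain ⟨M₁, hM₁⟩ := h.regular.bounded 4
  obtain ⟨M₂, hM₂⟩ := h.swap.regular.bounded 4
  have hM₁0 : 0 ≤ M₁ := (abs_nonneg _).trans (hM₁ 0 (by simp))
  have hM₂0 : 0 ≤ M₂ := (abs_nonneg _).trans (hM₂ 0 (by simp))
  set V : ℝ := volume.real (ball (0 : EuclideanSpace ℝ (Fin N)) 4)
  set W : ENNReal := ∫⁻ z in ball (0 : EuclideanSpace ℝ (Fin N)) 1, ‖z‖ₑ ^ (-((N : ℝ) - 1))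
  have hW : W ≠ ⊤ := (lintegral_ball_enorm_rpow_lt_top volume
    (by rw [finrank_euclideanSpace_fin]; omega)
    (by rw [finrank_euclideanSpace_fin]; linarith)).ne
  set D : ENNReal := C * (ENNReal.ofReal (M₁ * V) + ENNReal.ofReal (c * M₂ ^ p) * W)
  have hD : D ≠ ⊤ := by finiteness
  refine ⟨D.toReal, fun x hx hx1 i => ?_⟩
  set R := ‖x‖
  have hR : 0 < R := norm_pos_iff.2 hx
  set α := scaleExp a b p q
  set β := scaleExp b a q p
  have hU := h.rescale hpq hR
  have hRα : 0 < R ^ α := Real.rpow_pos_of_pos hR _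
  have hnx : ‖R⁻¹ • x‖ = 1 := by
    rw [norm_smul, norm_inv, Real.norm_of_nonneg hR.le, inv_mul_cancel₀ hR.ne']
  have hRx : R • R⁻¹ • x = x := by rw [smul_smul, mul_inv_cancel₀ hR.ne', one_smul]
  have hball : ∀ y : EuclideanSpace ℝ (Fin N), ‖y‖ ≤ 4 → ‖R • y‖ ≤ 4 := fun y hy => by
    rw [norm_smul, Real.norm_of_nonneg hR.le]
    nlinarith [norm_nonneg y]
  have hA : ∫ y in ball 0 4, R ^ α * u (R • y) ≤ R ^ α * (M₁ * V) := by
    have hint := (h.rescale hpq hR).continuous.continuousOn (s := closedBall 0 4)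
      |>.integrableOn_compact (isCompact_closedBall _ _) (μ := volume) |>.mono_set
      ball_subset_closedBall
    calc _ ≤ ∫ _y in ball (0 : EuclideanSpace ℝ (Fin N)) 4, R ^ α * M₁ := by
          refine setIntegral_mono_on hint (integrableOn_const measure_ball_lt_top.ne)
            measurableSet_ball fun y hy => ?_
          exact mul_le_mul_of_nonneg_left ((le_abs_self _).trans
            (hM₁ _ (hball y (mem_ball_zero_iff.1 hy).le))) hRα.le
      _ = _ := by rw [setIntegral_const, smul_eq_mul]; ring
  have hF : ∀ y, shellPart (fun y => ‖y‖ ^ a * (R ^ β * v (R • y)) ^ p) y ≤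
      ENNReal.ofReal (R ^ α * (c * M₂ ^ p)) := fun y => by
    refine indicator_le (fun y hy => ENNReal.ofReal_le_ofReal ?_) y
    have hv := (le_abs_self _).trans (hM₂ (R • y) (hball y (by linarith [hy.2])))
    rw [Real.mul_rpow (by positivity) (h.swap.pos _).le, ← Real.rpow_mul hR.le,
      ← scaleExp_add hpq, add_assoc, Real.rpow_add hR]
    have hv0 := (h.swap.pos (R • y)).le
    have hya := hca _ hy.1 hy.2
    have hRa := Real.rpow_le_one hR.le hx1 (by linarith : 0 ≤ 2 + a)
    calc ‖y‖ ^ a * (R ^ α * R ^ (2 + a) * v (R • y) ^ p)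
        ≤ c * (R ^ α * 1 * M₂ ^ p) := by
          gcongr
      _ = _ := by ring
  have hmain := (hpot _ _ (hU.isSuperPair hN ha hp) _ hA _ hnx.ge (by rw [hnx]; norm_num)).2
  have hle : ENNReal.ofReal (R ^ α * (|pd i u x| * R)) ≤ ENNReal.ofReal (R ^ α) * D := by
    calc _ ≤ ENNReal.ofReal (R ^ α * u (R • R⁻¹ • x) +
          ∑ i, |pd i (fun y => R ^ α * u (R • y)) (R⁻¹ • x)|) := by
          refine ENNReal.ofReal_le_ofReal ?_
          have h1 := Finset.single_le_sum (f := fun i =>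
            |pd i (fun y => R ^ α * u (R • y)) (R⁻¹ • x)|) (fun _ _ => abs_nonneg _)
            (Finset.mem_univ i)
          have hdu : DifferentiableAt ℝ (fun y => u (R • y)) (R⁻¹ • x) := by
            refine DifferentiableAt.comp (g := u) (f := fun y => R • y) _ ?_ (by fun_prop)
            rw [hRx]
            exact differentiableAt_of_c2 (h.contDiffAt hx)
          have h2 : |pd i (fun y => R ^ α * u (R • y)) (R⁻¹ • x)| = R ^ α * (|pd i u x| * R) := by
            rw [pd_const_mul _ hdu, pd_smul_arg, hRx, abs_mul, abs_mul, abs_of_pos hRα,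
              abs_of_pos hR, mul_comm R]
          have h3 : 0 < R ^ α * u (R • R⁻¹ • x) := mul_pos hRα (h.pos _)
          linarith
      _ ≤ _ := hmain
      _ ≤ C * (ENNReal.ofReal (R ^ α * (M₁ * V)) +
          ENNReal.ofReal (R ^ α * (c * M₂ ^ p)) * W) := by
          gcongr
          exact rieszPot_le_of_le hF _
      _ = _ := by
          rw [ENNReal.ofReal_mul hRα.le, ENNReal.ofReal_mul hRα.le]
          ring
  rw [ENNReal.ofReal_mul hRα.le, ENNReal.mul_le_mul_iff_right
    (ENNReal.ofReal_pos.2 hRα).ne' ENNReal.ofReal_ne_top] at hle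
  rw [← div_eq_mul_inv, le_div_iff₀ hR]
  exact (ENNReal.ofReal_le_iff_le_toReal hD).1 hle

end NearOrigin

section PohozaevInequality

variable {N : ℕ} {u v G : EuclideanSpace ℝ (Fin N) → ℝ} {a b p q : ℝ}

/-- The function `u` plus the sum of the absolute values of its partial derivatives. -/
noncomputable def firstOrder (u : EuclideanSpace ℝ (Fin N) → ℝ) (x : EuclideanSpace ℝ (Fin N)) :
    ℝ :=
  u x + ∑ i, |pd i u x|

/-- The energy density of the system. -/
noncomputable def energyDensity (a b p q : ℝ) (u v : EuclideanSpace ℝ (Fin N) → ℝ)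
    (x : EuclideanSpace ℝ (Fin N)) : ℝ :=
  ‖x‖ ^ a * v x ^ (p + 1) + ‖x‖ ^ b * u x ^ (q + 1)

lemma abs_pd_le_sum (u : EuclideanSpace ℝ (Fin N) → ℝ) (i : Fin N)
    (x : EuclideanSpace ℝ (Fin N)) : |pd i u x| ≤ ∑ j, |pd j u x| :=
  Finset.single_le_sum (f := fun j => |pd j u x|) (fun _ _ => abs_nonneg _) (Finset.mem_univ i)

lemma abs_radialPd_le (u : EuclideanSpace ℝ (Fin N) → ℝ) (x : EuclideanSpace ℝ (Fin N)) :
    |radialPd u x| ≤ ‖x‖ * ∑ j, |pd j u x| := by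
  rw [Finset.mul_sum]
  refine (Finset.abs_sum_le_sum_abs _ _).trans (Finset.sum_le_sum fun j _ => ?_)
  rw [abs_mul]
  exact mul_le_mul_of_nonneg_right (abs_coord_le j) (abs_nonneg _)

lemma abs_gradInner_le (u v : EuclideanSpace ℝ (Fin N) → ℝ) (x : EuclideanSpace ℝ (Fin N)) :
    |gradInner u v x| ≤ (∑ j, |pd j u x|) * ∑ j, |pd j v x| := by
  rw [Finset.sum_mul]
  refine (Finset.abs_sum_le_sum_abs _ _).trans (Finset.sum_le_sum fun j _ => ?_)
  rw [abs_mul]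
  exact mul_le_mul_of_nonneg_left (abs_pd_le_sum v j x) (abs_nonneg _)

lemma abs_pohozaevField_le (c d : ℝ) {x : EuclideanSpace ℝ (Fin N)} (hu : 0 ≤ u x) (hv : 0 ≤ v x)
    (hG : 0 ≤ G x) (i : Fin N) :
    |pohozaevField c d u v G i x| ≤
      ‖x‖ * (3 * ((∑ j, |pd j u x|) * ∑ j, |pd j v x|) + G x) +
        (|c| * (v x * ∑ j, |pd j u x|) + |d| * (u x * ∑ j, |pd j v x|)) := by
  have hS := abs_pd_le_sum u i x
  have hT := abs_pd_le_sum v i x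
  have hRu := abs_radialPd_le u x
  have hRv := abs_radialPd_le v x
  have hD := abs_gradInner_le u v x
  have hxi := abs_coord_le (z := x) i
  set S := ∑ j, |pd j u x|
  set T := ∑ j, |pd j v x|
  have hS0 : 0 ≤ S := (abs_nonneg _).trans hS
  have hT0 : 0 ≤ T := (abs_nonneg _).trans hT
  have h1 : |radialPd v x * pd i u x| ≤ ‖x‖ * T * S := by
    rw [abs_mul]; gcongr
  have h2 : |radialPd u x * pd i v x| ≤ ‖x‖ * S * T := by
    rw [abs_mul]; gcongr
  have h3 : |x i * (G x - gradInner u v x)| ≤ ‖x‖ * (G x + S * T) := by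
    rw [abs_mul]
    gcongr
    refine (abs_sub _ _).trans ?_
    rw [abs_of_nonneg hG]
    gcongr
  have h4 : |c * (v x * pd i u x)| ≤ |c| * (v x * S) := by
    rw [abs_mul, abs_mul, abs_of_nonneg hv]; gcongr
  have h5 : |d * (u x * pd i v x)| ≤ |d| * (u x * T) := by
    rw [abs_mul, abs_mul, abs_of_nonneg hu]; gcongr
  calc _ ≤ |radialPd v x * pd i u x| + |radialPd u x * pd i v x| +
        |x i * (G x - gradInner u v x)| + (|c * (v x * pd i u x)| + |d * (u x * pd i v x)|) :=
        (abs_add_le _ _).trans (add_le_add (abs_add_three _ _ _) (abs_add_le _ _))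
    _ ≤ ‖x‖ * T * S + ‖x‖ * S * T + ‖x‖ * (G x + S * T) +
        (|c| * (v x * S) + |d| * (u x * T)) := by gcongr
    _ = _ := by ring

lemma IsHHSol.potentialDensity_nonneg (hp : 0 < p) (hq : 0 < q) (h : IsHHSol a b p q univ u v)
    (x : EuclideanSpace ℝ (Fin N)) : 0 ≤ potentialDensity a b p q u v x := by
  have h1 := (h.pos x).le
  have h2 := (h.swap.pos x).le
  unfold potentialDensity
  positivity

lemma IsHHSol.energyDensity_nonneg (h : IsHHSol a b p q univ u v)
    (x : EuclideanSpace ℝ (Fin N)) : 0 ≤ energyDensity a b p q u v x := by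
  have h1 := (h.pos x).le
  have h2 := (h.swap.pos x).le
  unfold energyDensity
  positivity

lemma IsHHSol.potentialDensity_le (hp : 0 < p) (hq : 0 < q) (h : IsHHSol a b p q univ u v)
    (x : EuclideanSpace ℝ (Fin N)) :
    potentialDensity a b p q u v x ≤ energyDensity a b p q u v x := by
  have h1 := (h.pos x).le
  have h2 := (h.swap.pos x).le
  exact add_le_add (mul_le_of_le_one_left (by positivity) (inv_le_one_of_one_le₀ (by linarith)))
    (mul_le_of_le_one_left (by positivity) (inv_le_one_of_one_le₀ (by linarith)))

lemma IsHHSol.locallyIntegrable_energyDensity (hN : 3 ≤ N) (ha : -2 < a) (hb : -2 < b) (hp : 0 < p)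
    (hq : 0 < q) (h : IsHHSol a b p q univ u v) :
    LocallyIntegrable (energyDensity a b p q u v) := by
  have : (3 : ℝ) ≤ N := by exact_mod_cast hN
  exact (locallyIntegrable_weight_mul (by omega) (by linarith)
      (h.swap.continuous.rpow_const fun x => Or.inr (by linarith))).add
    (locallyIntegrable_weight_mul (by omega) (by linarith)
      (h.continuous.rpow_const fun x => Or.inr (by linarith)))

lemma IsHHSol.exists_abs_pohozaevField_le (hN : 3 ≤ N) (ha : -2 < a) (hb : -2 < b) (hp : 0 < p)
    (hq : 0 < q) (hpq : 1 < p * q) (h : IsHHSol a b p q univ u v) (c d : ℝ) :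
    ∃ L, ∀ x ≠ 0, ‖x‖ ≤ 1 → ∀ i,
      |pohozaevField c d u v (potentialDensity a b p q u v) i x| ≤ L * ‖x‖⁻¹ := by
  obtain ⟨L₁, hL₁⟩ := h.exists_pd_le hN ha hp hpq
  obtain ⟨L₂, hL₂⟩ := h.swap.exists_pd_le hN hb hq (mul_comm p q ▸ hpq)
  obtain ⟨M₁, hM₁⟩ := h.regular.bounded 1
  obtain ⟨M₂, hM₂⟩ := h.swap.regular.bounded 1
  have hsum : ∀ {w : EuclideanSpace ℝ (Fin N) → ℝ} {L : ℝ} {x : EuclideanSpace ℝ (Fin N)},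
      (∀ i, |pd i w x| ≤ L * ‖x‖⁻¹) → ∑ j, |pd j w x| ≤ N * L * ‖x‖⁻¹ := fun hw => by
    refine (Finset.sum_le_sum fun i _ => hw i).trans_eq ?_
    rw [Finset.sum_const, Finset.card_univ, Fintype.card_fin, nsmul_eq_mul, mul_assoc]
  have hweight : ∀ {a m M w r : ℝ}, -2 < a → 0 < m → 0 < r → r ≤ 1 → 0 ≤ w → w ≤ M →
      r * (r ^ a * w ^ (m + 1)) ≤ M ^ (m + 1) * r⁻¹ := by
    intro a m M w r ha hm hr hr1 hw hwM
    rw [← mul_assoc, mul_comm r, ← Real.rpow_add_one hr.ne', mul_comm, ← Real.rpow_neg_one r]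
    exact mul_le_mul (Real.rpow_le_rpow hw hwM (by linarith))
      (Real.rpow_le_rpow_of_exponent_ge hr hr1 (by linarith)) (by positivity)
      (Real.rpow_nonneg (hw.trans hwM) _)
  refine ⟨3 * ((N * L₁) * (N * L₂)) + (M₂ ^ (p + 1) + M₁ ^ (q + 1)) +
    (|c| * (M₂ * (N * L₁)) + |d| * (M₁ * (N * L₂))), fun x hx hx1 i => ?_⟩
  have hr : 0 < ‖x‖ := norm_pos_iff.2 hx
  have hS := hsum (hL₁ x hx hx1)
  have hT := hsum (hL₂ x hx hx1)
  have hu0 := (h.pos x).le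
  have hv0 := (h.swap.pos x).le
  have hu := (le_abs_self _).trans (hM₁ x hx1)
  have hv := (le_abs_self _).trans (hM₂ x hx1)
  refine (abs_pohozaevField_le c d hu0 hv0 (h.potentialDensity_nonneg hp hq x) i).trans ?_
  have hG : ‖x‖ * potentialDensity a b p q u v x ≤ (M₂ ^ (p + 1) + M₁ ^ (q + 1)) * ‖x‖⁻¹ := by
    refine (mul_le_mul_of_nonneg_left (h.potentialDensity_le hp hq x) hr.le).trans ?_
    rw [energyDensity, mul_add, add_mul]
    exact add_le_add (hweight ha hp hr hx1 hv0 hv) (hweight hb hq hr hx1 hu0 hu)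
  set S := ∑ j, |pd j u x|
  set T := ∑ j, |pd j v x|
  have hS0 : 0 ≤ S := Finset.sum_nonneg fun _ _ => abs_nonneg _
  have hT0 : 0 ≤ T := Finset.sum_nonneg fun _ _ => abs_nonneg _
  have hST : ‖x‖ * (3 * (S * T)) ≤ 3 * ((N * L₁) * (N * L₂)) * ‖x‖⁻¹ := by
    calc _ ≤ ‖x‖ * (3 * ((N * L₁ * ‖x‖⁻¹) * (N * L₂ * ‖x‖⁻¹))) := by
          gcongr
          exact hS0.trans hS
      _ = _ := by field_simp
  have hvS : |c| * (v x * S) ≤ |c| * (M₂ * (N * L₁)) * ‖x‖⁻¹ := by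
    rw [mul_assoc, mul_assoc]
    gcongr
    exact hv0.trans hv
  have huT : |d| * (u x * T) ≤ |d| * (M₁ * (N * L₂)) * ‖x‖⁻¹ := by
    rw [mul_assoc, mul_assoc]
    gcongr
    exact hu0.trans hu
  linarith

/-- The energy in the unit ball is controlled by boundary terms on any large set of radii. -/
lemma exists_pohozaev_bound (hN : 3 ≤ N) (ha : -2 < a) (hb : -2 < b) (hp : 0 < p) (hq : 0 < q)
    (hpq : 1 < p * q) (hsub : (N + a) / (p + 1) + (N + b) / (q + 1) > (N : ℝ) - 2) :
    ∃ C : ENNReal, C ≠ ⊤ ∧ ∀ u v : EuclideanSpace ℝ (Fin N) → ℝ, IsHHSol a b p q univ u v →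
      ∀ K : Set ℝ, IsCompact K → K ⊆ Icc 1 2 → 1 / 2 ≤ volume K →
      ENNReal.ofReal (∫ x in ball 0 1, energyDensity a b p q u v x) ≤
        C * ∫⁻ x in {x : EuclideanSpace ℝ (Fin N) | ‖x‖ ∈ K},
          (ENNReal.ofReal (firstOrder u x) * ENNReal.ofReal (firstOrder v x) +
            ENNReal.ofReal (energyDensity a b p q u v x)) := by
  set ε : ℝ := ((N + a) / (p + 1) + (N + b) / (q + 1) - (N - 2)) / 2 with hε
  have hε0 : 0 < ε := by rw [hε]; linarith
  set c : ℝ := (N + a) / (p + 1) - ε with hc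
  set d : ℝ := (N + b) / (q + 1) - ε with hd
  obtain ⟨D, hD⟩ : ∃ D : ℝ, D = N * (6 + |c| + |d|) := ⟨_, rfl⟩
  have hD0 : 0 ≤ D := by rw [hD]; positivity
  refine ⟨ENNReal.ofReal (2 / ε * D), ENNReal.ofReal_ne_top, fun u v h K hK hK12 hKv => ?_⟩
  set G := potentialDensity a b p q u v
  set e := energyDensity a b p q u v
  obtain ⟨L, hL⟩ := h.exists_abs_pohozaevField_le hN ha hb hp hq hpq c d
  have he0 := h.energyDensity_nonneg
  have hmain := integral_div_le_of_radii hN (Z := pohozaevField c d u v G) (d := fun x => ε * e x)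
    (fun i x hx => (h.contDiffAt hx).pohozaevField (h.swap.contDiffAt hx)
      (h.contDiffAt_potentialDensity hx) c d i)
    (fun x => mul_nonneg hε0.le (he0 x))
    (fun x hx => by
      rw [h.sum_pd_pohozaevField hp hq hx (by rw [hc, hd, hε]; ring)]
      refine le_of_eq ?_
      simp only [hc, hd, e, energyDensity]
      ring)
    (((h.locallyIntegrable_energyDensity hN ha hb hp hq).integrableOn_isCompact
      (isCompact_closedBall 0 1)).mono_set ball_subset_closedBall |>.const_mul ε) hL hK hK12
  have hKr : 1 / 2 ≤ volume.real K := by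
    have := ENNReal.toReal_mono hK.measure_lt_top.ne hKv
    simpa [Measure.real] using this
  rw [integral_const_mul] at hmain
  have hE0 : 0 ≤ ∫ x in ball 0 1, e x := integral_nonneg he0
  have hE : ∫ x in ball 0 1, e x ≤
      2 / ε * ∫ x in {x | ‖x‖ ∈ K}, ∑ i, |pohozaevField c d u v G i x| := by
    rw [div_mul_eq_mul_div, le_div_iff₀ hε0]
    nlinarith [mul_nonneg hε0.le hE0]
  have hmeas : MeasurableSet {x : EuclideanSpace ℝ (Fin N) | ‖x‖ ∈ K} :=
    measurable_norm hK.measurableSet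
  calc _ ≤ ENNReal.ofReal (2 / ε) *
        ENNReal.ofReal (∫ x in {x | ‖x‖ ∈ K}, ∑ i, |pohozaevField c d u v G i x|) := by
        rw [← ENNReal.ofReal_mul (by positivity)]
        exact ENNReal.ofReal_le_ofReal hE
    _ ≤ ENNReal.ofReal (2 / ε) * ∫⁻ x in {x : EuclideanSpace ℝ (Fin N) | ‖x‖ ∈ K},
        ENNReal.ofReal D * (ENNReal.ofReal (firstOrder u x) * ENNReal.ofReal (firstOrder v x) +
            ENNReal.ofReal (e x)) := by
        gcongr
        refine (le_trans ?_ (enorm_integral_le_lintegral_enorm fun x =>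
          ∑ i, |pohozaevField c d u v G i x|)).trans
          (setLIntegral_mono' hmeas fun x hx => ?_)
        · rw [Real.enorm_eq_ofReal_abs]
          exact ENNReal.ofReal_le_ofReal (le_abs_self _)
        rw [Real.enorm_of_nonneg (Finset.sum_nonneg fun _ _ => abs_nonneg _)]
        have hu0 := (h.pos x).le
        have hv0 := (h.swap.pos x).le
        have hS0 : 0 ≤ ∑ j, |pd j u x| := Finset.sum_nonneg fun _ _ => abs_nonneg _
        have hT0 : 0 ≤ ∑ j, |pd j v x| := Finset.sum_nonneg fun _ _ => abs_nonneg _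
        have hfu : 0 ≤ firstOrder u x := add_nonneg hu0 hS0
        have hfv : 0 ≤ firstOrder v x := add_nonneg hv0 hT0
        have hx2 : ‖x‖ ≤ 2 := (hK12 hx).2
        rw [← ENNReal.ofReal_mul hfu, ← ENNReal.ofReal_add (mul_nonneg hfu hfv) (he0 x),
          ← ENNReal.ofReal_mul (by positivity)]
        refine ENNReal.ofReal_le_ofReal ?_
        calc _ ≤ ∑ _i : Fin N, (6 + |c| + |d|) * (firstOrder u x * firstOrder v x + e x) := by
              refine Finset.sum_le_sum fun i _ => ?_
              have hG0 := h.potentialDensity_nonneg hp hq x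
              have hGe : G x ≤ e x := h.potentialDensity_le hp hq x
              refine (abs_pohozaevField_le c d hu0 hv0 hG0 i).trans ?_
              set S := ∑ j, |pd j u x| with hS
              set T := ∑ j, |pd j v x| with hT
              rw [firstOrder, firstOrder, ← hS, ← hT]
              have hX : ‖x‖ * (3 * (S * T) + G x) ≤ 2 * (3 * (S * T) + e x) := by gcongr
              have huv := mul_nonneg hu0 hv0
              have huT := mul_nonneg hu0 hT0
              have hvS := mul_nonneg hv0 hS0
              have hST := mul_nonneg hS0 hT0
              have hc1 : |c| * (v x * S) ≤ |c| * ((u x + S) * (v x + T) + e x) := by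
                gcongr; linarith [he0 x]
              have hd1 : |d| * (u x * T) ≤ |d| * ((u x + S) * (v x + T) + e x) := by
                gcongr; linarith [he0 x]
              linarith [he0 x]
          _ = _ := by
              rw [Finset.sum_const, Finset.card_univ, Fintype.card_fin, nsmul_eq_mul]
              rw [hD]
              ring
    _ = _ := by
        rw [lintegral_const_mul' _ _ ENNReal.ofReal_ne_top, ENNReal.ofReal_mul (q := D)
          (by positivity), mul_assoc]

end PohozaevInequality

section ShellNorms

variable {N : ℕ} {u v f g : EuclideanSpace ℝ (Fin N) → ℝ} {a b p q : ℝ}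

lemma measurable_shellPart (hf : Measurable f) : Measurable (shellPart f) :=
  hf.ennreal_ofReal.indicator measurableSet_shell

lemma lintegral_shellPart_le (hf : LocallyIntegrable f) (hf0 : ∀ x, 0 ≤ f x) {R : ℝ}
    (hR : 5 / 2 ≤ R) : ∫⁻ y, shellPart f y ≤ ENNReal.ofReal (∫ y in ball 0 R, f y) := by
  rw [shellPart, lintegral_indicator measurableSet_shell,
    ofReal_integral_eq_lintegral_ofReal ((hf.integrableOn_isCompact
      (isCompact_closedBall 0 R)).mono_set ball_subset_closedBall) (Eventually.of_forall hf0)]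
  refine lintegral_mono_set fun y hy => ?_
  rw [mem_ball_zero_iff]
  exact hy.2.trans_le hR

lemma shellPart_mono (hfg : ∀ x, f x ≤ g x) (y : EuclideanSpace ℝ (Fin N)) :
    shellPart f y ≤ shellPart g y :=
  indicator_le_indicator (ENNReal.ofReal_le_ofReal (hfg y))

lemma IsHHSol.measurable_rhs (h : IsHHSol a b p q univ u v) (m : ℝ) :
    Measurable fun x => ‖x‖ ^ a * v x ^ m :=
  (measurable_norm.pow_const a).mul (h.swap.continuous.measurable.pow_const m)

lemma shellPart_weight_rpow_le (a p : ℝ) {s : ℝ} (hs : 1 < s) :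
    ∃ c : ENNReal, c ≠ ⊤ ∧ ∀ v : EuclideanSpace ℝ (Fin N) → ℝ, (∀ x, 0 < v x) → ∀ y,
      shellPart (fun y => ‖y‖ ^ a * v y ^ p) y ^ s ≤
        c * (shellPart (fun y => ‖y‖ ^ a * v y ^ p) y ^ (1 - p * (s - 1)) *
          shellPart (fun y => ‖y‖ ^ a * v y ^ (p + 1)) y ^ (p * (s - 1))) := by
  obtain ⟨c, hc, hca⟩ := rpow_le_of_mem_shell (a * (s - 1))
  refine ⟨ENNReal.ofReal c, ENNReal.ofReal_ne_top, fun v hv y => ?_⟩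
  by_cases hy : y ∈ {y : EuclideanSpace ℝ (Fin N) | 1 / 2 < ‖y‖ ∧ ‖y‖ < 5 / 2}
  · have hy0 : 0 < ‖y‖ := lt_trans (by norm_num) hy.1
    have hvy := hv y
    simp only [shellPart, indicator_of_mem hy]
    rw [ENNReal.ofReal_rpow_of_pos (by positivity), ENNReal.ofReal_rpow_of_pos (by positivity),
      ENNReal.ofReal_rpow_of_pos (by positivity), ← ENNReal.ofReal_mul (by positivity),
      ← ENNReal.ofReal_mul hc.le]
    refine ENNReal.ofReal_le_ofReal ?_
    have h1 : (‖y‖ ^ a * v y ^ p) ^ (1 - p * (s - 1)) * (‖y‖ ^ a * v y ^ (p + 1)) ^ (p * (s - 1)) =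
        ‖y‖ ^ a * v y ^ (p * s) := by
      rw [Real.mul_rpow (by positivity) (by positivity), Real.mul_rpow (by positivity)
        (by positivity), ← Real.rpow_mul hy0.le, ← Real.rpow_mul hy0.le, ← Real.rpow_mul hvy.le,
        ← Real.rpow_mul hvy.le, mul_mul_mul_comm, ← Real.rpow_add hy0, ← Real.rpow_add hvy]
      congr 2 <;> ring
    have h2 : (‖y‖ ^ a * v y ^ p) ^ s = ‖y‖ ^ (a * (s - 1)) * (‖y‖ ^ a * v y ^ (p * s)) := by
      rw [Real.mul_rpow (by positivity) (by positivity), ← Real.rpow_mul hy0.le,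
        ← Real.rpow_mul hvy.le, ← mul_assoc, ← Real.rpow_add hy0]
      congr 2; ring
    rw [h1, h2]
    exact mul_le_mul_of_nonneg_right (hca _ hy.1 hy.2) (by positivity)
  · simp only [shellPart, indicator_of_notMem hy]
    rw [ENNReal.zero_rpow_of_pos (by linarith)]
    exact zero_le

lemma IsHHSol.lintegral_shellPart_energy_le (hN : 3 ≤ N) (ha : -2 < a) (hb : -2 < b) (hp : 0 < p)
    (hq : 0 < q) (h : IsHHSol a b p q univ u v) :
    ∫⁻ y, shellPart (fun y => ‖y‖ ^ a * v y ^ (p + 1)) y ≤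
      ENNReal.ofReal (∫ y in ball 0 4, energyDensity a b p q u v y) := by
  refine (lintegral_mono (shellPart_mono fun y => ?_)).trans (lintegral_shellPart_le
    (h.locallyIntegrable_energyDensity hN ha hb hp hq) h.energyDensity_nonneg (by norm_num))
  exact le_add_of_nonneg_right (mul_nonneg (by positivity) (Real.rpow_nonneg (h.pos y).le _))

lemma energyDensity_swap : energyDensity b a q p v u = energyDensity a b p q u v :=
  funext fun _ => add_comm _ _

lemma exists_lintegral_shellPart_le (hN : 3 ≤ N) (ha : -2 < a) (hb : -2 < b) (hp : 0 < p)
    (hq : 0 < q) (hpq : 1 < p * q) : ∃ C : ENNReal, C ≠ ⊤ ∧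
      ∀ u v : EuclideanSpace ℝ (Fin N) → ℝ, IsHHSol a b p q univ u v →
        ∫⁻ y, shellPart (fun y => ‖y‖ ^ a * v y ^ p) y ≤ C := by
  obtain ⟨C, -, hC⟩ := exists_setIntegral_rhs_le hN ha hb hp hq hpq
  refine ⟨ENNReal.ofReal C, ENNReal.ofReal_ne_top, fun u v h => ?_⟩
  have hs := h.isSuperPair hN ha hp
  exact (lintegral_shellPart_le hs.locallyIntegrable hs.rhs_nonneg (by norm_num)).trans
    (ENNReal.ofReal_le_ofReal (hC u v h))

/-- Interpolated bound for the right-hand side on the shell. -/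
lemma exists_lintegral_shellPart_rpow_le (hN : 3 ≤ N) (ha : -2 < a) (hb : -2 < b) (hp : 0 < p)
    (hq : 0 < q) (hpq : 1 < p * q) {s : ℝ} (hs : 1 < s) (hps : p * (s - 1) ≤ 1) :
    ∃ C : ENNReal, C ≠ ⊤ ∧
      ∀ u v : EuclideanSpace ℝ (Fin N) → ℝ, IsHHSol a b p q univ u v →
        ∫⁻ y, shellPart (fun y => ‖y‖ ^ a * v y ^ p) y ^ s ≤
          C * ENNReal.ofReal (∫ y in ball 0 4, energyDensity a b p q u v y) ^ (p * (s - 1)) := by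
  obtain ⟨c, hc, hcv⟩ := shellPart_weight_rpow_le (N := N) a p hs
  obtain ⟨C, hC, hCv⟩ := exists_lintegral_shellPart_le hN ha hb hp hq hpq
  have hθ : 0 ≤ 1 - p * (s - 1) := by linarith
  refine ⟨c * C ^ (1 - p * (s - 1)), by finiteness, fun u v h => ?_⟩
  have hm1 := measurable_shellPart (h.measurable_rhs p)
  have hm2 := measurable_shellPart (h.measurable_rhs (p + 1))
  refine (lintegral_mono fun y => hcv v h.swap.pos y).trans ?_
  rw [lintegral_const_mul' _ _ hc, mul_assoc]
  gcongr
  refine (ENNReal.lintegral_mul_norm_pow_le hm1.aemeasurable hm2.aemeasurable hθ (by nlinarith)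
    (by ring)).trans ?_
  gcongr
  · exact hCv u v h
  · exact h.lintegral_shellPart_energy_le hN ha hb hp hq

end ShellNorms

section PotentialPowers

variable {N : ℕ}

/-- Power bound for a constant plus a Riesz potential, over good radii. -/
lemma exists_setLIntegral_add_rieszPot_le (hN : 3 ≤ N) {A K₀ : ENNReal} (hA : A ≠ ⊤) (hK₀ : K₀ ≠ ⊤)
    {s lam m η : ℝ} (hs : 1 ≤ s) (hlam : s ≤ lam) (hη : 0 < η) (hη1 : η ≤ 1)
    (hm : η ≤ 1 + (N - 1) * (1 / lam + 1 - 1 / s) - m) :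
    ∃ D : ENNReal, D ≠ ⊤ ∧ ∀ (F : EuclideanSpace ℝ (Fin N) → ENNReal) (K : Set ℝ) (J : ENNReal),
      Measurable F → MeasurableSet K → K ⊆ Icc 1 2 → 1 ≤ J → ∫⁻ y, F y ^ s ≤ J →
      (∀ r ∈ K, radialPot (1 - η) (fun y => F y ^ s) r ≤ K₀ * J) →
      ∫⁻ x in {x : EuclideanSpace ℝ (Fin N) | ‖x‖ ∈ K}, (A + rieszPot m F x) ^ lam ≤
        D * J ^ (lam / s) := by
  have hl1 : 1 ≤ lam := hs.trans hlam
  have hs0 : 0 < s := by linarith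
  set W : ENNReal := ∫⁻ z in ball (0 : EuclideanSpace ℝ (Fin N)) 1, ‖z‖ₑ ^ (-((N : ℝ) - η))
  have hW : W ≠ ⊤ := (lintegral_ball_enorm_rpow_lt_top volume
    (by rw [finrank_euclideanSpace_fin]; omega)
    (by rw [finrank_euclideanSpace_fin]; linarith)).ne
  set B : ENNReal := W ^ (1 + lam * (1 - 1 / s)) * K₀ ^ (lam / s - 1)
  have h3 : 0 ≤ 1 - 1 / s := sub_nonneg.2 ((div_le_one hs0).2 hs)
  have h4 : 0 ≤ lam / s - 1 := sub_nonneg.2 ((one_le_div hs0).2 hlam)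
  have hB : B ≠ ⊤ := ENNReal.mul_ne_top (ENNReal.rpow_ne_top_of_nonneg (by positivity) hW)
    (ENNReal.rpow_ne_top_of_nonneg h4 hK₀)
  set V : ENNReal := volume (closedBall (0 : EuclideanSpace ℝ (Fin N)) 2)
  have hV : V ≠ ⊤ := measure_closedBall_lt_top.ne
  refine ⟨2 ^ (lam - 1) * (A ^ lam * V + B), ENNReal.mul_ne_top
    (ENNReal.rpow_ne_top_of_nonneg (by linarith) (by simp)) (ENNReal.add_ne_top.2
    ⟨ENNReal.mul_ne_top (ENNReal.rpow_ne_top_of_nonneg (by linarith) hA) hV, hB⟩),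
    fun F K J hF hK hK12 hJ1 hJ hrad => ?_⟩
  have hpot := setLIntegral_rieszPot_le (by omega) hF hs hlam (by linarith : 0 ≤ 1 - η)
    (m := m) (γ := N - η) (by linarith) hrad hK hJ
  have hmeas : MeasurableSet {x : EuclideanSpace ℝ (Fin N) | ‖x‖ ∈ K} := measurable_norm hK
  have hsub : {x : EuclideanSpace ℝ (Fin N) | ‖x‖ ∈ K} ⊆ closedBall 0 2 := fun x hx =>
    mem_closedBall_zero_iff.2 (hK12 hx).2
  calc _ ≤ ∫⁻ x in {x : EuclideanSpace ℝ (Fin N) | ‖x‖ ∈ K},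
        2 ^ (lam - 1) * (A ^ lam + rieszPot m F x ^ lam) :=
        lintegral_mono fun x => ENNReal.rpow_add_le_mul_rpow_add_rpow _ _ hl1
    _ = 2 ^ (lam - 1) * (A ^ lam * volume {x : EuclideanSpace ℝ (Fin N) | ‖x‖ ∈ K} +
        ∫⁻ x in {x : EuclideanSpace ℝ (Fin N) | ‖x‖ ∈ K}, rieszPot m F x ^ lam) := by
        rw [lintegral_const_mul' _ _ (ENNReal.rpow_ne_top_of_nonneg (by linarith) (by simp)),
          lintegral_add_left measurable_const, setLIntegral_const]
    _ ≤ 2 ^ (lam - 1) * (A ^ lam * V * J ^ (lam / s) + B * J ^ (lam / s)) := by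
        refine mul_le_mul' le_rfl (add_le_add ?_ hpot)
        calc _ ≤ A ^ lam * V := mul_le_mul' le_rfl (measure_mono hsub)
          _ ≤ _ := le_mul_of_one_le_right zero_le
            (ENNReal.one_le_rpow hJ1 (div_pos (by linarith) hs0))
    _ = _ := by ring

lemma radialPot_mono {τ : ℝ} {G H : EuclideanSpace ℝ (Fin N) → ENNReal} (h : ∀ y, G y ≤ H y)
    (r : ℝ) : radialPot τ G r ≤ radialPot τ H r :=
  lintegral_mono fun y => mul_le_mul' (h y) le_rfl

lemma radialPot_const_mul {τ : ℝ} {G : EuclideanSpace ℝ (Fin N) → ENNReal} {c : ENNReal}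
    (hc : c ≠ ⊤) (r : ℝ) : radialPot τ (fun y => c * G y) r = c * radialPot τ G r := by
  simp only [radialPot, mul_assoc]
  exact lintegral_const_mul' _ _ hc

/-- Radii that are good for three densities at once. -/
lemma exists_good_radii_three {τ : ℝ} (hτ0 : 0 ≤ τ) (hτ : τ < 1) : ∃ K₀ : ENNReal, K₀ ≠ ⊤ ∧
    ∀ (G : Fin 3 → EuclideanSpace ℝ (Fin N) → ENNReal) (J : Fin 3 → ENNReal),
      (∀ k, Measurable (G k)) → (∀ k, J k ≠ 0) → (∀ k, J k ≠ ⊤) → (∀ k, ∫⁻ y, G k y ≤ J k) →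
      ∃ K : Set ℝ, IsCompact K ∧ K ⊆ Icc 1 2 ∧ 1 / 2 ≤ volume K ∧
        ∀ k, ∀ r ∈ K, radialPot τ (G k) r ≤ K₀ * J k := by
  obtain ⟨K₀, hK₀, hgood⟩ := exists_good_radii hτ0 hτ
  refine ⟨3 * K₀, by finiteness, fun G J hG hJ0 hJt hGJ => ?_⟩
  have hH : Measurable fun y => 3⁻¹ * ∑ k, (J k)⁻¹ * G k y :=
    (Finset.measurable_sum _ fun k _ => (hG k).const_mul _).const_mul _
  obtain ⟨K, hK, hK12, hKv, hKr⟩ := hgood N _ hH (by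
    rw [lintegral_const_mul' _ _ (by simp), lintegral_finsetSum _ fun k _ => (hG k).const_mul _]
    calc _ ≤ (3 : ENNReal)⁻¹ * ∑ _k : Fin 3, 1 := by
          gcongr with k
          rw [lintegral_const_mul _ (hG k)]
          exact (mul_le_mul' le_rfl (hGJ k)).trans_eq (ENNReal.inv_mul_cancel (hJ0 k) (hJt k))
      _ = 1 := by
          simp only [Finset.sum_const, Finset.card_univ, Fintype.card_fin, nsmul_eq_mul, mul_one]
          exact ENNReal.inv_mul_cancel (by simp) (by simp))
  refine ⟨K, hK, hK12, hKv, fun k r hr => ?_⟩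
  calc radialPot τ (G k) r ≤ radialPot τ (fun y => 3 * J k * (3⁻¹ * ∑ k, (J k)⁻¹ * G k y)) r := by
        refine radialPot_mono (fun y => ?_) r
        calc G k y = 3 * J k * (3⁻¹ * ((J k)⁻¹ * G k y)) := by
              rw [show 3 * J k * (3⁻¹ * ((J k)⁻¹ * G k y)) = 3 * 3⁻¹ * (J k * (J k)⁻¹) * G k y by
                ring, ENNReal.mul_inv_cancel (by simp) (by simp),
                ENNReal.mul_inv_cancel (hJ0 k) (hJt k), one_mul, one_mul]
          _ ≤ _ := by
              gcongr
              exact Finset.single_le_sum (f := fun k => (J k)⁻¹ * G k y) (fun _ _ => zero_le)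
                (Finset.mem_univ k)
    _ = 3 * J k * radialPot τ (fun y => 3⁻¹ * ∑ k, (J k)⁻¹ * G k y) r :=
        radialPot_const_mul (ENNReal.mul_ne_top (by simp) (hJt k)) r
    _ ≤ 3 * J k * K₀ := by gcongr; exact hKr r hr
    _ = _ := by ring

end PotentialPowers

section EnergyBound

variable {N : ℕ} {a b p q : ℝ}

lemma exists_exponent (hN : 3 ≤ N) (hp : 0 < p) (hq : 0 < q)
    (hcrit : ((N : ℝ) - 3) * (p * q - 1) < 2 * (p + 1)) :
    ∃ t, 0 < t ∧ p * (q + 1) * t < 1 ∧ 0 < 3 - N + ((N : ℝ) - 1) * (1 / (q + 1) + t) := by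
  have hN' : (3 : ℝ) ≤ N := by exact_mod_cast hN
  have hn : (0 : ℝ) < N - 1 := by linarith
  have h : max 0 (((N : ℝ) - 3) / (N - 1) - 1 / (q + 1)) < 1 / (p * (q + 1)) := by
    refine max_lt (by positivity) ?_
    rw [sub_lt_iff_lt_add, div_add_div _ _ (by positivity) (by positivity),
      div_lt_div_iff₀ hn (by positivity)]
    have : 0 < q + 1 := by linarith
    nlinarith
  obtain ⟨t, h1, h2⟩ := exists_between h
  rw [max_lt_iff, sub_lt_iff_lt_add', div_lt_iff₀ hn] at h1
  rw [lt_div_iff₀ (by positivity)] at h2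
  exact ⟨t, h1.1, by linarith, by linarith [h1.2]⟩

/-- Power bound for functions dominated by a constant plus a Riesz potential. -/
lemma exists_setLIntegral_rpow_le (hN : 3 ≤ N) {A C K₀ : ENNReal} (hA : A ≠ ⊤) (hC : C ≠ ⊤)
    (hK₀ : K₀ ≠ ⊤) {s lam m η : ℝ} (hs : 1 ≤ s) (hlam : s ≤ lam) (hη : 0 < η) (hη1 : η ≤ 1)
    (hm : η ≤ 1 + (N - 1) * (1 / lam + 1 - 1 / s) - m) :
    ∃ D : ENNReal, D ≠ ⊤ ∧ ∀ (w F : EuclideanSpace ℝ (Fin N) → ENNReal) (K : Set ℝ) (J : ENNReal),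
      (∀ x, 1 ≤ ‖x‖ → ‖x‖ ≤ 2 → w x ≤ C * (A + rieszPot m F x)) →
      Measurable F → MeasurableSet K → K ⊆ Icc 1 2 → 1 ≤ J → ∫⁻ y, F y ^ s ≤ J →
      (∀ r ∈ K, radialPot (1 - η) (fun y => F y ^ s) r ≤ K₀ * J) →
      ∫⁻ x in {x : EuclideanSpace ℝ (Fin N) | ‖x‖ ∈ K}, w x ^ lam ≤ D * J ^ (lam / s) := by
  obtain ⟨D, hD, hDF⟩ := exists_setLIntegral_add_rieszPot_le hN hA hK₀ hs hlam hη hη1 hm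
  have hl : 0 ≤ lam := by linarith
  refine ⟨C ^ lam * D, by finiteness, fun w F K J hw hF hK hK12 hJ1 hJ hrad => ?_⟩
  calc _ ≤ ∫⁻ x in {x : EuclideanSpace ℝ (Fin N) | ‖x‖ ∈ K}, C ^ lam * (A + rieszPot m F x) ^ lam :=
        setLIntegral_mono' (measurable_norm hK) fun x hx => by
          rw [← ENNReal.mul_rpow_of_nonneg _ _ hl]
          exact ENNReal.rpow_le_rpow (hw x (hK12 hx).1 (hK12 hx).2) hl
    _ = C ^ lam * ∫⁻ x in {x : EuclideanSpace ℝ (Fin N) | ‖x‖ ∈ K}, (A + rieszPot m F x) ^ lam :=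
        lintegral_const_mul' _ _ (by finiteness)
    _ ≤ C ^ lam * (D * J ^ (lam / s)) := mul_le_mul' le_rfl (hDF F K J hF hK hK12 hJ1 hJ hrad)
    _ = _ := (mul_assoc _ _ _).symm

lemma exists_solution_potential_bound (hN : 3 ≤ N) (ha : -2 < a) (hb : -2 < b) (hp : 0 < p)
    (hq : 0 < q) (hpq : 1 < p * q) : ∃ A C : ENNReal, A ≠ ⊤ ∧ C ≠ ⊤ ∧
      ∀ u v : EuclideanSpace ℝ (Fin N) → ℝ, IsHHSol a b p q univ u v → ∀ x, 1 ≤ ‖x‖ → ‖x‖ ≤ 2 →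
        ENNReal.ofReal (u x) ≤
          C * (A + rieszPot (N - 2) (shellPart fun y => ‖y‖ ^ a * v y ^ p) x) ∧
        ENNReal.ofReal (firstOrder u x) ≤
          C * (A + rieszPot (N - 1) (shellPart fun y => ‖y‖ ^ a * v y ^ p) x) := by
  obtain ⟨A, -, hA⟩ := exists_setIntegral_le hN hb ha hq hp (mul_comm p q ▸ hpq)
  obtain ⟨C, hC, hCU⟩ := exists_potential_bound hN
  exact ⟨ENNReal.ofReal A, C, ENNReal.ofReal_ne_top, hC, fun u v h =>
    hCU u _ (h.isSuperPair hN ha hp) A (hA v u h.swap)⟩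

lemma measurable_firstOrder {u : EuclideanSpace ℝ (Fin N) → ℝ} (hu : Measurable u) :
    Measurable (firstOrder u) :=
  hu.add (Finset.measurable_fun_sum _ fun _ _ => (measurable_fderiv_apply_const ℝ u _).abs)

lemma ofReal_weight_mul_rpow_le {v : EuclideanSpace ℝ (Fin N) → ℝ} (hv : ∀ x, 0 < v x) {c : ℝ}
    (hc : 0 < c) (hca : ∀ r : ℝ, 1 / 2 < r → r < 5 / 2 → r ^ a ≤ c) {m : ℝ} (hm : 0 ≤ m)
    {x : EuclideanSpace ℝ (Fin N)} (hx1 : 1 ≤ ‖x‖) (hx2 : ‖x‖ ≤ 2) :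
    ENNReal.ofReal (‖x‖ ^ a * v x ^ m) ≤ ENNReal.ofReal c * ENNReal.ofReal (v x) ^ m := by
  rw [ENNReal.ofReal_rpow_of_nonneg (hv x).le hm, ← ENNReal.ofReal_mul hc.le]
  exact ENNReal.ofReal_le_ofReal (mul_le_mul_of_nonneg_right (hca _ (by linarith) (by linarith))
    (Real.rpow_nonneg (hv x).le _))

end EnergyBound

section EnergyBound

variable {N : ℕ} {a b p q : ℝ}

/-- The `v`-part of the energy on good radii is controlled by its `u`-part. -/
lemma exists_setLIntegral_energy_le (hN : 3 ≤ N) (ha : -2 < a) (hb : -2 < b) (hp : 0 < p)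
    (hq : 0 < q) (hpq : 1 < p * q) {K₀ B : ENNReal} (hK₀ : K₀ ≠ ⊤) (hB : B ≠ ⊤) (hB1 : 1 ≤ B)
    {η : ℝ} (hη : 0 < η) (hη1 : η ≤ 1) (hηp : η ≤ 2 / (p + 1)) :
    ∃ D : ENNReal, D ≠ ⊤ ∧ ∀ u v : EuclideanSpace ℝ (Fin N) → ℝ, IsHHSol a b p q univ u v →
      (N ≠ 3 → ∀ x ≠ 0,
        ‖x‖ ^ a * v x ^ (p + 1) ≤ (p + 1) / (q + 1) * (‖x‖ ^ b * u x ^ (q + 1))) →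
      ∀ K : Set ℝ, MeasurableSet K → K ⊆ Icc 1 2 →
      ∫⁻ y, shellPart (fun y => ‖y‖ ^ b * u y ^ q) y ^ (1 : ℝ) ≤ B →
      (∀ r ∈ K, radialPot (1 - η)
        (fun y => shellPart (fun y => ‖y‖ ^ b * u y ^ q) y ^ (1 : ℝ)) r ≤ K₀ * B) →
      ∫⁻ x in {x : EuclideanSpace ℝ (Fin N) | ‖x‖ ∈ K},
          ENNReal.ofReal (energyDensity a b p q u v x) ≤
        D * (1 + ∫⁻ x in {x : EuclideanSpace ℝ (Fin N) | ‖x‖ ∈ K},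
          ENNReal.ofReal (u x) ^ (q + 1)) := by
  obtain ⟨ca, hca, hcar⟩ := rpow_le_of_mem_shell a
  obtain ⟨cb, hcb, hcbr⟩ := rpow_le_of_mem_shell b
  by_cases h3 : N = 3
  · obtain ⟨A, C, hA, hC, hv⟩ := exists_solution_potential_bound hN hb ha hq hp
      (mul_comm p q ▸ hpq)
    obtain ⟨D, hD, hDw⟩ := exists_setLIntegral_rpow_le hN hA hC hK₀ le_rfl
      (by linarith : 1 ≤ p + 1) hη hη1 (m := (N : ℝ) - 2) (by
        subst h3
        refine hηp.trans_eq ?_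
        push_cast
        ring)
    refine ⟨ENNReal.ofReal ca * (D * B ^ ((p + 1) / 1)) + ENNReal.ofReal cb, by finiteness,
      fun u v h _ K hK hK12 hBu hrad => ?_⟩
    have hmeas : MeasurableSet {x : EuclideanSpace ℝ (Fin N) | ‖x‖ ∈ K} := measurable_norm hK
    have hvK := hDw (fun x => ENNReal.ofReal (v x)) _ K B
      (fun x h1 h2 => (hv v u h.swap x h1 h2).1) (measurable_shellPart (h.swap.measurable_rhs q))
      hK hK12 hB1 hBu hrad
    calc _ ≤ ∫⁻ x in {x : EuclideanSpace ℝ (Fin N) | ‖x‖ ∈ K},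
          (ENNReal.ofReal ca * ENNReal.ofReal (v x) ^ (p + 1) +
            ENNReal.ofReal cb * ENNReal.ofReal (u x) ^ (q + 1)) :=
          setLIntegral_mono' hmeas fun x hx => ENNReal.ofReal_add_le.trans (add_le_add
            (ofReal_weight_mul_rpow_le h.swap.pos hca hcar (by linarith) (hK12 hx).1 (hK12 hx).2)
            (ofReal_weight_mul_rpow_le h.pos hcb hcbr (by linarith) (hK12 hx).1 (hK12 hx).2))
      _ = ENNReal.ofReal ca * (∫⁻ x in {x : EuclideanSpace ℝ (Fin N) | ‖x‖ ∈ K},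
            ENNReal.ofReal (v x) ^ (p + 1)) +
          ENNReal.ofReal cb * ∫⁻ x in {x : EuclideanSpace ℝ (Fin N) | ‖x‖ ∈ K},
            ENNReal.ofReal (u x) ^ (q + 1) := by
          rw [lintegral_add_left (((h.swap.continuous.measurable.ennreal_ofReal).pow_const
            _).const_mul _), lintegral_const_mul' _ _ ENNReal.ofReal_ne_top,
            lintegral_const_mul' _ _ ENNReal.ofReal_ne_top]
      _ ≤ _ := by
          rw [add_mul, mul_add, mul_add, mul_one, mul_one]
          exact add_le_add ((mul_le_mul' le_rfl hvK).trans le_self_add) le_add_self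
  · refine ⟨ENNReal.ofReal ((p + 1) / (q + 1) + 1) * ENNReal.ofReal cb, by finiteness,
      fun u v h hcomp K hK hK12 _ _ => ?_⟩
    have hmeas : MeasurableSet {x : EuclideanSpace ℝ (Fin N) | ‖x‖ ∈ K} := measurable_norm hK
    calc _ ≤ ∫⁻ x in {x : EuclideanSpace ℝ (Fin N) | ‖x‖ ∈ K},
          ENNReal.ofReal ((p + 1) / (q + 1) + 1) * ENNReal.ofReal cb *
            ENNReal.ofReal (u x) ^ (q + 1) := setLIntegral_mono' hmeas fun x hx => by
          have hx0 : x ≠ 0 := norm_pos_iff.1 (by linarith [(hK12 hx).1])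
          rw [mul_assoc]
          refine le_trans ?_ (mul_le_mul' le_rfl (ofReal_weight_mul_rpow_le h.pos hcb hcbr
            (by linarith) (hK12 hx).1 (hK12 hx).2))
          rw [← ENNReal.ofReal_mul (by positivity), add_mul, one_mul]
          exact ENNReal.ofReal_le_ofReal (add_le_add_left (hcomp h3 x hx0) _)
      _ = ENNReal.ofReal ((p + 1) / (q + 1) + 1) * ENNReal.ofReal cb *
          ∫⁻ x in {x : EuclideanSpace ℝ (Fin N) | ‖x‖ ∈ K}, ENNReal.ofReal (u x) ^ (q + 1) :=
          lintegral_const_mul' _ _ (by finiteness)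
      _ ≤ _ := mul_le_mul' le_rfl le_add_self

/-- Hölder's inequality with bounds for the two factors. -/
lemma lintegral_mul_le_of_rpow_le {α : Type*} [MeasurableSpace α] {μ : Measure α} {l m : ℝ}
    (hlm : l.HolderConjugate m) {f g : α → ENNReal} (hf : Measurable f) (hg : Measurable g)
    {D E X Y : ENNReal} {s z : ℝ} (hfD : ∫⁻ x, f x ^ l ∂μ ≤ D * X ^ (l / s))
    (hgE : ∫⁻ x, g x ^ m ∂μ ≤ E * Y ^ (m / z)) :
    ∫⁻ x, f x * g x ∂μ ≤ D ^ (1 / l) * E ^ (1 / m) * (X ^ (1 / s) * Y ^ (1 / z)) := by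
  have key : ∀ {l s : ℝ} {D X I : ENNReal}, 0 < l → I ≤ D * X ^ (l / s) →
      I ^ (1 / l) ≤ D ^ (1 / l) * X ^ (1 / s) := by
    intro l s D X I hl h
    refine (ENNReal.rpow_le_rpow h (by positivity)).trans_eq ?_
    rw [ENNReal.mul_rpow_of_nonneg _ _ (by positivity), ← ENNReal.rpow_mul]
    congr 2
    field_simp
  refine (ENNReal.lintegral_mul_le_Lp_mul_Lq μ hlm hf.aemeasurable hg.aemeasurable).trans ?_
  refine (mul_le_mul' (key hlm.pos hfD) (key hlm.symm.pos hgE)).trans_eq ?_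
  ring

/-- Exponents for which the energy estimate improves itself. -/
lemma exists_exponents (hN : 3 ≤ N) (hp : 0 < p) (hq : 0 < q) (hpq : 1 < p * q)
    (hcrit : ((N : ℝ) - 3) * (p * q - 1) < 2 * (p + 1)) :
    ∃ s z l m η θ : ℝ, 1 < s ∧ 1 < z ∧ s ≤ l ∧ z ≤ m ∧ s ≤ q + 1 ∧ l.HolderConjugate m ∧
      p * (s - 1) ≤ 1 ∧ q * (z - 1) = 1 ∧ 0 < η ∧ η ≤ 1 / 2 ∧ η ≤ 2 / (p + 1) ∧
      η ≤ 1 + (N - 1) * (1 / (q + 1) + 1 - 1 / s) - ((N : ℝ) - 2) ∧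
      η ≤ 1 + (N - 1) * (1 / l + 1 - 1 / s) - ((N : ℝ) - 1) ∧
      η ≤ 1 + (N - 1) * (1 / m + 1 - 1 / z) - ((N : ℝ) - 1) ∧
      0 ≤ θ ∧ θ < 1 ∧ p * (s - 1) * ((q + 1) / s) ≤ θ ∧ p * (s - 1) * (1 / s) + 1 / z ≤ θ := by
  obtain ⟨t, ht0, htp, hδ⟩ := exists_exponent hN hp hq hcrit
  set δ : ℝ := 3 - N + ((N : ℝ) - 1) * (1 / (q + 1) + t) with hδdef
  obtain ⟨e, he⟩ : ∃ e, e = 1 / (q + 1) := ⟨_, rfl⟩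
  have he0 : 0 < e := by rw [he]; positivity
  have heq : e * (q + 1) = 1 := by rw [he]; field_simp
  have hte : t ≤ 1 - e := by
    have : t < e * q := by nlinarith
    nlinarith
  have ht1 : 0 < 1 - t := by linarith
  have he1 : e < 1 := by nlinarith
  set η : ℝ := min (δ / 2) (min (2 / (p + 1)) (1 / 2))
  have hη0 : 0 < η := by positivity
  have hηδ : η ≤ δ / 2 := min_le_left _ _
  have hηp : η ≤ 2 / (p + 1) := (min_le_right _ _).trans (min_le_left _ _)
  have hη2 : η ≤ 1 / 2 := (min_le_right _ _).trans (min_le_right _ _)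
  obtain ⟨s, hs⟩ : ∃ s, s = (1 - t)⁻¹ := ⟨_, rfl⟩
  obtain ⟨z, hz⟩ : ∃ z, z = (1 - e)⁻¹ := ⟨_, rfl⟩
  obtain ⟨l, hl⟩ : ∃ l, l = ((1 - t + e) / 2)⁻¹ := ⟨_, rfl⟩
  obtain ⟨m, hm⟩ : ∃ m, m = ((1 + t - e) / 2)⁻¹ := ⟨_, rfl⟩
  have hs' : 1 / s = 1 - t := by rw [hs, one_div, inv_inv]
  have hz' : 1 / z = 1 - e := by rw [hz, one_div, inv_inv]
  have hl' : 1 / l = (1 - t + e) / 2 := by rw [hl, one_div, inv_inv]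
  have hm' : 1 / m = (1 + t - e) / 2 := by rw [hm, one_div, inv_inv]
  have hs1 : 1 < s := by rw [hs]; exact (one_lt_inv₀ ht1).2 (by linarith)
  have hz1 : 1 < z := by rw [hz]; exact (one_lt_inv₀ (by linarith)).2 (by linarith)
  have hsl : s ≤ l := by rw [hs, hl]; exact inv_anti₀ (by linarith) (by linarith)
  have hzm : z ≤ m := by rw [hz, hm]; exact inv_anti₀ (by linarith) (by linarith)
  have hsq : s ≤ q + 1 := by
    rw [hs, inv_le_comm₀ ht1 (by linarith), ← one_div, ← he]
    linarith
  have hlm : l.HolderConjugate m := by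
    rw [Real.holderConjugate_iff]
    refine ⟨hs1.trans_le hsl, ?_⟩
    rw [← one_div, ← one_div, hl', hm']
    ring
  have hst : p * (s - 1) = p * t * s := by
    rw [hs]
    field_simp
    ring
  have hps : p * (s - 1) ≤ 1 := by
    rw [hst, hs, ← div_eq_mul_inv, div_le_one ht1]
    nlinarith
  have hqz : q * (z - 1) = 1 := by
    have : 1 - e = e * q := by linarith
    rw [hz, this]
    field_simp
    linarith
  rw [← he] at hδdef
  have hθ : 0 ≤ p * (q + 1) * t := by positivity
  refine ⟨s, z, l, m, η, max (p * (q + 1) * t) (p * t + (1 - e)), hs1, hz1, hsl, hzm, hsq, hlm,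
    hps, hqz, hη0, hη2, hηp, ?_, ?_, ?_, hθ.trans (le_max_left _ _),
    max_lt htp (by nlinarith), le_trans (le_of_eq ?_) (le_max_left _ _),
    le_trans (le_of_eq ?_) (le_max_right _ _)⟩
  · rw [hs', ← he]; linarith
  · rw [hs', hl']; linarith
  · rw [hz', hm']; linarith
  · rw [hst]; field_simp
  · rw [hst, hz']; field_simp

/-- Self-improving energy estimate. -/
lemma exists_energy_bound (hN : 3 ≤ N) (ha : -2 < a) (hb : -2 < b) (hp : 0 < p) (hq : 0 < q)
    (hpq : 1 < p * q) (hsub : (N + a) / (p + 1) + (N + b) / (q + 1) > (N : ℝ) - 2)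
    (hcrit : ((N : ℝ) - 3) * (p * q - 1) < 2 * (p + 1)) :
    ∃ θ : ℝ, 0 ≤ θ ∧ θ < 1 ∧ ∃ C : ENNReal, C ≠ ⊤ ∧
      ∀ u v : EuclideanSpace ℝ (Fin N) → ℝ, IsHHSol a b p q univ u v →
      (N ≠ 3 → ∀ x ≠ 0,
        ‖x‖ ^ a * v x ^ (p + 1) ≤ (p + 1) / (q + 1) * (‖x‖ ^ b * u x ^ (q + 1))) →
      ENNReal.ofReal (∫ x in ball 0 1, energyDensity a b p q u v x) ≤
        C * (1 + ENNReal.ofReal (∫ x in ball 0 4, energyDensity a b p q u v x)) ^ θ := by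
  have hqp : 1 < q * p := mul_comm p q ▸ hpq
  obtain ⟨s, z, l, m, η, θ, hs1, hz1, hsl, hzm, hsq, hlm, hps, hqz, hη0, hη2, hηp, hη₁, hη₂, hη₃,
    hθ0, hθ1, hθs, hθz⟩ := exists_exponents hN hp hq hpq hcrit
  obtain ⟨A₁, C₁, hA₁, hC₁, hu⟩ := exists_solution_potential_bound hN ha hb hp hq hpq
  obtain ⟨A₂, C₂, hA₂, hC₂, hv⟩ := exists_solution_potential_bound hN hb ha hq hp hqp
  obtain ⟨K₀, hK₀, hgood⟩ := exists_good_radii_three (N := N) (τ := 1 - η) (by linarith)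
    (by linarith)
  obtain ⟨B₁, hB₁, hF⟩ := exists_lintegral_shellPart_rpow_le hN ha hb hp hq hpq hs1 hps
  obtain ⟨B₂, hB₂, hG⟩ := exists_lintegral_shellPart_rpow_le hN hb ha hq hp hqp hz1 hqz.le
  obtain ⟨B₃, hB₃, hG₁⟩ := exists_lintegral_shellPart_le hN hb ha hq hp hqp
  obtain ⟨D₁, hD₁, hI₁⟩ := exists_setLIntegral_rpow_le hN hA₁ hC₁ hK₀ hs1.le hsq hη0
    (by linarith) (m := (N : ℝ) - 2) hη₁
  obtain ⟨D₂, hD₂, hI₂⟩ := exists_setLIntegral_rpow_le hN hA₁ hC₁ hK₀ hs1.le hsl hη0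
    (by linarith) (m := (N : ℝ) - 1) hη₂
  obtain ⟨D₃, hD₃, hI₃⟩ := exists_setLIntegral_rpow_le hN hA₂ hC₂ hK₀ hz1.le hzm hη0
    (by linarith) (m := (N : ℝ) - 1) hη₃
  obtain ⟨D₄, hD₄, hI₄⟩ := exists_setLIntegral_energy_le hN ha hb hp hq hpq hK₀
    (B := 1 + B₃) (by finiteness) le_self_add hη0 (by linarith) hηp
  obtain ⟨P, hP, hPoh⟩ := exists_pohozaev_bound hN ha hb hp hq hpq hsub
  have hs0 : 0 ≤ 1 / s := by positivity
  have hz0 : 0 ≤ 1 / z := by positivity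
  have hqs : 0 ≤ (q + 1) / s := by positivity
  refine ⟨θ, hθ0, hθ1,
    P * (D₂ ^ (1 / l) * D₃ ^ (1 / m) * ((1 + B₁) ^ (1 / s) * (1 + B₂) ^ (1 / z)) +
      D₄ * (1 + D₁ * (1 + B₁) ^ ((q + 1) / s))), ?_, fun u v h hcomp => ?_⟩
  · have := hlm.one_div_nonneg
    have := hlm.symm.one_div_nonneg
    finiteness
  set Φ : ENNReal := 1 + ENNReal.ofReal (∫ x in ball 0 4, energyDensity a b p q u v x) with hΦ
  have hΦ1 : 1 ≤ Φ := le_self_add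
  have hΦt : Φ ≠ ⊤ := by finiteness
  have hJ₁ : (1 : ENNReal) ≤ (1 + B₁) * Φ ^ (p * (s - 1)) :=
    one_le_mul le_self_add (ENNReal.one_le_rpow hΦ1 (mul_pos hp (by linarith)))
  have hJ₂ : (1 : ENNReal) ≤ (1 + B₂) * Φ := one_le_mul le_self_add hΦ1
  have hmF := measurable_shellPart (h.measurable_rhs p)
  have hmG := measurable_shellPart (h.swap.measurable_rhs q)
  have hFJ : ∫⁻ y, shellPart (fun y => ‖y‖ ^ a * v y ^ p) y ^ s ≤ (1 + B₁) * Φ ^ (p * (s - 1)) :=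
    (hF u v h).trans (mul_le_mul' le_add_self (ENNReal.rpow_le_rpow le_add_self (by nlinarith)))
  have hGJ : ∫⁻ y, shellPart (fun y => ‖y‖ ^ b * u y ^ q) y ^ z ≤ (1 + B₂) * Φ := by
    refine (hG v u h.swap).trans ?_
    rw [energyDensity_swap, hqz, ENNReal.rpow_one]
    exact mul_le_mul' le_add_self le_add_self
  have hG₁J : ∫⁻ y, shellPart (fun y => ‖y‖ ^ b * u y ^ q) y ^ (1 : ℝ) ≤ 1 + B₃ := by
    simp only [ENNReal.rpow_one]
    exact (hG₁ v u h.swap).trans le_add_self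
  obtain ⟨K, hK, hK12, hKv, hrad⟩ := hgood
    ![fun y => shellPart (fun y => ‖y‖ ^ a * v y ^ p) y ^ s,
      fun y => shellPart (fun y => ‖y‖ ^ b * u y ^ q) y ^ z,
      fun y => shellPart (fun y => ‖y‖ ^ b * u y ^ q) y ^ (1 : ℝ)]
    ![(1 + B₁) * Φ ^ (p * (s - 1)), (1 + B₂) * Φ, 1 + B₃]
    (fun | 0 => hmF.pow_const _ | 1 => hmG.pow_const _ | 2 => hmG.pow_const _)
    (fun
      | 0 => (zero_lt_one.trans_le hJ₁).ne'
      | 1 => (zero_lt_one.trans_le hJ₂).ne'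
      | 2 => (zero_lt_one.trans_le (le_self_add : (1 : ENNReal) ≤ 1 + B₃)).ne')
    (fun
      | 0 => show (1 + B₁) * Φ ^ (p * (s - 1)) ≠ ⊤ by finiteness
      | 1 => show (1 + B₂) * Φ ≠ ⊤ by finiteness
      | 2 => show 1 + B₃ ≠ ⊤ by finiteness)
    (fun | 0 => hFJ | 1 => hGJ | 2 => hG₁J)
  have hKm := hK.measurableSet
  have hII₁ := hI₁ (fun x => ENNReal.ofReal (u x)) _ K _ (fun x h1 h2 => (hu u v h x h1 h2).1)
    hmF hKm hK12 hJ₁ hFJ (hrad 0)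
  have hII₂ := lintegral_mul_le_of_rpow_le hlm
    (measurable_firstOrder h.continuous.measurable).ennreal_ofReal
    (measurable_firstOrder h.swap.continuous.measurable).ennreal_ofReal
    (hI₂ (fun x => ENNReal.ofReal (firstOrder u x)) _ K _ (fun x h1 h2 => (hu u v h x h1 h2).2)
      hmF hKm hK12 hJ₁ hFJ (hrad 0))
    (hI₃ (fun x => ENNReal.ofReal (firstOrder v x)) _ K _
      (fun x h1 h2 => (hv v u h.swap x h1 h2).2) hmG hKm hK12 hJ₂ hGJ (hrad 1))
  have hII₃ := hI₄ u v h hcomp K hKm hK12 hG₁J (hrad 2)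
  have hJ₁' : ((1 + B₁) * Φ ^ (p * (s - 1))) ^ ((q + 1) / s) ≤
      (1 + B₁) ^ ((q + 1) / s) * Φ ^ θ := by
    rw [ENNReal.mul_rpow_of_nonneg _ _ hqs, ← ENNReal.rpow_mul]
    refine mul_le_mul' le_rfl (ENNReal.rpow_le_rpow_of_exponent_le hΦ1 hθs)
  have hJ₂' : ((1 + B₁) * Φ ^ (p * (s - 1))) ^ (1 / s) * ((1 + B₂) * Φ) ^ (1 / z) ≤
      (1 + B₁) ^ (1 / s) * (1 + B₂) ^ (1 / z) * Φ ^ θ := by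
    rw [ENNReal.mul_rpow_of_nonneg _ _ hs0, ENNReal.mul_rpow_of_nonneg _ _ hz0,
      ← ENNReal.rpow_mul, mul_mul_mul_comm, ← ENNReal.rpow_add _ _ (by positivity) hΦt]
    refine mul_le_mul' le_rfl (ENNReal.rpow_le_rpow_of_exponent_le hΦ1 hθz)
  have hΦθ : 1 ≤ Φ ^ θ := by
    rw [← ENNReal.one_rpow θ]
    exact ENNReal.rpow_le_rpow hΦ1 hθ0
  refine (hPoh u v h K hK hK12 hKv).trans ?_
  have hmuv : Measurable fun x =>
      ENNReal.ofReal (firstOrder u x) * ENNReal.ofReal (firstOrder v x) :=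
    (measurable_firstOrder h.continuous.measurable).ennreal_ofReal.mul
      (measurable_firstOrder h.swap.continuous.measurable).ennreal_ofReal
  rw [mul_assoc, lintegral_add_left hmuv, add_mul]
  refine mul_le_mul' le_rfl (add_le_add ?_ ?_)
  · rw [mul_assoc]
    exact hII₂.trans (mul_le_mul' le_rfl hJ₂')
  · rw [mul_assoc, add_mul, one_mul, mul_assoc]
    exact hII₃.trans (mul_le_mul' le_rfl (add_le_add hΦθ
      (hII₁.trans (mul_le_mul' le_rfl hJ₁'))))

end EnergyBound

section Iteration

lemma log_le_of_iterated_rpow_bound {g : ℕ → ℝ} (hg : ∀ k, 1 ≤ g k) {C θ A B : ℝ} (hC : 0 < C)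
    (hθ0 : 0 ≤ θ) (hθ1 : θ < 1) (h : ∀ k, g k ≤ C * g (k + 1) ^ θ)
    (hgrow : ∀ k : ℕ, Real.log (g k) ≤ A + B * k) :
    Real.log (g 0) ≤ Real.log C / (1 - θ) := by
  set m : ℝ := Real.log C / (1 - θ)
  have hm : m * (1 - θ) = Real.log C := div_mul_cancel₀ _ (by linarith)
  have hg0 : ∀ k, 0 < g k := fun k => zero_lt_one.trans_le (hg k)
  have hstep : ∀ k, Real.log (g k) - m ≤ θ * (Real.log (g (k + 1)) - m) := fun k => by
    have := Real.log_le_log (hg0 k) (h k)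
    rw [Real.log_mul hC.ne' (Real.rpow_pos_of_pos (hg0 _) _).ne', Real.log_rpow (hg0 _)] at this
    linarith
  have hiter : ∀ k, Real.log (g 0) - m ≤ θ ^ k * (Real.log (g k) - m) := fun k => by
    induction k with
    | zero => simp
    | succ k ih =>
      refine ih.trans ?_
      rw [pow_succ, mul_assoc]
      exact mul_le_mul_of_nonneg_left (hstep k) (by positivity)
  have hlim : Tendsto (fun k : ℕ => (A - m) * θ ^ k + B * (k * θ ^ k)) atTop (nhds 0) := by
    simpa using ((tendsto_pow_atTop_nhds_zero_of_lt_one hθ0 hθ1).const_mul (A - m)).add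
      ((tendsto_self_mul_const_pow_of_lt_one hθ0 hθ1).const_mul B)
  refine sub_nonpos.1 (ge_of_tendsto' hlim fun k => (hiter k).trans ?_)
  calc _ ≤ θ ^ k * (A + B * k - m) :=
        mul_le_mul_of_nonneg_left (sub_le_sub_right (hgrow k) m) (by positivity)
    _ = _ := by ring

variable {N : ℕ} {a b p q : ℝ} {u v : EuclideanSpace ℝ (Fin N) → ℝ}

lemma scaleExp_add_sub_pos (hp : 0 < p) (hq : 0 < q) (hpq : 1 < p * q)
    (hsub : (N + a) / (p + 1) + (N + b) / (q + 1) > (N : ℝ) - 2) :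
    0 < scaleExp a b p q + scaleExp b a q p + 2 - N := by
  rw [gt_iff_lt, div_add_div _ _ (by positivity) (by positivity),
    lt_div_iff₀ (by positivity)] at hsub
  rw [scaleExp, scaleExp, mul_comm q p, ← add_div, add_sub_assoc, ← sub_lt_iff_lt_add,
    lt_div_iff₀ (by linarith)]
  linarith

/-- Scaling of the energy. -/
lemma IsHHSol.setIntegral_energyDensity_rescale (hpq : 1 < p * q) (h : IsHHSol a b p q univ u v)
    {R : ℝ} (hR : 0 < R) (r : ℝ) :
    ∫ x in ball 0 r, energyDensity a b p q (fun x => R ^ scaleExp a b p q * u (R • x))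
        (fun x => R ^ scaleExp b a q p * v (R • x)) x =
      R ^ (scaleExp a b p q + scaleExp b a q p + 2 - N) *
        ∫ x in ball 0 (r * R), energyDensity a b p q u v x := by
  have h1 := scaleExp_add (a := a) (b := b) hpq
  have h2 := scaleExp_add (a := b) (b := a) (mul_comm p q ▸ hpq : 1 < q * p)
  have hterm : ∀ (x : EuclideanSpace ℝ (Fin N)) {c e f S w : ℝ}, 0 < w → f * e = S + c →
      ‖x‖ ^ c * (R ^ f * w) ^ e = R ^ S * (‖R • x‖ ^ c * w ^ e) := by
    intro x c e f S w hw hS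
    rw [Real.mul_rpow (by positivity) hw.le, norm_smul, Real.norm_of_nonneg hR.le,
      Real.mul_rpow hR.le (norm_nonneg _), ← Real.rpow_mul hR.le, hS, Real.rpow_add hR]
    ring
  have key : ∀ x, energyDensity a b p q (fun x => R ^ scaleExp a b p q * u (R • x))
      (fun x => R ^ scaleExp b a q p * v (R • x)) x =
      R ^ (scaleExp a b p q + scaleExp b a q p + 2) * energyDensity a b p q u v (R • x) := by
    intro x
    rw [energyDensity, energyDensity, mul_add, hterm x (S := scaleExp a b p q + scaleExp b a q p + 2)
      (h.swap.pos _) (by linarith), hterm x (S := scaleExp a b p q + scaleExp b a q p + 2)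
      (h.pos _) (by linarith)]
  simp only [key]
  rw [integral_const_mul, Measure.setIntegral_comp_smul_of_pos _ _ _ hR, _root_.smul_ball hR.ne',
    finrank_euclideanSpace_fin, smul_zero, Real.norm_of_nonneg hR.le, mul_comm R r, smul_eq_mul,
    Real.rpow_sub hR, Real.rpow_natCast]
  ring

/-- The energy of the rescalings of a bounded solution grows at most polynomially. -/
lemma IsHHSol.exists_energy_growth (hN : 3 ≤ N) (ha : -2 < a) (hb : -2 < b) (hp : 0 < p)
    (hq : 0 < q) (hpq : 1 < p * q) (h : IsHHSol a b p q univ u v) {M : ℝ} (hu : ∀ x, u x ≤ M)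
    (hv : ∀ x, v x ≤ M) : ∃ A d : ℝ, 0 ≤ A ∧ 0 ≤ d ∧ ∀ R : ℝ, 1 ≤ R →
      ∫ x in ball 0 1, energyDensity a b p q (fun x => R ^ scaleExp a b p q * u (R • x))
        (fun x => R ^ scaleExp b a q p * v (R • x)) x ≤ A * R ^ d := by
  have hN' : (3 : ℝ) ≤ N := by exact_mod_cast hN
  have hM : 0 < M := (h.pos 0).trans_le (hu 0)
  have hint : ∀ {c : ℝ}, -2 < c →
      IntegrableOn (fun x : EuclideanSpace ℝ (Fin N) => ‖x‖ ^ c) (ball 0 1) := fun hc =>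
    ((locallyIntegrable_norm_rpow (by omega) (by linarith)).integrableOn_isCompact
      (isCompact_closedBall 0 1)).mono_set ball_subset_closedBall
  have hβ := scaleExp_pos hb ha hq (mul_comm p q ▸ hpq : 1 < q * p)
  have hα := scaleExp_pos ha hb hp hpq
  set α := scaleExp a b p q
  set β := scaleExp b a q p
  set d : ℝ := max (β * (p + 1)) (α * (q + 1))
  set W : EuclideanSpace ℝ (Fin N) → ℝ := fun x => ‖x‖ ^ a * M ^ (p + 1) + ‖x‖ ^ b * M ^ (q + 1)
  have hW : IntegrableOn W (ball 0 1) := ((hint ha).mul_const _).add ((hint hb).mul_const _)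
  have hW0 : ∀ x, 0 ≤ W x := fun x => by positivity
  have hI0 : 0 ≤ ∫ x in ball 0 1, W x := integral_nonneg hW0
  refine ⟨∫ x in ball 0 1, W x, d, hI0, le_max_of_le_left (by positivity), fun R hR => ?_⟩
  have hR0 : 0 < R := by linarith
  have hle : ∀ {e f s : ℝ}, 0 ≤ s → s ≤ M → 0 < e → f * e ≤ d →
      (R ^ f * s) ^ e ≤ M ^ e * R ^ d := by
    intro e f s hs hsM he hd
    rw [Real.mul_rpow (by positivity) hs, ← Real.rpow_mul hR0.le, mul_comm]
    gcongr
  calc _ ≤ ∫ x in ball 0 1, W x * R ^ d := by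
        refine setIntegral_mono_on ?_ (hW.mul_const _) measurableSet_ball fun x _ => ?_
        · exact (((h.rescale hpq hR0).locallyIntegrable_energyDensity hN ha hb hp
            hq).integrableOn_isCompact (isCompact_closedBall 0 1)).mono_set ball_subset_closedBall
        · simp only [W, energyDensity, add_mul, mul_assoc]
          exact add_le_add
            (mul_le_mul_of_nonneg_left (hle (h.swap.pos _).le (hv _) (by linarith)
              (le_max_left _ _)) (by positivity))
            (mul_le_mul_of_nonneg_left (hle (h.pos _).le (hu _) (by linarith)
              (le_max_right _ _)) (by positivity))
    _ = (∫ x in ball 0 1, W x) * R ^ d := integral_mul_const _ _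

lemma IsHHSol.setIntegral_energyDensity_pos (hN : 3 ≤ N) (ha : -2 < a) (hb : -2 < b) (hp : 0 < p)
    (hq : 0 < q) (h : IsHHSol a b p q univ u v) :
    0 < ∫ x in ball 0 1, energyDensity a b p q u v x := by
  have : Nonempty (Fin N) := ⟨⟨0, by omega⟩⟩
  rw [setIntegral_pos_iff_support_of_nonneg_ae (Eventually.of_forall h.energyDensity_nonneg)
    (((h.locallyIntegrable_energyDensity hN ha hb hp hq).integrableOn_isCompact
      (isCompact_closedBall 0 1)).mono_set ball_subset_closedBall)]
  calc 0 < volume (ball (0 : EuclideanSpace ℝ (Fin N)) 1) := measure_ball_pos _ _ one_pos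
    _ = volume (ball (0 : EuclideanSpace ℝ (Fin N)) 1 \ {0}) :=
        (measure_sdiff_null (measure_singleton 0)).symm
    _ ≤ _ := measure_mono fun x hx => by
        have hx0 : 0 < ‖x‖ := norm_pos_iff.2 hx.2
        have hux := h.pos x
        have hvx := h.swap.pos x
        exact ⟨(show 0 < energyDensity a b p q u v x by unfold energyDensity; positivity).ne', hx.1⟩

end Iteration

/-- Theorem 1.1: Liouville theorem for bounded positive solutions of the Hardy–Hénon
system on `ℝ^N`. -/
theorem no_bounded_positive_solution
    (N : ℕ) (hN : 3 ≤ N) (a b p q : ℝ) (ha : -2 < a) (hb : -2 < b)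
    (hq : 0 < q) (hqp : q ≤ p) (hpq : 1 < p * q)
    (hsub : ((N : ℝ) + a) / (p + 1) + ((N : ℝ) + b) / (q + 1) > (N : ℝ) - 2)
    (hextra : 4 ≤ N →
      (0 ≤ a - b ∧ a - b ≤ ((N : ℝ) - 2) * (p - q) ∧
        2 * (p + 1) / (p * q - 1) > (N : ℝ) - 3)) :
    ¬ ∃ u v : EuclideanSpace ℝ (Fin N) → ℝ,
        IsHHSol a b p q (univ : Set (EuclideanSpace ℝ (Fin N))) u v ∧
        (∃ M, ∀ x, u x ≤ M) ∧ (∃ M, ∀ x, v x ≤ M) := by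
  rintro ⟨u, v, h, ⟨M₁, hu⟩, ⟨M₂, hv⟩⟩
  have hp : 0 < p := hq.trans_le hqp
  have hcrit : ((N : ℝ) - 3) * (p * q - 1) < 2 * (p + 1) := by
    rcases hN.eq_or_lt with rfl | h4
    · push_cast; linarith
    · exact (lt_div_iff₀ (by linarith)).1 (hextra h4).2.2
  obtain ⟨θ, hθ0, hθ1, C, hC, hbound⟩ := exists_energy_bound hN ha hb hp hq hpq hsub hcrit
  set κ : ℝ := scaleExp a b p q + scaleExp b a q p + 2 - N with hκdef
  have hκ : 0 < κ := scaleExp_add_sub_pos hp hq hpq hsub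
  set E : ℝ → ℝ := fun R => ∫ x in ball 0 R, energyDensity a b p q u v x with hE
  have hE0 : ∀ R, 0 ≤ E R := fun R => integral_nonneg h.energyDensity_nonneg
  have hEmono : ∀ R, 1 ≤ R → E 1 ≤ E R := fun R hR => setIntegral_mono_set
    (((h.locallyIntegrable_energyDensity hN ha hb hp hq).integrableOn_isCompact
      (isCompact_closedBall 0 R)).mono_set ball_subset_closedBall)
    (Eventually.of_forall h.energyDensity_nonneg) (ball_subset_ball hR).eventuallyLE
  obtain ⟨A, d, hA, hd, hgrow⟩ := h.exists_energy_growth hN ha hb hp hq hpq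
    (fun x => (hu x).trans (le_max_left M₁ M₂)) fun x => (hv x).trans (le_max_right M₁ M₂)
  set y : ℝ → ℝ := fun R => 1 + R ^ κ * E R with hy
  have hy1 : ∀ R, 0 < R → 1 ≤ y R := fun R hR =>
    le_add_of_nonneg_right (mul_nonneg (by positivity) (hE0 R))
  have hygrow : ∀ R, 1 ≤ R → y R ≤ (1 + A) * R ^ d := fun R hR => by
    have h1 := hgrow R hR
    rw [h.setIntegral_energyDensity_rescale hpq (by linarith), one_mul] at h1
    have h2 := Real.one_le_rpow hR hd
    rw [add_mul, one_mul]
    exact add_le_add h2 h1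
  have hstep : ∀ R, 0 < R → y R ≤ (1 + C).toReal * y (R * 4) ^ θ := fun R hR => by
    have h1 := hbound _ _ (h.rescale hpq hR) fun h3 x hx =>
      (h.rescale hpq hR).comparison hN ha hb hq hqp hpq (hextra (by omega)).1
        (hextra (by omega)).2.1 (fun x => mul_le_mul_of_nonneg_left (hv _) (by positivity)) hx
    rw [h.setIntegral_energyDensity_rescale hpq hR, h.setIntegral_energyDensity_rescale hpq hR,
      one_mul, mul_comm 4 R] at h1
    have hy4 := hy1 (R * 4) (by positivity)
    have h2 : 1 + ENNReal.ofReal (R ^ κ * E (R * 4)) ≤ ENNReal.ofReal (y (R * 4)) := by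
      rw [← ENNReal.ofReal_one, ← ENNReal.ofReal_add zero_le_one
        (mul_nonneg (by positivity) (hE0 _))]
      refine ENNReal.ofReal_le_ofReal (add_le_add le_rfl (mul_le_mul_of_nonneg_right ?_ (hE0 _)))
      exact Real.rpow_le_rpow hR.le (by linarith) hκ.le
    have h3 : (1 : ENNReal) ≤ ENNReal.ofReal (y (R * 4)) ^ θ := by
      rw [← ENNReal.one_rpow θ]
      exact ENNReal.rpow_le_rpow (ENNReal.one_le_ofReal.2 hy4) hθ0
    refine (ENNReal.ofReal_le_ofReal_iff (by positivity)).1 ?_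
    rw [ENNReal.ofReal_mul (by positivity), ENNReal.ofReal_toReal (by finiteness),
      ← ENNReal.ofReal_rpow_of_nonneg (by linarith) hθ0, add_mul, one_mul]
    refine (ENNReal.ofReal_add_le).trans (add_le_add (by simpa using h3) (h1.trans ?_))
    exact mul_le_mul' le_rfl (ENNReal.rpow_le_rpow h2 hθ0)
  have hC0 : 0 < (1 + C).toReal := ENNReal.toReal_pos (by simp) (by finiteness)
  have hlog : ∀ R, 1 ≤ R → Real.log (y R) ≤ Real.log (1 + C).toReal / (1 - θ) := fun R hR => by
    have hR4 : ∀ k : ℕ, 1 ≤ R * 4 ^ k := fun k => one_le_mul_of_one_le_of_one_le hR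
      (one_le_pow₀ (by norm_num))
    have := log_le_of_iterated_rpow_bound (g := fun k => y (R * 4 ^ k))
      (A := Real.log (1 + A) + d * Real.log R) (B := d * Real.log 4)
      (fun k => hy1 _ (by positivity)) hC0 hθ0 hθ1
      (fun k => (hstep _ (by positivity)).trans_eq (by rw [pow_succ, mul_assoc]))
      (fun k => by
        refine (Real.log_le_log (zero_lt_one.trans_le (hy1 _ (by positivity)))
          (hygrow _ (hR4 k))).trans_eq ?_
        rw [Real.log_mul (by positivity) (by positivity), Real.log_rpow (by positivity),
          Real.log_mul (by positivity) (by positivity), Real.log_pow]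
        ring)
    simpa using this
  have hlim := (tendsto_rpow_atTop hκ).atTop_mul_const
    (h.setIntegral_energyDensity_pos hN ha hb hp hq)
  obtain ⟨R, hR1, hR⟩ := ((eventually_ge_atTop 1).and (hlim.eventually_gt_atTop
    (Real.exp (Real.log (1 + C).toReal / (1 - θ))))).exists
  have h1 := (Real.log_le_iff_le_exp (zero_lt_one.trans_le (hy1 R (by linarith)))).1 (hlog R hR1)
  have h2 : R ^ κ * E 1 ≤ R ^ κ * E R := mul_le_mul_of_nonneg_left (hEmono R hR1) (by positivity)
  exact absurd (hR.trans_le (h2.trans ((le_add_of_nonneg_left zero_le_one).trans h1)))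
    (lt_irrefl _)
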